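/- arXiv:math-ph/0501067 — 3 statements merged into one kernel-verified Lean document; each statement's English description precedes it below -/
import Mathlib

section
/- Let q ≥ 4 be an integer and let h < 0. Then: (1) every global minimizer of Φ_{β,h}^{(q)} on Δ_q is a permutation in the last q−1 coordinates of a vector satisfying x₁ < x₂ = ... = x_{q−1} ≤ x_q. Moreover, there exists a function β₋ : (−∞, 0) → (0, ∞) such that: (2) for all β < β₋(h) there is a unique global minimizer, and it satisfies x₂ = ... = x_q; writing x₁ = 1/q − m and x_k = 1/q + m/(q−1) for k = 2,...,q, the quantity θ = (q/(q−1)) m satisfies θ = (e^{βθ−h} − 1)/((q−1)e^{βθ−h} + 1), and there is exactly one θ ∈ [0, 1/(q−1)] satisfying this equation; (3) for all β > β₋(h) there are exactly q−1 global minimizers, which are the permutations in the last q−1 coordinates of a single vector with x₁ < x₂ = ... = x_{q−1} < x_q; (4) at β = β₋(h) there are exactly q global minimizers: one symmetric as in (2) and q−1 asymmetric as in (3); (5) h ↦ β₋(h) is strictly increasing and continuous on (−∞, 0), with β₋(h) → β_MF^{(q−1)} as h → −∞ and β₋(h) → β_MF^{(q)} as h ↑ 0. -/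
open Real Set Filter Topology

noncomputable section

/-- The probability simplex `Δ_q`. -/
def pottsSimplex (q : ℕ) : Set (Fin q → ℝ) :=
  {x | (∀ k, 0 ≤ x k) ∧ ∑ k, x k = 1}

/-- The mean-field free-energy function `Φ_{β,h}^{(q)}` of the `q`-state Potts model. -/
noncomputable def pottsPhi (q : ℕ) [NeZero q] (β h : ℝ) (x : Fin q → ℝ) : ℝ :=
  (∑ k, (-(β / 2) * x k ^ 2 + x k * Real.log (x k))) - h * x 0

/-- `x` is a global minimizer of `Φ_{β,h}^{(q)}` on `Δ_q`. -/
def IsPottsMinimizer (q : ℕ) [NeZero q] (β h : ℝ) (x : Fin q → ℝ) : Prop :=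
  x ∈ pottsSimplex q ∧ ∀ y ∈ pottsSimplex q, pottsPhi q β h x ≤ pottsPhi q β h y

/-- The mean-field transition coupling `β_MF^{(q)} = 2 (q-1)/(q-2) log (q-1)`. -/
noncomputable def betaMF (q : ℕ) : ℝ :=
  2 * (((q : ℝ) - 1) / ((q : ℝ) - 2)) * Real.log ((q : ℝ) - 1)

/-- The last coordinate index of `Fin q` (corresponding to `x_q`). -/
def lastIdx (q : ℕ) [NeZero q] : Fin q :=
  ⟨q - 1, Nat.sub_lt (Nat.pos_of_ne_zero (NeZero.ne q)) Nat.one_pos⟩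

/-- `k` is one of the "middle" indices `2,…,q-1` (i.e. `1,…,q-2` in 0-based indexing). -/
def IsMid (q : ℕ) [NeZero q] (k : Fin q) : Prop := k ≠ 0 ∧ k ≠ lastIdx q

/-- The form `x₁ < x₂ = … = x_{q-1} ≤ x_q`. -/
def NegOrderedForm (q : ℕ) [NeZero q] (x : Fin q → ℝ) : Prop :=
  (∀ j k : Fin q, IsMid q j → IsMid q k → x j = x k) ∧
  (∀ j : Fin q, IsMid q j → x 0 < x j) ∧
  (∀ j : Fin q, IsMid q j → x j ≤ x (lastIdx q))

/-- The (strictly) asymmetric form `x₁ < x₂ = … = x_{q-1} < x_q`. -/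
def AsymForm (q : ℕ) [NeZero q] (x : Fin q → ℝ) : Prop :=
  (∀ j k : Fin q, IsMid q j → IsMid q k → x j = x k) ∧
  (∀ j : Fin q, IsMid q j → x 0 < x j) ∧
  (∀ j : Fin q, IsMid q j → x j < x (lastIdx q))

/-- The symmetric form `x₂ = … = x_q`. -/
def SymForm (q : ℕ) [NeZero q] (x : Fin q → ℝ) : Prop :=
  ∀ j k : Fin q, j ≠ 0 → k ≠ 0 → x j = x k

/-- `θ` solves the negative-field mean-field equation
`θ = (e^{βθ-h} - 1)/((q-1) e^{βθ-h} + 1)`. -/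
def GEq (q : ℕ) (β h θ : ℝ) : Prop :=
  θ = (Real.exp (β * θ - h) - 1) / (((q : ℝ) - 1) * Real.exp (β * θ - h) + 1)

/-- For `p ≥ 1`, the function `θ ↦ log ((1 + θ) / (1 - p θ))` is convex on `[0, 1/p)`. -/
lemma convexOn_log_one_add_sub_log {p : ℝ} (hp : 1 ≤ p) :
    ConvexOn ℝ (Ico 0 (1 / p)) (fun θ ↦ log (1 + θ) - log (1 - p * θ)) := by
  have hp0 : 0 < p := by linarith
  have key : ∀ θ ∈ Ico 0 (1 / p), 0 < 1 + θ ∧ 0 < 1 - p * θ := by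
    rintro θ ⟨h0, h1⟩
    rw [lt_div_iff₀ hp0] at h1
    constructor <;> nlinarith
  have hd : ∀ θ ∈ Ico 0 (1 / p), HasDerivAt (fun θ ↦ log (1 + θ) - log (1 - p * θ))
      (1 / (1 + θ) - (-p) / (1 - p * θ)) θ := by
    intro θ hθ
    obtain ⟨h1, h2⟩ := key θ hθ
    have e1 : HasDerivAt (fun θ : ℝ ↦ 1 + θ) 1 θ := by
      simpa using (hasDerivAt_id θ).const_add 1
    have e2 : HasDerivAt (fun θ : ℝ ↦ 1 - p * θ) (-p) θ := by
      simpa using ((hasDerivAt_id θ).const_mul p).const_sub 1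
    exact (e1.log h1.ne').sub (e2.log h2.ne')
  refine MonotoneOn.convexOn_of_deriv (convex_Ico _ _)
    (fun θ hθ ↦ (hd θ hθ).continuousAt.continuousWithinAt)
    (fun θ hθ ↦ (hd θ (interior_subset hθ)).differentiableAt.differentiableWithinAt) ?_
  intro x hx y hy hxy
  have hx' := interior_subset hx
  have hy' := interior_subset hy
  rw [(hd x hx').deriv, (hd y hy').deriv]
  obtain ⟨x1, x2⟩ := key x hx'
  obtain ⟨y1, y2⟩ := key y hy'
  have e : ∀ z : ℝ, 0 < 1 + z → 0 < 1 - p * z →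
      1 / (1 + z) - (-p) / (1 - p * z) = (1 + p) / ((1 + z) * (1 - p * z)) := by
    intro z h1 h2
    rw [div_sub_div _ _ h1.ne' h2.ne']
    ring
  rw [e x x1 x2, e y y1 y2]
  apply div_le_div_of_nonneg_left (by linarith) (mul_pos y1 y2)
  nlinarith [hx'.1, hy'.1, mul_nonneg (sub_nonneg.2 hxy) hx'.1,
    mul_nonneg (sub_nonneg.2 hxy) hy'.1, mul_nonneg (sub_nonneg.2 hxy) (sub_nonneg.2 hp)]

/-- The even binary entropy lies above its tangent line in the variable `τ ^ 2`. -/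
lemma binary_entropy_ge_tangent_sq {τ₀ τ : ℝ} (h0 : 0 < τ₀) (h1 : τ₀ < 1) (hτ : |τ| < 1) :
    (1 + τ₀) * log (1 + τ₀) + (1 - τ₀) * log (1 - τ₀)
      + (log (1 + τ₀) - log (1 - τ₀)) / (2 * τ₀) * (τ ^ 2 - τ₀ ^ 2)
      ≤ (1 + τ) * log (1 + τ) + (1 - τ) * log (1 - τ) := by
  set l := (log (1 + τ₀) - log (1 - τ₀)) / τ₀ with hl
  clear_value l
  set J : ℝ → ℝ := fun τ ↦ (1 + τ) * log (1 + τ) + (1 - τ) * log (1 - τ) - l / 2 * τ ^ 2 with hJ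
  have hd : ∀ x ∈ Ico (0 : ℝ) 1, HasDerivAt J (log (1 + x) - log (1 - x) - l * x) x := by
    rintro x ⟨hx0, hx1⟩
    have e1 : HasDerivAt (fun x : ℝ ↦ 1 + x) 1 x := by simpa using (hasDerivAt_id x).const_add 1
    have e2 : HasDerivAt (fun x : ℝ ↦ 1 - x) (-1) x := by simpa using (hasDerivAt_id x).const_sub 1
    have p1 : (1 : ℝ) + x ≠ 0 := by linarith
    have p2 : (1 : ℝ) - x ≠ 0 := by linarith
    have := ((e1.mul (e1.log p1)).add (e2.mul (e2.log p2))).sub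
      ((hasDerivAt_pow 2 x).const_mul (l / 2))
    refine this.congr_deriv ?_
    field_simp
    ring
  have hconv := convexOn_log_one_add_sub_log (le_refl (1 : ℝ))
  simp only [one_mul, div_one] at hconv
  have hl' : l * τ₀ = log (1 + τ₀) - log (1 - τ₀) := by rw [hl]; field_simp
  have hlow : ∀ x, 0 ≤ x → x ≤ τ₀ → log (1 + x) - log (1 - x) ≤ l * x := by
    intro x hx hx'
    have := hconv.2 ⟨le_refl _, one_pos⟩ ⟨h0.le, h1⟩
      (by rw [sub_nonneg, div_le_one h0]; exact hx' : 0 ≤ 1 - x / τ₀)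
      (by positivity : 0 ≤ x / τ₀) (by ring)
    simp only [smul_eq_mul, mul_zero, zero_add, add_zero, sub_zero, log_one] at this
    rw [div_mul_cancel₀ _ h0.ne', ← hl'] at this
    calc _ ≤ _ := this
      _ = l * x := by field_simp
  have hhigh : ∀ x, τ₀ ≤ x → x < 1 → l * x ≤ log (1 + x) - log (1 - x) := by
    intro x hx hx'
    have hx0 : 0 < x := h0.trans_le hx
    have := hconv.2 ⟨le_refl _, one_pos⟩ ⟨hx0.le, hx'⟩
      (by rw [sub_nonneg, div_le_one hx0]; exact hx : 0 ≤ 1 - τ₀ / x)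
      (by positivity : 0 ≤ τ₀ / x) (by ring)
    simp only [smul_eq_mul, mul_zero, zero_add, add_zero, sub_zero, log_one] at this
    rw [div_mul_cancel₀ _ hx0.ne', ← hl', div_mul_eq_mul_div, le_div_iff₀ hx0] at this
    have h2 : τ₀ * (l * x) ≤ τ₀ * (log (1 + x) - log (1 - x)) := by linarith
    exact le_of_mul_le_mul_left h2 h0
  have main : ∀ x, 0 ≤ x → x < 1 → J τ₀ ≤ J x := by
    intro x hx hx'
    rcases le_total x τ₀ with h | h
    · have : AntitoneOn J (Icc 0 τ₀) := by
        refine antitoneOn_of_deriv_nonpos (convex_Icc _ _)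
          (fun y hy ↦ (hd y ⟨hy.1, hy.2.trans_lt h1⟩).continuousAt.continuousWithinAt)
          (fun y hy ↦ ?_) (fun y hy ↦ ?_)
        · have hy := interior_subset hy
          exact (hd y ⟨hy.1, hy.2.trans_lt h1⟩).differentiableAt.differentiableWithinAt
        · have hy := interior_subset hy
          rw [(hd y ⟨hy.1, hy.2.trans_lt h1⟩).deriv]
          linarith [hlow y hy.1 hy.2]
      exact this ⟨hx, h⟩ ⟨h0.le, le_refl _⟩ h
    · have : MonotoneOn J (Ico τ₀ 1) := by
        refine monotoneOn_of_deriv_nonneg (convex_Ico _ _)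
          (fun y hy ↦ (hd y ⟨h0.le.trans hy.1, hy.2⟩).continuousAt.continuousWithinAt)
          (fun y hy ↦ ?_) (fun y hy ↦ ?_)
        · have hy := interior_subset hy
          exact (hd y ⟨h0.le.trans hy.1, hy.2⟩).differentiableAt.differentiableWithinAt
        · have hy := interior_subset hy
          rw [(hd y ⟨h0.le.trans hy.1, hy.2⟩).deriv]
          linarith [hhigh y hy.1 hy.2]
      exact this ⟨le_refl _, h1⟩ ⟨h, hx'⟩ h
  have heven : J |τ| = J τ := by
    rcases abs_cases τ with ⟨h, -⟩ | ⟨h, -⟩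
    · rw [h]
    · rw [h]; simp only [hJ]; ring_nf
  have := main |τ| (abs_nonneg _) hτ
  rw [heven] at this
  simp only [hJ] at this
  have e : (log (1 + τ₀) - log (1 - τ₀)) / (2 * τ₀) = l / 2 := by rw [hl]; field_simp
  rw [e]
  linarith

/-- The transition coupling of the zero-field model with `m + 1` states, for real `m`. -/
def zeroFieldCoupling (m : ℝ) : ℝ := 2 * (m / (m - 1)) * log m

lemma zeroFieldCoupling_pos {m : ℝ} (hm : 1 < m) : 0 < zeroFieldCoupling m := by
  have := log_pos hm
  have : 0 < m - 1 := by linarith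
  unfold zeroFieldCoupling
  positivity

lemma zeroFieldCoupling_lt {m : ℝ} (hm : 1 < m) : zeroFieldCoupling m < m + 1 := by
  have h1 := self_lt_sinh_iff.2 (log_pos hm)
  have hm1 : 0 < m - 1 := by linarith
  rw [sinh_log (by linarith)] at h1
  unfold zeroFieldCoupling
  calc 2 * (m / (m - 1)) * log m < 2 * (m / (m - 1)) * ((m - m⁻¹) / 2) := by
        gcongr
    _ = m + 1 := by field_simp; ring

/-- Entropy inequality for the zero-field model at its transition coupling, restricted to vectors
with one coordinate `b` and `m` coordinates `a`. -/
lemma zeroField_entropy_ge {m a b : ℝ} (hm : 1 < m) (ha : 0 < a) (hb : 0 < b) :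
    zeroFieldCoupling m / (2 * (b + m * a)) * (b ^ 2 + m * a ^ 2 - (b + m * a) ^ 2 / (m + 1))
      ≤ b * log b + m * (a * log a) - (b + m * a) * log ((b + m * a) / (m + 1)) := by
  have hm0 : 0 < m := by linarith
  have hm1 : 0 < m - 1 := by linarith
  have hs : 0 < b + m * a := by positivity
  have e1 : 1 + (b - m * a) / (b + m * a) = 2 * b / (b + m * a) := by field_simp; ring
  have e2 : 1 - (b - m * a) / (b + m * a) = 2 * (m * a) / (b + m * a) := by field_simp; ring
  have e3 : 1 + (m - 1) / (m + 1) = 2 * m / (m + 1) := by field_simp; ring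
  have e4 : 1 - (m - 1) / (m + 1) = 2 / (m + 1) := by field_simp; ring
  have key := binary_entropy_ge_tangent_sq (τ₀ := (m - 1) / (m + 1))
    (τ := (b - m * a) / (b + m * a)) (by positivity)
    (by rw [div_lt_one (by positivity)]; linarith)
    (by
      rw [abs_lt]
      have p1 : 0 < 2 * b / (b + m * a) := by positivity
      have p2 : 0 < 2 * (m * a) / (b + m * a) := by positivity
      constructor <;> linarith)
  rw [e1, e2, e3, e4, log_div (by positivity) (by positivity), log_div (by positivity) hs.ne',
    log_div (by positivity) (by positivity), log_div (by positivity) hs.ne',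
    log_mul two_ne_zero hm0.ne', log_mul two_ne_zero hb.ne', log_mul two_ne_zero (by positivity),
    log_mul hm0.ne' ha.ne'] at key
  rw [log_div hs.ne' (by positivity)]
  unfold zeroFieldCoupling
  have h2 := mul_le_mul_of_nonneg_left key (by positivity : 0 ≤ (b + m * a) / 2)
  rw [← sub_nonneg] at h2 ⊢
  refine h2.trans_eq ?_
  field_simp
  ring

/-- Equality case of `zeroField_entropy_ge`: the asymmetric zero-field minimizer. -/
lemma zeroField_entropy_eq {m s : ℝ} (hm : 1 < m) (hs : 0 < s) :
    (s * m / (m + 1)) * log (s * m / (m + 1))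
        + m * (s / (m * (m + 1)) * log (s / (m * (m + 1)))) - s * log (s / (m + 1))
      = zeroFieldCoupling m / (2 * s)
        * ((s * m / (m + 1)) ^ 2 + m * (s / (m * (m + 1))) ^ 2 - s ^ 2 / (m + 1)) := by
  have hm0 : 0 < m := by linarith
  have hm1 : m - 1 ≠ 0 := by linarith
  rw [log_div (by positivity) (by positivity), log_div (by positivity) (by positivity),
    log_div (by positivity) (by positivity), log_mul (by positivity) (by positivity),
    log_mul (by positivity) (by positivity)]
  unfold zeroFieldCoupling
  field_simp
  ring

/-- Necessary first- and second-order conditions at a local minimum. -/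
lemma IsLocalMin.first_second_order {f f' : ℝ → ℝ} {x c : ℝ} (hmin : IsLocalMin f x)
    (hf : ∀ᶠ y in 𝓝 x, HasDerivAt f (f' y) y) (hf' : HasDerivAt f' c x) :
    f' x = 0 ∧ 0 ≤ c := by
  have h0 : f' x = 0 := hmin.hasDerivAt_eq_zero hf.self_of_nhds
  refine ⟨h0, ?_⟩
  by_contra! hc
  have hd : deriv f =ᶠ[𝓝 x] f' := hf.mono fun y hy ↦ hy.deriv
  have hmax : IsLocalMax f x := by
    refine isLocalMax_of_deriv_deriv_neg ?_ ?_ hf.self_of_nhds.continuousAt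
    · rwa [hd.deriv_eq, hf'.deriv]
    · rw [hd.self_of_nhds, h0]
  have hconst : f =ᶠ[𝓝 x] fun _ ↦ f x := by
    filter_upwards [hmin, hmax] with y h1 h2 using le_antisymm h2 h1
  have h2 : deriv (deriv f) x = 0 := by
    rw [(hconst.deriv).deriv_eq]
    simp
  rw [hd.deriv_eq, hf'.deriv] at h2
  exact hc.ne h2

/-- The single-coordinate contribution to the free energy. -/
def pottsTerm (β x : ℝ) : ℝ := -(β / 2) * x ^ 2 + x * log x

lemma hasDerivAt_pottsTerm {β x : ℝ} (hx : x ≠ 0) :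
    HasDerivAt (pottsTerm β) (log x + 1 - β * x) x := by
  have := ((hasDerivAt_pow 2 x).const_mul (-(β / 2))).add
    ((hasDerivAt_id x).mul (hasDerivAt_log hx))
  refine this.congr_deriv ?_
  simp
  field_simp
  ring

/-- First- and second-order conditions for a weighted sum of three free-energy terms along a
line. -/
lemma pottsTerm_line_conditions {β κ x₁ x₂ x₃ : ℝ} (v₁ v₂ v₃ w₁ w₂ w₃ : ℝ)
    (h₁ : 0 < x₁) (h₂ : 0 < x₂) (h₃ : 0 < x₃)
    (hmin : IsLocalMin (fun ε ↦ w₁ * pottsTerm β (x₁ + ε * v₁) + w₂ * pottsTerm β (x₂ + ε * v₂)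
      + w₃ * pottsTerm β (x₃ + ε * v₃) + κ * ε) 0) :
    w₁ * v₁ * (log x₁ + 1 - β * x₁) + w₂ * v₂ * (log x₂ + 1 - β * x₂)
        + w₃ * v₃ * (log x₃ + 1 - β * x₃) + κ = 0 ∧
      0 ≤ w₁ * v₁ ^ 2 * (1 / x₁ - β) + w₂ * v₂ ^ 2 * (1 / x₂ - β)
        + w₃ * v₃ ^ 2 * (1 / x₃ - β) := by
  have hline : ∀ x v ε : ℝ, HasDerivAt (fun ε ↦ x + ε * v) v ε := fun x v ε ↦ by
    simpa using ((hasDerivAt_id ε).mul_const v).const_add x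
  have hpos : ∀ x v : ℝ, 0 < x → ∀ᶠ ε in 𝓝 (0 : ℝ), 0 < x + ε * v := fun x v hx ↦ by
    have : ContinuousAt (fun ε : ℝ ↦ x + ε * v) 0 := (hline x v 0).continuousAt
    exact this.eventually (by simpa using lt_mem_nhds hx)
  have hterm : ∀ w x v ε : ℝ, 0 < x + ε * v → HasDerivAt (fun ε ↦ w * pottsTerm β (x + ε * v))
      (w * v * (log (x + ε * v) + 1 - β * (x + ε * v))) ε := fun w x v ε h ↦ by
    have := ((hasDerivAt_pottsTerm (β := β) h.ne').comp ε (hline x v ε)).const_mul w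
    exact this.congr_deriv (by ring)
  have hterm2 : ∀ w x v : ℝ, 0 < x →
      HasDerivAt (fun ε ↦ w * v * (log (x + ε * v) + 1 - β * (x + ε * v)))
      (w * v ^ 2 * (1 / x - β)) 0 := fun w x v h ↦ by
    have h' : x + 0 * v ≠ 0 := by simpa using h.ne'
    have := ((((hline x v 0).log h').add_const 1).sub ((hline x v 0).const_mul β)).const_mul (w * v)
    refine this.congr_deriv ?_
    simp only [zero_mul, add_zero]
    ring
  have := hmin.first_second_order (f' := fun ε ↦
      w₁ * v₁ * (log (x₁ + ε * v₁) + 1 - β * (x₁ + ε * v₁))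
      + w₂ * v₂ * (log (x₂ + ε * v₂) + 1 - β * (x₂ + ε * v₂))
      + w₃ * v₃ * (log (x₃ + ε * v₃) + 1 - β * (x₃ + ε * v₃)) + κ)
    (by
      filter_upwards [hpos x₁ v₁ h₁, hpos x₂ v₂ h₂, hpos x₃ v₃ h₃] with ε e1 e2 e3
      have hk : HasDerivAt (fun ε ↦ κ * ε) κ ε := by simpa using (hasDerivAt_id ε).const_mul κ
      exact (((hterm w₁ x₁ v₁ ε e1).add (hterm w₂ x₂ v₂ ε e2)).add (hterm w₃ x₃ v₃ ε e3)).add hk)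
    ((((hterm2 w₁ x₁ v₁ h₁).add (hterm2 w₂ x₂ v₂ h₂)).add (hterm2 w₃ x₃ v₃ h₃)).add_const κ)
  simpa using this

lemma log_one_sub_lt {u : ℝ} (h0 : 0 < u) (h1 : u < 1) : log (1 - u) < -u - u ^ 2 / 2 := by
  have hv : 0 < 1 - u := by linarith
  have h := le_log_one_add_of_nonneg (x := u / (1 - u)) (by positivity)
  have e1 : 1 + u / (1 - u) = (1 - u)⁻¹ := by field_simp; ring
  have e2 : 2 * (u / (1 - u)) / (u / (1 - u) + 2) = 2 * u / (2 - u) := by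
    have : 2 - u ≠ 0 := by linarith
    have : u + (1 - u) * 2 ≠ 0 := by linarith
    field_simp
    ring
  rw [e1, e2, log_inv, div_le_iff₀ (by linarith)] at h
  have : (u + u ^ 2 / 2) * (2 - u) < 2 * u := by nlinarith [pow_pos h0 3]
  nlinarith

lemma sub_sq_half_le_log_one_add {x : ℝ} (hx : 0 ≤ x) : x - x ^ 2 / 2 ≤ log (1 + x) := by
  refine le_trans ?_ (le_log_one_add_of_nonneg hx)
  rw [le_div_iff₀ (by linarith)]
  nlinarith [pow_nonneg hx 3]

lemma log_sub_self_lt {x y : ℝ} (hx : 0 < x) (hxy : x < y) (hy : y ≤ 1) :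
    log x - x < log y - y := by
  have hy0 : 0 < y := hx.trans hxy
  have h := log_lt_sub_one_of_pos (x := x / y) (by positivity) (by rw [ne_eq, div_eq_one_iff_eq hy0.ne']; exact hxy.ne)
  rw [log_div hx.ne' hy0.ne'] at h
  have : x / y - 1 ≤ x - y := by
    rw [div_sub_one hy0.ne', div_le_iff₀ hy0]
    nlinarith
  linarith

lemma log_sub_self_lt' {x y : ℝ} (hx : 1 ≤ x) (hxy : x < y) : log y - y < log x - x := by
  have hx0 : 0 < x := by linarith
  have h := log_lt_sub_one_of_pos (x := y / x) (by have := hx0.trans hxy; positivity)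
    (by rw [ne_eq, div_eq_one_iff_eq hx0.ne']; exact hxy.ne')
  rw [log_div (hx0.trans hxy).ne' hx0.ne'] at h
  have : y / x - 1 ≤ y - x := by
    rw [div_sub_one hx0.ne', div_le_iff₀ hx0]
    nlinarith
  linarith

/-- Displacement bound on the increasing branch of `log x - x`. -/
lemma displacement_lt {x x' Δ : ℝ} (hx : x < 1) (hx' : 0 < x') (hlt : x' < x)
    (h : log x' - x' = log x - x - Δ) :
    (x - x') + (x - x') ^ 2 / (2 * (x * (1 - x))) < x / (1 - x) * Δ := by
  have hx0 : 0 < x := hx'.trans hlt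
  have h1x : 0 < 1 - x := by linarith
  have hl := log_one_sub_lt (u := (x - x') / x) (by have : 0 < x - x' := by linarith
                                                    positivity)
    (by rw [div_lt_one hx0]; linarith)
  have e : 1 - (x - x') / x = x' / x := by field_simp; ring
  rw [e, log_div hx'.ne' hx0.ne'] at hl
  have hl2 : (x - x') / x + ((x - x') / x) ^ 2 / 2 - (x - x') < Δ := by linarith
  calc (x - x') + (x - x') ^ 2 / (2 * (x * (1 - x)))
      = x / (1 - x) * ((x - x') / x + ((x - x') / x) ^ 2 / 2 - (x - x')) := by
        field_simp
        ring
    _ < _ := by gcongr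

/-- Displacement bound on the decreasing branch of `log x - x`. -/
lemma le_displacement {y y' Δ : ℝ} (hy : 1 < y) (hle : y ≤ y')
    (h : log y' - y' = log y - y - Δ) :
    y / (y - 1) * Δ ≤ (y' - y) + (y' - y) ^ 2 / (2 * (y * (y - 1))) := by
  have hy0 : 0 < y := by linarith
  have hy1 : 0 < y - 1 := by linarith
  have hl := sub_sq_half_le_log_one_add (x := (y' - y) / y)
    (by have : 0 ≤ y' - y := by linarith
        positivity)
  have e : 1 + (y' - y) / y = y' / y := by field_simp; ring
  rw [e, log_div (by linarith) hy0.ne'] at hl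
  have hl2 : Δ ≤ (y' - y) - (y' - y) / y + ((y' - y) / y) ^ 2 / 2 := by linarith
  calc y / (y - 1) * Δ ≤ y / (y - 1) * ((y' - y) - (y' - y) / y + ((y' - y) / y) ^ 2 / 2) := by
        gcongr
    _ = _ := by
        field_simp

/-- Two asymmetric critical points with the same total mass cannot lie on different levels if the
lower one satisfies the second-order condition and has large second moment. -/
lemma no_two_levels {n z a y z' a' y' Δ : ℝ} (hn : 0 < n)
    (hz1 : z < 1) (ha1 : a < 1) (hy1 : 1 < y) (hz0 : 0 < z) (ha0 : 0 < a)
    (hz' : 0 < z') (ha' : 0 < a') (hz'1 : z' < 1) (ha'1 : a' < 1) (hΔ : 0 < Δ)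
    (ez : log z' - z' = log z - z - Δ) (ea : log a' - a' = log a - a - Δ)
    (ey : log y' - y' = log y - y - Δ)
    (hsum : z + n * a + y = z' + n * a' + y')
    (hess : z / (1 - z) + n * (a / (1 - a)) ≤ y / (y - 1))
    (hmom : z * (1 - z) + n * (a * (1 - a)) ≤ y * (y - 1)) : False := by
  have lz : z' < z := by
    by_contra! h
    rcases h.eq_or_lt with h | h
    · rw [h] at ez; linarith
    · linarith [log_sub_self_lt hz0 h hz'1.le]
  have la : a' < a := by
    by_contra! h
    rcases h.eq_or_lt with h | h
    · rw [h] at ea; linarith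
    · linarith [log_sub_self_lt ha0 h ha'1.le]
  have hη : y' - y = (z - z') + n * (a - a') := by linarith
  have ly : y ≤ y' := by
    have : 0 ≤ n * (a - a') := mul_nonneg hn.le (by linarith)
    linarith
  have bz := displacement_lt hz1 hz' lz ez
  have ba := mul_lt_mul_of_pos_left (displacement_lt ha1 ha' la ea) hn
  have bY := le_displacement hy1 ly ey
  have hP : 0 < z * (1 - z) := mul_pos hz0 (by linarith)
  have hQ : 0 < a * (1 - a) := mul_pos ha0 (by linarith)
  have hR : 0 < y * (y - 1) := mul_pos (by linarith) (by linarith)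
  have hs := mul_le_mul_of_nonneg_right hess hΔ.le
  rw [hη] at bY
  generalize z - z' = e at *
  generalize a - a' = d at *
  generalize z * (1 - z) = P at *
  generalize a * (1 - a) = Q at *
  generalize y * (y - 1) = R at *
  have main : e ^ 2 / P + n * (d ^ 2 / Q) < (e + n * d) ^ 2 / R := by
    have e1 : e ^ 2 / (2 * P) = e ^ 2 / P / 2 := by field_simp
    have e2 : d ^ 2 / (2 * Q) = d ^ 2 / Q / 2 := by field_simp
    have e3 : (e + n * d) ^ 2 / (2 * R) = (e + n * d) ^ 2 / R / 2 := by field_simp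
    rw [e1] at bz
    rw [e2] at ba
    rw [e3] at bY
    nlinarith
  have cs : (e + n * d) ^ 2 ≤ (e ^ 2 / P + n * (d ^ 2 / Q)) * (P + n * Q) := by
    have : (e ^ 2 / P + n * (d ^ 2 / Q)) * (P + n * Q) - (e + n * d) ^ 2
        = n * (e * Q - d * P) ^ 2 / (P * Q) := by
      field_simp
      ring
    have h2 : 0 ≤ n * (e * Q - d * P) ^ 2 / (P * Q) := by positivity
    linarith
  rw [lt_div_iff₀ hR] at main
  have h3 : 0 ≤ e ^ 2 / P + n * (d ^ 2 / Q) := by positivity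
  linarith [mul_le_mul_of_nonneg_left hmom h3]

lemma three_mul_lt_exp_sub {t : ℝ} (h0 : 0 < t) (h1 : t < 1) :
    exp t + 1 - 2 / exp t < 3 * t := by
  have b1 := exp_bound (x := t) (by rw [abs_of_pos h0]; exact h1.le) (n := 5) (by norm_num)
  have b2 := exp_bound (x := -t) (by rw [abs_neg, abs_of_pos h0]; exact h1.le) (n := 5)
    (by norm_num)
  rw [abs_neg] at b2
  rw [abs_of_pos h0] at b1 b2
  have c1 := (abs_le.1 b1).2
  have c2 := (abs_le.1 b2).1
  simp only [Finset.sum_range_succ, Finset.sum_range_zero, Nat.factorial] at c1 c2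
  norm_num at c1 c2
  have e : 2 / exp t = 2 * exp (-t) := by rw [exp_neg]; rfl
  rw [e]
  have t4 : 0 < t ^ 4 := by positivity
  have t2 : 0 < t ^ 2 := by positivity
  have p : 0 ≤ t ^ 4 * (1 - t) := by apply mul_nonneg t4.le; linarith
  have p2 : 0 ≤ t ^ 2 * (1 - t) := by apply mul_nonneg t2.le; linarith
  nlinarith

/-- The second-order condition forces a large second moment. -/
lemma second_moment_of_second_order {n z a y : ℝ} (hn : 2 ≤ n)
    (hz0 : 0 < z) (hz1 : z < 1) (ha0 : 0 < a) (ha1 : a < 1) (hy1 : 1 < y)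
    (hlog : log y - y = log a - a)
    (hess : z / (1 - z) + n * (a / (1 - a)) ≤ y / (y - 1)) :
    z * (1 - z) + n * (a * (1 - a)) ≤ y * (y - 1) := by
  have h1z : 0 < 1 - z := by linarith
  have h1a : 0 < 1 - a := by linarith
  have hy0 : 0 < y - 1 := by linarith
  have qz : 0 < z / (1 - z) := by positivity
  have qa : 0 < a / (1 - a) := by positivity
  rcases le_or_gt 2 y with hy2 | hy2
  · have d1 : z * (1 - z) ≤ z / (1 - z) := by
      rw [le_div_iff₀ h1z]; nlinarith [mul_pos hz0 h1z]
    have d2 : a * (1 - a) ≤ a / (1 - a) := by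
      rw [le_div_iff₀ h1a]; nlinarith [mul_pos ha0 h1a]
    have d3 : y / (y - 1) ≤ y * (y - 1) := by
      rw [div_le_iff₀ hy0]; nlinarith [mul_nonneg (sub_nonneg.2 hy2) (sub_nonneg.2 hy2)]
    have := mul_le_mul_of_nonneg_left d2 (by linarith : 0 ≤ n)
    linarith
  · set t := y - a with ht
    have ht0 : 0 < t := by linarith
    have hE : exp t = y / a := by
      have : t = log (y / a) := by rw [log_div (by linarith) ha0.ne']; linarith
      rw [this, exp_log (by positivity)]
    have hess2 : 2 * (a / (1 - a)) ≤ y / (y - 1) := by nlinarith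
    have t1 : 1 ≤ t := by
      by_contra! h
      have h3 := three_mul_lt_exp_sub ht0 h
      rw [hE, ht] at h3
      have e : 2 / (y / a) = 2 * a / y := by field_simp
      rw [e] at h3
      rw [← mul_div_assoc, div_le_div_iff₀ h1a hy0] at hess2
      have h4 : y / a + 1 - 2 * a / y = (y ^ 2 + a * y - 2 * a ^ 2) / (a * y) := by
        field_simp
      rw [h4, div_lt_iff₀ (by nlinarith)] at h3
      nlinarith [mul_pos ht0 ha0]
    have hD : 17 / 8 ≤ y + a := by
      have hw0 : 0 ≤ t / (y + a) := by positivity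
      have hw1 : t / (y + a) < 1 := by rw [div_lt_one (by linarith)]; linarith
      have hs := sum_range_le_log_div hw0 hw1 2
      have e1 : (1 + t / (y + a)) / (1 - t / (y + a)) = exp t := by
        rw [hE, ht]
        have : y + a ≠ 0 := by linarith
        have : y + a - (y - a) ≠ 0 := by linarith
        field_simp
        ring
      rw [e1, log_exp] at hs
      simp only [Finset.sum_range_succ, Finset.sum_range_zero] at hs
      norm_num at hs
      set D := y + a with hDdef
      have hD0 : 0 < D := by linarith
      have hs2 : 2 * t / D + 2 / 3 * t ^ 3 / D ^ 3 ≤ t := by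
        have : (t / D) ^ 3 = t ^ 3 / D ^ 3 := by rw [div_pow]
        rw [this] at hs
        have e : 2 * t / D + 2 / 3 * t ^ 3 / D ^ 3 = 2 * (t / D + t ^ 3 / D ^ 3 / 3) := by ring
        rw [e]; linarith
      have hs3 : 2 * D ^ 2 + 2 / 3 * t ^ 2 ≤ D ^ 3 := by
        rw [div_add_div _ _ hD0.ne' (by positivity), div_le_iff₀ (by positivity)] at hs2
        have : (D * t) * (2 * D ^ 2 + 2 / 3 * t ^ 2) ≤ (D * t) * D ^ 3 := by
          nlinarith
        exact le_of_mul_le_mul_left this (by positivity)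
      by_contra! hcon
      nlinarith [mul_pos hD0 hD0, mul_pos (mul_pos hD0 hD0) (sub_pos.2 hcon),
        mul_pos hD0 (sub_pos.2 hcon)]
    have g1 : n * (a * (1 - a)) ≤ y / (y - 1) * (1 - a) ^ 2 := by
      have : n * (a / (1 - a)) ≤ y / (y - 1) := by linarith
      calc n * (a * (1 - a)) = n * (a / (1 - a)) * (1 - a) ^ 2 := by field_simp
        _ ≤ _ := by gcongr
    have g2 : z * (1 - z) ≤ 1 / 4 := by nlinarith [sq_nonneg (z - 1 / 2)]
    have g3 : y * (y - 1) - y / (y - 1) * (1 - a) ^ 2 = y / (y - 1) * ((y + a - 2) * t) := by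
      rw [ht]
      field_simp
      ring
    have g4 : 2 ≤ y / (y - 1) := by rw [le_div_iff₀ hy0]; linarith
    have g5 : 1 / 8 ≤ (y + a - 2) * t := by nlinarith
    nlinarith

/-- The symmetric mean-field equation in logarithmic form has at most one solution. -/
lemma symmetric_equation_unique {p β h θ θ' : ℝ} (hp : 1 ≤ p) (hh : h < 0)
    (h0 : 0 ≤ θ) (h0' : 0 ≤ θ') (h1 : p * θ < 1) (h1' : p * θ' < 1)
    (e : log (1 + θ) - log (1 - p * θ) = β * θ - h)
    (e' : log (1 + θ') - log (1 - p * θ') = β * θ' - h) : θ = θ' := by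
  wlog hlt : θ < θ' generalizing θ θ'
  · rcases (not_lt.1 hlt).eq_or_lt with h | h
    · exact h.symm
    · exact (this h0' h0 h1' h1 e' e h).symm
  exfalso
  have hp0 : 0 < p := by linarith
  have hθ' : 0 < θ' := by linarith
  have := (convexOn_log_one_add_sub_log hp).2 (x := 0) ⟨le_refl _, by positivity⟩
    (y := θ') ⟨h0', by rw [lt_div_iff₀ hp0]; linarith⟩
    (by rw [sub_nonneg, div_le_one hθ']; exact hlt.le : 0 ≤ 1 - θ / θ')
    (by positivity : 0 ≤ θ / θ') (by ring)
  simp only [smul_eq_mul, mul_zero, zero_add, add_zero, sub_zero, log_one] at this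
  rw [div_mul_cancel₀ _ hθ'.ne', e, e'] at this
  have e3 : θ / θ' * (β * θ' - h) = β * θ - θ / θ' * h := by field_simp
  have : θ / θ' < 1 := by rw [div_lt_one hθ']; exact hlt
  nlinarith

lemma sum_comp_update_update {ι : Type*} [Fintype ι] [DecidableEq ι] (f : ℝ → ℝ) (x : ι → ℝ)
    {i j : ι} (hij : i ≠ j) (a b : ℝ) :
    ∑ k, f (Function.update (Function.update x i a) j b k)
      = ∑ k, f (x k) + (f a - f (x i)) + (f b - f (x j)) := by
  have key : ∀ (x : ι → ℝ) (i : ι) (a : ℝ),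
      ∑ k, f (Function.update x i a k) = ∑ k, f (x k) + (f a - f (x i)) := fun x i a ↦ by
    rw [← Finset.add_sum_erase _ _ (Finset.mem_univ i),
      ← Finset.add_sum_erase _ (fun k ↦ f (x k)) (Finset.mem_univ i)]
    rw [Finset.sum_congr rfl (g := fun k ↦ f (x k))]
    · simp; ring
    · intro k hk
      rw [Function.update_of_ne (Finset.ne_of_mem_erase hk)]
  rw [key, key, Function.update_of_ne hij.symm]

lemma pottsPhi_eq (q : ℕ) [NeZero q] (β h : ℝ) (x : Fin q → ℝ) :
    pottsPhi q β h x = ∑ k, pottsTerm β (x k) - h * x 0 := rfl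

lemma pottsPhi_update_update {q : ℕ} [NeZero q] (β h : ℝ) (x : Fin q → ℝ) {i j : Fin q}
    (hij : i ≠ j) (a b : ℝ) :
    pottsPhi q β h (Function.update (Function.update x i a) j b) = pottsPhi q β h x
      + (pottsTerm β a - pottsTerm β (x i)) + (pottsTerm β b - pottsTerm β (x j))
      - (if i = 0 then h else 0) * (a - x i) - (if j = 0 then h else 0) * (b - x j) := by
  rw [pottsPhi_eq, pottsPhi_eq, sum_comp_update_update _ _ hij]
  by_cases hj : j = 0
  · subst hj; simp [hij]; ring
  · by_cases hi : i = 0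
    · subst hi; simp [hj, Function.update_of_ne (Ne.symm hj)]; ring
    · simp [hi, hj, Function.update_of_ne (Ne.symm hi), Function.update_of_ne (Ne.symm hj)]; ring

lemma update_update_mem_pottsSimplex {q : ℕ} {x : Fin q → ℝ} (hx : x ∈ pottsSimplex q)
    {i j : Fin q} (hij : i ≠ j) {a b : ℝ} (ha : 0 ≤ a) (hb : 0 ≤ b) (hab : a + b = x i + x j) :
    Function.update (Function.update x i a) j b ∈ pottsSimplex q := by
  refine ⟨fun k ↦ ?_, ?_⟩
  · by_cases hk : k = j
    · subst hk; simpa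
    · rw [Function.update_of_ne hk]
      by_cases hk : k = i
      · subst hk; simpa
      · rw [Function.update_of_ne hk]; exact hx.1 k
  · have := sum_comp_update_update (fun t ↦ t) x hij a b
    rw [this, hx.2]; linarith

lemma IsPottsMinimizer.pair_le {q : ℕ} [NeZero q] {β h : ℝ} {x : Fin q → ℝ}
    (hx : IsPottsMinimizer q β h x) {i j : Fin q} (hij : i ≠ j) {a b : ℝ} (ha : 0 ≤ a) (hb : 0 ≤ b)
    (hab : a + b = x i + x j) :
    0 ≤ (pottsTerm β a - pottsTerm β (x i)) + (pottsTerm β b - pottsTerm β (x j))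
      - (if i = 0 then h else 0) * (a - x i) - (if j = 0 then h else 0) * (b - x j) := by
  have := hx.2 _ (update_update_mem_pottsSimplex hx.1 hij ha hb hab)
  rw [pottsPhi_update_update β h x hij] at this
  linarith

lemma IsPottsMinimizer.pos {q : ℕ} [NeZero q] {β h : ℝ} (hβ : 0 ≤ β) {x : Fin q → ℝ}
    (hx : IsPottsMinimizer q β h x) (i : Fin q) : 0 < x i := by
  by_contra! hi
  have hi0 : x i = 0 := le_antisymm hi (hx.1.1 i)
  obtain ⟨j, hj⟩ : ∃ j, 0 < x j := by
    by_contra! hcon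
    have := Finset.sum_nonpos fun k (_ : k ∈ Finset.univ) ↦ hcon k
    rw [hx.1.2] at this; linarith
  have hij : i ≠ j := by rintro rfl; linarith
  have hj1 : x j ≤ 1 := by
    rw [← hx.1.2]
    exact Finset.single_le_sum (fun k _ ↦ hx.1.1 k) (Finset.mem_univ j)
  set s := x j with hs
  have he : exp (-β - |h|) ≤ 1 := exp_le_one_iff.2 (by linarith [abs_nonneg h])
  have hε0 : 0 < s / 2 * exp (-β - |h|) := by positivity
  have hε1 : s / 2 * exp (-β - |h|) ≤ s / 2 := by nlinarith
  have hlog : log (s / 2 * exp (-β - |h|)) = log (s / 2) + (-β - |h|) := by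
    rw [log_mul (by positivity) (by positivity), log_exp]
  set ε := s / 2 * exp (-β - |h|)
  have h1 := hx.pair_le hij (a := ε) (b := s - ε) hε0.le (by linarith) (by rw [hi0]; ring)
  rw [hi0, ← hs] at h1
  have hsε : 0 < s - ε := by linarith
  have h2 : log s - log (s - ε) ≥ ε / s := by
    have := log_le_sub_one_of_pos (x := (s - ε) / s) (by positivity)
    rw [log_div hsε.ne' hj.ne'] at this
    have e : (s - ε) / s - 1 = - (ε / s) := by field_simp; ring
    linarith
  have h3 : ε ≤ s * (log s - log (s - ε)) := by
    have := mul_le_mul_of_nonneg_left h2 hj.le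
    rwa [mul_div_cancel₀ _ hj.ne'] at this
  have h4 : log (s / 2) ≤ log (s - ε) := log_le_log (by positivity) (by linarith)
  have h5 : (if j = 0 then h else 0) - (if i = 0 then h else 0) ≤ |h| := by
    split_ifs <;> simp [le_abs_self, neg_le_abs]
  unfold pottsTerm at h1
  simp only [zero_mul, sub_zero, hlog] at h1
  nlinarith [mul_le_mul_of_nonneg_left h4 hε0.le, mul_le_mul_of_nonneg_left h5 hε0.le,
    mul_le_mul_of_nonneg_left hj1 (mul_nonneg hβ hε0.le), mul_nonneg hβ (sq_nonneg ε)]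

lemma IsPottsMinimizer.pair_conditions {q : ℕ} [NeZero q] {β h : ℝ} (hβ : 0 ≤ β) {x : Fin q → ℝ}
    (hx : IsPottsMinimizer q β h x) {i j : Fin q} (hij : i ≠ j) :
    log (x i) - β * x i - (if i = 0 then h else 0) = log (x j) - β * x j - (if j = 0 then h else 0)
      ∧ 0 ≤ 1 / x i - β + (1 / x j - β) := by
  have hi := hx.pos hβ i
  have hj := hx.pos hβ j
  have := pottsTerm_line_conditions (β := β) (x₁ := x i) (x₂ := x j) (x₃ := 1) 1 (-1) 0 1 1 0
    (κ := (if j = 0 then h else 0) - (if i = 0 then h else 0)) hi hj one_pos (by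
      have h1 : ∀ᶠ ε in 𝓝 (0 : ℝ), ε < x j := Iio_mem_nhds hj
      have h2 : ∀ᶠ ε in 𝓝 (0 : ℝ), -x i < ε := Ioi_mem_nhds (by linarith)
      filter_upwards [h1, h2] with ε e1 e2
      have := hx.pair_le hij (a := x i + ε * 1) (b := x j + ε * (-1)) (by linarith) (by linarith)
        (by ring)
      simp only [zero_mul, add_zero, mul_zero, mul_one, one_mul] at this ⊢
      nlinarith)
  constructor
  · linarith [this.1]
  · linarith [this.2]

lemma zero_ne_lastIdx {q : ℕ} [NeZero q] (hq : 4 ≤ q) : (0 : Fin q) ≠ lastIdx q := by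
  intro h
  have := congrArg Fin.val h
  simp [lastIdx] at this
  omega

lemma exists_ne_zero_ne {q : ℕ} [NeZero q] (hq : 4 ≤ q) (j : Fin q) : ∃ k : Fin q, k ≠ 0 ∧ k ≠ j := by
  by_cases hj : j.val = 1
  · refine ⟨⟨2, by omega⟩, ?_, ?_⟩ <;> simp [Fin.ext_iff, hj]
  · refine ⟨⟨1, by omega⟩, ?_, ?_⟩ <;> simp [Fin.ext_iff]
    omega

/-- The vector with first coordinate `c`, last coordinate `b`, and all others equal to `a`. -/
def vec3 (q : ℕ) [NeZero q] (c a b : ℝ) : Fin q → ℝ :=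
  Function.update (Function.update (fun _ ↦ a) 0 c) (lastIdx q) b

lemma vec3_last (q : ℕ) [NeZero q] (c a b : ℝ) : vec3 q c a b (lastIdx q) = b := by simp [vec3]

lemma vec3_zero {q : ℕ} [NeZero q] (hq : 4 ≤ q) (c a b : ℝ) : vec3 q c a b 0 = c := by
  simp [vec3, Function.update_of_ne (zero_ne_lastIdx hq)]

lemma vec3_of_isMid {q : ℕ} [NeZero q] (c a b : ℝ) {k : Fin q} (hk : IsMid q k) :
    vec3 q c a b k = a := by
  simp [vec3, Function.update_of_ne hk.2, Function.update_of_ne hk.1]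

lemma eq_vec3 {q : ℕ} [NeZero q] (hq : 4 ≤ q) {x : Fin q → ℝ} {c a b : ℝ} (h0 : x 0 = c)
    (hlast : x (lastIdx q) = b) (hmid : ∀ k, IsMid q k → x k = a) : x = vec3 q c a b := by
  funext k
  by_cases hk : k = 0
  · rw [hk, vec3_zero hq, h0]
  · by_cases hk' : k = lastIdx q
    · rw [hk', vec3_last, hlast]
    · rw [vec3_of_isMid c a b ⟨hk, hk'⟩, hmid k ⟨hk, hk'⟩]

lemma sum_comp_vec3 {q : ℕ} [NeZero q] (hq : 4 ≤ q) (f : ℝ → ℝ) (c a b : ℝ) :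
    ∑ k, f (vec3 q c a b k) = f c + ((q : ℝ) - 2) * f a + f b := by
  unfold vec3
  rw [sum_comp_update_update f _ (zero_ne_lastIdx hq)]
  simp
  ring

/-- The free energy of a vector with first coordinate `c`, last coordinate `b` and `n` further
coordinates equal to `a`. -/
def tripleEnergy (n β h c a b : ℝ) : ℝ :=
  pottsTerm β c + n * pottsTerm β a + pottsTerm β b - h * c

lemma pottsPhi_vec3 {q : ℕ} [NeZero q] (hq : 4 ≤ q) (β h c a b : ℝ) :
    pottsPhi q β h (vec3 q c a b) = tripleEnergy ((q : ℝ) - 2) β h c a b := by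
  rw [pottsPhi_eq, sum_comp_vec3 hq, vec3_zero hq]
  rfl

lemma vec3_mem_pottsSimplex {q : ℕ} [NeZero q] (hq : 4 ≤ q) {c a b : ℝ} (hc : 0 ≤ c) (ha : 0 ≤ a)
    (hb : 0 ≤ b) (hsum : c + ((q : ℝ) - 2) * a + b = 1) : vec3 q c a b ∈ pottsSimplex q := by
  refine ⟨fun k ↦ ?_, ?_⟩
  · by_cases hk : k = 0
    · rwa [hk, vec3_zero hq]
    · by_cases hk' : k = lastIdx q
      · rwa [hk', vec3_last]
      · rwa [vec3_of_isMid c a b ⟨hk, hk'⟩]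
  · have := sum_comp_vec3 hq (fun t ↦ t) c a b
    rw [this, hsum]

lemma pottsPhi_comp_perm {q : ℕ} [NeZero q] (β h : ℝ) (x : Fin q → ℝ) {σ : Equiv.Perm (Fin q)}
    (hσ : σ 0 = 0) : pottsPhi q β h (x ∘ σ) = pottsPhi q β h x := by
  rw [pottsPhi_eq, pottsPhi_eq]
  simp only [Function.comp_apply, hσ]
  rw [Equiv.sum_comp σ fun k ↦ pottsTerm β (x k)]

lemma comp_perm_mem_pottsSimplex {q : ℕ} {x : Fin q → ℝ} (hx : x ∈ pottsSimplex q)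
    (σ : Equiv.Perm (Fin q)) : x ∘ σ ∈ pottsSimplex q :=
  ⟨fun k ↦ hx.1 _, by simp only [Function.comp_apply]; rw [Equiv.sum_comp σ x, hx.2]⟩

lemma IsPottsMinimizer.comp_perm {q : ℕ} [NeZero q] {β h : ℝ} {x : Fin q → ℝ}
    (hx : IsPottsMinimizer q β h x) {σ : Equiv.Perm (Fin q)} (hσ : σ 0 = 0) :
    IsPottsMinimizer q β h (x ∘ σ) :=
  ⟨comp_perm_mem_pottsSimplex hx.1 σ, fun y hy ↦ by
    rw [pottsPhi_comp_perm β h x hσ]; exact hx.2 y hy⟩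

/-- The data `(c, a, b)` of a global minimizer in normal form: first coordinate `c`, last
coordinate `b`, and `n` further coordinates equal to `a`. -/
structure IsMinTriple (n β h c a b : ℝ) : Prop where
  pos : 0 < c
  lt : c < a
  le : a ≤ b
  sum_eq : c + n * a + b = 1
  log_eq : log b - β * b = log a - β * a
  log_eq_field : log c - β * c - h = log a - β * a
  mul_le_one : β * a ≤ 1
  one_lt_mul : a < b → 1 < β * b
  min_le : ∀ c' a' b', 0 ≤ c' → 0 ≤ a' → 0 ≤ b' → c' + n * a' + b' = 1 →
    tripleEnergy n β h c a b ≤ tripleEnergy n β h c' a' b'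

lemma IsPottsMinimizer.zero_le {q : ℕ} [NeZero q] {β h : ℝ} (hh : h < 0) {x : Fin q → ℝ}
    (hx : IsPottsMinimizer q β h x) {k : Fin q} (hk : k ≠ 0) : x 0 ≤ x k := by
  have := hx.pair_le hk.symm (a := x k) (b := x 0) (hx.1.1 _) (hx.1.1 _) (by ring)
  simp only [if_true, if_neg hk] at this
  nlinarith

lemma IsPottsMinimizer.zero_lt {q : ℕ} [NeZero q] {β h : ℝ} (hβ : 0 ≤ β) (hh : h < 0)
    {x : Fin q → ℝ} (hx : IsPottsMinimizer q β h x) {k : Fin q} (hk : k ≠ 0) : x 0 < x k := by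
  refine lt_of_le_of_ne (hx.zero_le hh hk) fun h0 ↦ ?_
  have := (hx.pair_conditions hβ hk).1
  rw [if_neg hk, if_pos rfl, h0] at this
  linarith

lemma eq_of_log_sub_mul_eq {β x y : ℝ} (hβ : 0 ≤ β) (hx : 0 < x) (hy : 0 < y) (hx1 : β * x ≤ 1)
    (hy1 : β * y ≤ 1) (e : log x - β * x = log y - β * y) : x = y := by
  rcases hβ.eq_or_lt with rfl | hβ
  · simp only [zero_mul, sub_zero] at e
    exact log_injOn_pos hx hy e
  have e' : log (β * x) - β * x = log (β * y) - β * y := by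
    rw [log_mul hβ.ne' hx.ne', log_mul hβ.ne' hy.ne']; linarith
  have : β * x = β * y := by
    by_contra hne
    rcases lt_or_gt_of_ne hne with h | h
    · exact (log_sub_self_lt (by positivity) h hy1).ne e'
    · exact (log_sub_self_lt (by positivity) h hx1).ne' e'
  exact mul_left_cancel₀ hβ.ne' this

lemma IsPottsMinimizer.one_lt_mul_unique {q : ℕ} [NeZero q] {β h : ℝ} (hβ : 0 ≤ β)
    {x : Fin q → ℝ} (hx : IsPottsMinimizer q β h x) {i j : Fin q} (hij : i ≠ j)
    (hi : 1 < β * x i) : β * x j ≤ 1 := by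
  by_contra! hj
  have h1 := (hx.pair_conditions hβ hij).2
  have h2 : 1 / x i < β := by rw [div_lt_iff₀ (hx.pos hβ i)]; linarith
  have h3 : 1 / x j < β := by rw [div_lt_iff₀ (hx.pos hβ j)]; linarith
  linarith

lemma IsPottsMinimizer.eq_of_mul_le_one {q : ℕ} [NeZero q] {β h : ℝ} (hβ : 0 ≤ β)
    {x : Fin q → ℝ} (hx : IsPottsMinimizer q β h x) {i j : Fin q} (hi0 : i ≠ 0) (hj0 : j ≠ 0)
    (hi : β * x i ≤ 1) (hj : β * x j ≤ 1) : x i = x j := by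
  rcases eq_or_ne i j with rfl | hij
  · rfl
  have := (hx.pair_conditions hβ hij).1
  rw [if_neg hi0, if_neg hj0, sub_zero, sub_zero] at this
  exact eq_of_log_sub_mul_eq hβ (hx.pos hβ i) (hx.pos hβ j) hi hj this

lemma IsPottsMinimizer.isMinTriple {q : ℕ} [NeZero q] (hq : 4 ≤ q) {β h : ℝ} (hβ : 0 ≤ β)
    (hh : h < 0) {c a b : ℝ} (hx : IsPottsMinimizer q β h (vec3 q c a b)) (hab : a ≤ b)
    (ha : β * a ≤ 1) (hb : a < b → 1 < β * b) : IsMinTriple ((q : ℝ) - 2) β h c a b := by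
  obtain ⟨k, hk0, hkl⟩ := exists_ne_zero_ne hq (lastIdx q)
  have e0 := vec3_zero hq c a b
  have el := vec3_last q c a b
  have ek := vec3_of_isMid c a b ⟨hk0, hkl⟩
  refine ⟨?_, ?_, hab, ?_, ?_, ?_, ha, hb, ?_⟩
  · have := hx.pos hβ 0; rwa [e0] at this
  · have := hx.zero_lt hβ hh hk0; rwa [e0, ek] at this
  · have := sum_comp_vec3 hq (fun t ↦ t) c a b
    rw [← this, hx.1.2]
  · have := (hx.pair_conditions hβ hkl.symm).1
    rw [if_neg hk0, if_neg (zero_ne_lastIdx hq).symm, el, ek] at this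
    linarith
  · have := (hx.pair_conditions hβ hk0.symm).1
    rw [if_neg hk0, if_pos rfl, e0, ek] at this
    linarith
  · intro c' a' b' hc' ha' hb' hs
    rw [← pottsPhi_vec3 hq, ← pottsPhi_vec3 hq]
    exact hx.2 _ (vec3_mem_pottsSimplex hq hc' ha' hb' hs)

/-- Every global minimizer is, up to a permutation of all but the first coordinate, in normal
form. -/
lemma IsPottsMinimizer.exists_normal_form {q : ℕ} [NeZero q] (hq : 4 ≤ q) {β h : ℝ} (hβ : 0 ≤ β)
    (hh : h < 0) {x : Fin q → ℝ} (hx : IsPottsMinimizer q β h x) :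
    ∃ (c a b : ℝ) (σ : Equiv.Perm (Fin q)), σ 0 = 0 ∧ x = vec3 q c a b ∘ σ ∧
      IsPottsMinimizer q β h (vec3 q c a b) ∧ IsMinTriple ((q : ℝ) - 2) β h c a b := by
  have h0l := zero_ne_lastIdx hq
  by_cases hj : ∃ j, j ≠ 0 ∧ 1 < β * x j
  · obtain ⟨j, hj0, hj⟩ := hj
    obtain ⟨k, hk0, hkj⟩ := exists_ne_zero_ne hq j
    set σ := Equiv.swap j (lastIdx q) with hσ
    have hσ0 : σ 0 = 0 := Equiv.swap_apply_of_ne_of_ne hj0.symm h0l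
    have hkle := hx.one_lt_mul_unique hβ hkj.symm hj
    have heq : ∀ i, i ≠ 0 → i ≠ j → x i = x k := fun i hi0 hij ↦
      hx.eq_of_mul_le_one hβ hi0 hk0 (hx.one_lt_mul_unique hβ hij.symm hj) hkle
    have e : x ∘ σ = vec3 q (x 0) (x k) (x j) := by
      refine eq_vec3 hq ?_ ?_ fun i hi ↦ ?_
      · simp [hσ0]
      · simp [hσ]
      · refine heq _ ?_ ?_
        · rw [← hσ0]; exact fun h ↦ hi.1 (σ.injective h)
        · intro h
          have : σ (lastIdx q) = j := by simp [hσ]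
          exact hi.2 (σ.injective (h.trans this.symm))
    have e2 : x = vec3 q (x 0) (x k) (x j) ∘ σ := by
      rw [← e]; funext i; simp [hσ]
    have hx' : IsPottsMinimizer q β h (vec3 q (x 0) (x k) (x j)) := by
      rw [← e]; exact hx.comp_perm hσ0
    refine ⟨x 0, x k, x j, σ, hσ0, e2, hx', hx'.isMinTriple hq hβ hh ?_ hkle fun _ ↦ hj⟩
    have : 0 < β := hβ.lt_of_ne (by rintro rfl; linarith)
    by_contra! hcon
    nlinarith
  · push Not at hj
    have e : x = vec3 q (x 0) (x (lastIdx q)) (x (lastIdx q)) :=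
      eq_vec3 hq rfl rfl fun i hi ↦
        hx.eq_of_mul_le_one hβ hi.1 h0l.symm (hj i hi.1) (hj _ h0l.symm)
    have hx' := hx
    rw [e] at hx'
    exact ⟨x 0, x (lastIdx q), x (lastIdx q), 1, rfl, by simpa using e, hx',
      hx'.isMinTriple hq hβ hh le_rfl (hj _ h0l.symm) fun h ↦ absurd h (lt_irrefl _)⟩

lemma continuous_pottsPhi (q : ℕ) [NeZero q] (β h : ℝ) : Continuous (pottsPhi q β h) := by
  unfold pottsPhi
  have h1 : ∀ k : Fin q, Continuous fun x : Fin q → ℝ ↦ x k * log (x k) := fun k ↦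
    continuous_mul_log.comp (continuous_apply k)
  fun_prop

lemma isCompact_pottsSimplex (q : ℕ) : IsCompact (pottsSimplex q) :=
  isCompact_stdSimplex ℝ (Fin q)

lemma exists_isPottsMinimizer {q : ℕ} [NeZero q] (hq : 4 ≤ q) (β h : ℝ) :
    ∃ x, IsPottsMinimizer q β h x := by
  obtain ⟨x, hx, hmin⟩ := (isCompact_pottsSimplex q).exists_isMinOn
    ⟨_, vec3_mem_pottsSimplex hq zero_le_one le_rfl le_rfl (by simp)⟩
    (continuous_pottsPhi q β h).continuousOn
  exact ⟨x, hx, fun y hy ↦ hmin hy⟩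

lemma IsMinTriple.isPottsMinimizer {q : ℕ} [NeZero q] (hq : 4 ≤ q) {β h : ℝ} (hβ : 0 ≤ β)
    (hh : h < 0) {c a b : ℝ} (hm : IsMinTriple ((q : ℝ) - 2) β h c a b) :
    IsPottsMinimizer q β h (vec3 q c a b) := by
  have := hm.pos
  have := hm.lt
  have := hm.le
  refine ⟨vec3_mem_pottsSimplex hq (by linarith) (by linarith) (by linarith) hm.sum_eq,
    fun y hy ↦ ?_⟩
  obtain ⟨x, hx⟩ := exists_isPottsMinimizer hq β h
  obtain ⟨c', a', b', σ, hσ, e, hx', hm'⟩ := hx.exists_normal_form hq hβ hh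
  refine le_trans ?_ (hx'.2 y hy)
  rw [pottsPhi_vec3 hq, pottsPhi_vec3 hq]
  have := hm'.pos
  have := hm'.lt
  have := hm'.le
  exact hm.min_le _ _ _ (by linarith) (by linarith) (by linarith) hm'.sum_eq

lemma exists_isMinTriple {q : ℕ} [NeZero q] (hq : 4 ≤ q) {β h : ℝ} (hβ : 0 ≤ β) (hh : h < 0) :
    ∃ c a b, IsMinTriple ((q : ℝ) - 2) β h c a b := by
  obtain ⟨x, hx⟩ := exists_isPottsMinimizer hq β h
  obtain ⟨c, a, b, -, -, -, -, hm⟩ := hx.exists_normal_form hq hβ hh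
  exact ⟨c, a, b, hm⟩

namespace IsMinTriple

variable {n β h c a b β' h' c' a' b' : ℝ}

lemma mul_lt_one (hm : IsMinTriple n β h c a b) (hab : a < b) : β * a < 1 := by
  refine lt_of_le_of_ne hm.mul_le_one fun h1 ↦ ?_
  have hb := hm.one_lt_mul hab
  have hβ : 0 < β := by
    by_contra! hβ
    nlinarith [hm.pos, hm.lt]
  have ha : 0 < a := hm.pos.trans hm.lt
  have := log_sub_self_lt' h1.ge (h1.trans_lt hb)
  rw [log_mul hβ.ne' ha.ne', log_mul hβ.ne' (ha.trans hab).ne'] at this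
  linarith [hm.log_eq]

lemma mul_lt_one' (hm : IsMinTriple n β h c a b) (hβ : 0 ≤ β) : β * c < 1 := by
  rcases hβ.eq_or_lt with rfl | hβ
  · simp
  · nlinarith [hm.lt, hm.mul_le_one]

lemma mul_lt_one_zero (hm : IsMinTriple n β h c a b) (hn : 2 ≤ n) : (n + 2) * c < 1 := by
  nlinarith [hm.lt, hm.le, hm.sum_eq]

/-- In an asymmetric minimizer the total mass outside the first coordinate is supercritical. -/
lemma zeroFieldCoupling_le (hm : IsMinTriple n β h c a b) (hn : 2 ≤ n) (hab : a < b) :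
    zeroFieldCoupling n ≤ β * (1 - c) := by
  have ha : 0 < a := hm.pos.trans hm.lt
  have hs : b + n * a = 1 - c := by linarith [hm.sum_eq]
  have hs0 : 0 < 1 - c := by rw [← hs]; nlinarith
  have h1 := zeroField_entropy_ge (m := n) (by linarith) ha (ha.trans hab)
  have h2 := hm.min_le c ((1 - c) / (n + 1)) ((1 - c) / (n + 1)) hm.pos.le (by positivity)
    (by positivity) (by field_simp; ring)
  have hV : 0 < b ^ 2 + n * a ^ 2 - (b + n * a) ^ 2 / (n + 1) := by
    have : b ^ 2 + n * a ^ 2 - (b + n * a) ^ 2 / (n + 1) = n * (b - a) ^ 2 / (n + 1) := by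
      field_simp; ring
    rw [this]
    have := sub_pos.2 hab
    positivity
  rw [hs] at h1 hV
  unfold tripleEnergy pottsTerm at h2
  have e : n * (-(β / 2) * ((1 - c) / (n + 1)) ^ 2
      + (1 - c) / (n + 1) * log ((1 - c) / (n + 1)))
      + (-(β / 2) * ((1 - c) / (n + 1)) ^ 2 + (1 - c) / (n + 1) * log ((1 - c) / (n + 1)))
      = -(β / 2) * ((1 - c) ^ 2 / (n + 1)) + (1 - c) * log ((1 - c) / (n + 1)) := by
    field_simp
  set V := b ^ 2 + n * a ^ 2 - (1 - c) ^ 2 / (n + 1) with hVdef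
  have h3 : zeroFieldCoupling n / (2 * (1 - c)) * V ≤ β / 2 * V := by
    rw [hVdef] at h1 ⊢; linarith
  have h4 := le_of_mul_le_mul_right h3 hV
  rw [div_le_iff₀ (by positivity)] at h4
  linarith

/-- In a symmetric minimizer the total mass outside the first coordinate is subcritical. -/
lemma le_zeroFieldCoupling (hm : IsMinTriple n β h c a a) (hn : 2 ≤ n) :
    β * (1 - c) ≤ zeroFieldCoupling n := by
  have ha : 0 < a := hm.pos.trans hm.lt
  have hs : 1 - c = (n + 1) * a := by linarith [hm.sum_eq]
  have hs0 : 0 < 1 - c := by rw [hs]; positivity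
  have ha' : a = (1 - c) / (n + 1) := by rw [hs]; field_simp
  have hn0 : 0 < n := by linarith
  have h1 := zeroField_entropy_eq (m := n) (by linarith) hs0
  have h2 := hm.min_le c ((1 - c) / (n * (n + 1))) ((1 - c) * n / (n + 1)) hm.pos.le
    (by positivity) (by positivity) (by field_simp; ring)
  unfold tripleEnergy pottsTerm at h2
  have e : n * (-(β / 2) * a ^ 2 + a * log a) + (-(β / 2) * a ^ 2 + a * log a)
      = -(β / 2) * ((1 - c) ^ 2 / (n + 1)) + (1 - c) * log ((1 - c) / (n + 1)) := by
    rw [← ha', hs]; field_simp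
  have hV : 0 < ((1 - c) * n / (n + 1)) ^ 2 + n * ((1 - c) / (n * (n + 1))) ^ 2
      - (1 - c) ^ 2 / (n + 1) := by
    have : ((1 - c) * n / (n + 1)) ^ 2 + n * ((1 - c) / (n * (n + 1))) ^ 2
      - (1 - c) ^ 2 / (n + 1) = (1 - c) ^ 2 * (n - 1) ^ 2 / (n * (n + 1)) := by
      field_simp; ring
    rw [this]
    have : 0 < n - 1 := by linarith
    positivity
  set V := ((1 - c) * n / (n + 1)) ^ 2 + n * ((1 - c) / (n * (n + 1))) ^ 2
      - (1 - c) ^ 2 / (n + 1) with hVdef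
  have h3 : β / 2 * V ≤ zeroFieldCoupling n / (2 * (1 - c)) * V := by
    rw [← h1, hVdef]; linarith
  have h4 := le_of_mul_le_mul_right h3 hV
  rw [le_div_iff₀ (by positivity)] at h4
  linarith

/-- Comparing two minimizers in each other's potentials. -/
lemma exchange (hy : IsMinTriple n β h c a b) (hx : IsMinTriple n β' h' c' a' b') :
    (β' - β) / 2 * ((c ^ 2 + n * a ^ 2 + b ^ 2) - (c' ^ 2 + n * a' ^ 2 + b' ^ 2))
      + (h' - h) * (c - c') ≤ 0 := by
  have := hy.pos
  have := hy.lt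
  have := hy.le
  have := hx.pos
  have := hx.lt
  have := hx.le
  have h1 := hy.min_le c' a' b' (by linarith) (by linarith) (by linarith) hx.sum_eq
  have h2 := hx.min_le c a b (by linarith) (by linarith) (by linarith) hy.sum_eq
  unfold tripleEnergy pottsTerm at h1 h2
  nlinarith

lemma sq_sum_ge (hn : 2 ≤ n) (hsum : c + n * a + b = 1) :
    c ^ 2 + (1 - c) ^ 2 / (n + 1) ≤ c ^ 2 + n * a ^ 2 + b ^ 2 := by
  have : 1 - c = n * a + b := by linarith
  have e : c ^ 2 + n * a ^ 2 + b ^ 2 - (c ^ 2 + (n * a + b) ^ 2 / (n + 1))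
      = n * (a - b) ^ 2 / (n + 1) := by field_simp; ring
  have : 0 ≤ n * (a - b) ^ 2 / (n + 1) := by positivity
  rw [‹1 - c = _›]; linarith

lemma sq_sum_eq (hn : 2 ≤ n) (hsum : c + n * a + a = 1) :
    c ^ 2 + n * a ^ 2 + a ^ 2 = c ^ 2 + (1 - c) ^ 2 / (n + 1) := by
  have h1 : 1 - c = (n + 1) * a := by linarith
  have h2 : n + 1 ≠ 0 := by linarith
  rw [h1]; field_simp; ring

lemma sq_sub_le (hn : 2 ≤ n) (hcc : c ≤ c') (hc' : (n + 2) * c' ≤ 1) :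
    (c' - c) ^ 2 ≤ c ^ 2 + (1 - c) ^ 2 / (n + 1) - (c' ^ 2 + (1 - c') ^ 2 / (n + 1)) := by
  have e : c ^ 2 + (1 - c) ^ 2 / (n + 1) - (c' ^ 2 + (1 - c') ^ 2 / (n + 1)) - (c' - c) ^ 2
      = (c' - c) * ((c' - c) + 2 * (1 - (n + 2) * c')) / (n + 1) := by field_simp; ring
  have h1 := sub_nonneg.2 hcc
  have h2 := sub_nonneg.2 hc'
  have : 0 ≤ (c' - c) * ((c' - c) + 2 * (1 - (n + 2) * c')) / (n + 1) := by positivity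
  linarith

/-- An asymmetric minimizer has squared norm exceeding that of a symmetric one with larger first
coordinate. -/
lemma sq_sub_le_sq_sum_sub (hn : 2 ≤ n) (hy : IsMinTriple n β h c a b)
    (hx : IsMinTriple n β' h' c' a' a') (hcc : c ≤ c') :
    (c' - c) ^ 2 ≤ (c ^ 2 + n * a ^ 2 + b ^ 2) - (c' ^ 2 + n * a' ^ 2 + a' ^ 2) := by
  have h1 := sq_sum_ge hn hy.sum_eq
  have h2 := sq_sum_eq hn hx.sum_eq
  have h3 := sq_sub_le hn hcc (hx.mul_lt_one_zero hn).le
  linarith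

lemma zeroFieldCoupling_lt' (hm : IsMinTriple n β h c a b) (hn : 2 ≤ n) (hab : a < b) :
    zeroFieldCoupling n < β := by
  have h1 := hm.zeroFieldCoupling_le hn hab
  have h0 := zeroFieldCoupling_pos (m := n) (by linarith)
  have h3 := hm.mul_lt_one_zero hn
  have h4 := hm.pos
  have h5 : c < 1 := by nlinarith
  have h6 : 0 < β := by
    by_contra! hβ
    nlinarith
  nlinarith

/-- At fixed field, symmetric minimizers occur at couplings no larger than asymmetric ones. -/
lemma coupling_le (hn : 2 ≤ n) (hy : IsMinTriple n β h c a b) (hab : a < b)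
    (hx : IsMinTriple n β' h c' a' a') : β' ≤ β := by
  by_contra! hlt
  have h1 := hy.zeroFieldCoupling_le hn hab
  have h2 := hx.le_zeroFieldCoupling hn
  have h0 := zeroFieldCoupling_pos (m := n) (by linarith)
  have h3 := hx.mul_lt_one_zero hn
  have h4 := hx.pos
  have h5 : c' < 1 := by nlinarith
  have hcc : c < c' := by
    by_contra! hcon
    have h6 := hy.zeroFieldCoupling_lt' hn hab
    have h7 : β * (1 - c) ≤ β * (1 - c') := by gcongr; linarith
    have h8 : β * (1 - c') < β' * (1 - c') := by gcongr
    linarith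
  have h6 := exchange hy hx
  have h7 := sq_sub_le_sq_sum_sub hn hy hx hcc.le
  nlinarith [sq_pos_of_pos (sub_pos.2 hcc)]

lemma le_exp (hm : IsMinTriple n β h c a b) (hβ : 0 ≤ β) (hn : 2 ≤ n) : c ≤ exp h := by
  have h1 := hm.log_eq_field
  have ha : 0 < a := hm.pos.trans hm.lt
  have ha1 : a ≤ 1 := by nlinarith [hm.sum_eq, hm.pos, hm.le]
  have h2 := log_nonpos ha.le ha1
  rw [← log_le_iff_le_exp hm.pos]
  nlinarith [hm.lt]

lemma mul_one_sub_exp_le (hm : IsMinTriple n β h c a a) (hβ : 0 ≤ β) (hn : 2 ≤ n) :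
    β * (1 - exp h) ≤ zeroFieldCoupling n :=
  (mul_le_mul_of_nonneg_left (by linarith [hm.le_exp hβ hn]) hβ).trans (hm.le_zeroFieldCoupling hn)

/-- The mean-field equation of a symmetric minimizer in logarithmic form. -/
lemma field_equation (hm : IsMinTriple n β h c a a) :
    log (1 + (a - c)) - log (1 - (n + 1) * (a - c)) = β * (a - c) - h := by
  have ha : 0 < a := hm.pos.trans hm.lt
  have e1 : 1 + (a - c) = (n + 2) * a := by linarith [hm.sum_eq]
  have e2 : 1 - (n + 1) * (a - c) = (n + 2) * c := by linarith [hm.sum_eq]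
  by_cases hn : n + 2 = 0
  · have := hm.lt
    have := hm.sum_eq
    nlinarith
  · rw [e1, e2, log_mul hn ha.ne', log_mul hn hm.pos.ne']
    linarith [hm.log_eq_field]

/-- The symmetric minimizer is unique. -/
lemma symm_unique (hn : 2 ≤ n) (hh : h < 0) (hm : IsMinTriple n β h c a a)
    (hm' : IsMinTriple n β h c' a' a') : c = c' ∧ a = a' := by
  have e := symmetric_equation_unique (p := n + 1) (by linarith) hh (sub_nonneg.2 hm.lt.le)
    (sub_nonneg.2 hm'.lt.le) (by nlinarith [hm.sum_eq, hm.pos])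
    (by nlinarith [hm'.sum_eq, hm'.pos]) hm.field_equation hm'.field_equation
  have h1 := hm.sum_eq
  have h2 := hm'.sum_eq
  have : (n + 2) * (a - a') = 0 := by linarith
  have h3 : a = a' := by
    rcases mul_eq_zero.1 this with h | h <;> linarith
  exact ⟨by linarith, h3⟩

/-- Second-order condition along the curve of critical points. -/
lemma second_order (hn : 2 ≤ n) (hβ : 0 < β) (hm : IsMinTriple n β h c a b) (hab : a < b) :
    β * c / (1 - β * c) + n * (β * a / (1 - β * a)) ≤ β * b / (β * b - 1) := by
  have hc := hm.pos
  have ha : 0 < a := hc.trans hm.lt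
  have hb : 0 < b := ha.trans hab
  have hb1 := sub_pos.2 (hm.one_lt_mul hab)
  have ha1 := sub_pos.2 (hm.mul_lt_one hab)
  have hc1 := sub_pos.2 (hm.mul_lt_one' hβ.le)
  set A := a / (1 - β * a) with hA
  set C := c / (1 - β * c) with hC
  have hA0 : 0 < A := by positivity
  have hC0 : 0 < C := by positivity
  have key := (pottsTerm_line_conditions (β := β) (κ := -h * C) C A (-(C + n * A)) 1 n 1 hc ha hb (by
      have hev : ∀ x v : ℝ, 0 < x → ∀ᶠ ε in 𝓝 (0 : ℝ), 0 < x + ε * v := fun x v hx ↦ by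
        have : ContinuousAt (fun ε : ℝ ↦ x + ε * v) 0 := by fun_prop
        exact this.eventually (by simpa using lt_mem_nhds hx)
      filter_upwards [hev c C hc, hev a A ha, hev b (-(C + n * A)) hb] with ε e1 e2 e3
      have := hm.min_le _ _ _ e1.le e2.le e3.le (by linarith [hm.sum_eq])
      unfold tripleEnergy at this
      simp only [zero_mul, add_zero, mul_zero, one_mul]
      linarith)).2
  have t1 : C ^ 2 * (1 / c - β) = C := by
    rw [hC]; field_simp
  have t2 : A ^ 2 * (1 / a - β) = A := by
    rw [hA]; field_simp
  have t3 : (C + n * A) ^ 2 * (1 / b - β) = -((C + n * A) * ((C + n * A) * ((β * b - 1) / b))) := by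
    field_simp; ring
  have hS : 0 < C + n * A := by positivity
  have key2 : 0 ≤ (C + n * A) * (1 - (C + n * A) * ((β * b - 1) / b)) := by
    nlinarith
  have key3 : 0 ≤ 1 - (C + n * A) * ((β * b - 1) / b) := nonneg_of_mul_nonneg_right key2 hS
  have key4 : C + n * A ≤ b / (β * b - 1) := by
    rw [le_div_iff₀ hb1]
    rw [← mul_div_assoc, sub_nonneg, div_le_one hb] at key3
    exact key3
  calc _ = β * (C + n * A) := by rw [hA, hC]; ring
    _ ≤ β * (b / (β * b - 1)) := by gcongr
    _ = _ := by ring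

/-- The asymmetric minimizer is unique. -/
lemma asymm_unique (hn : 2 ≤ n) (hβ : 0 < β) (hm : IsMinTriple n β h c a b) (hab : a < b)
    (hm' : IsMinTriple n β h c' a' b') (hab' : a' < b') : c = c' ∧ a = a' ∧ b = b' := by
  wlog hle : log a' - β * a' ≤ log a - β * a generalizing c a b c' a' b'
  · have := this hm' hab' hm hab (not_le.1 hle).le
    exact ⟨this.1.symm, this.2.1.symm, this.2.2.symm⟩
  have hc := hm.pos
  have ha : 0 < a := hc.trans hm.lt
  have hb : 0 < b := ha.trans hab
  have hc' := hm'.pos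
  have ha' : 0 < a' := hc'.trans hm'.lt
  have hb' : 0 < b' := ha'.trans hab'
  rcases hle.eq_or_lt with heq | hlt
  · have e1 : c = c' := eq_of_log_sub_mul_eq hβ.le hc hc' (hm.mul_lt_one' hβ.le).le
      (hm'.mul_lt_one' hβ.le).le (by linarith [hm.log_eq_field, hm'.log_eq_field])
    have e2 : a = a' := eq_of_log_sub_mul_eq hβ.le ha ha' hm.mul_le_one hm'.mul_le_one heq.symm
    refine ⟨e1, e2, ?_⟩
    have := hm.sum_eq
    have := hm'.sum_eq
    subst e1 e2
    linarith
  · exfalso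
    have hess := hm.second_order hn hβ hab
    have lg : ∀ x, 0 < x → log (β * x) = log β + log x := fun x hx ↦ log_mul hβ.ne' hx.ne'
    have hmom := second_moment_of_second_order hn (mul_pos hβ hc) (hm.mul_lt_one' hβ.le) (mul_pos hβ ha)
      (hm.mul_lt_one hab) (hm.one_lt_mul hab)
      (by rw [lg _ ha, lg _ hb]; linarith [hm.log_eq]) hess
    refine no_two_levels (n := n) (z := β * c) (a := β * a) (y := β * b) (z' := β * c')
      (a' := β * a') (y' := β * b') (Δ := (log a - β * a) - (log a' - β * a')) (by linarith)
      (hm.mul_lt_one' hβ.le)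
      (hm.mul_lt_one hab) (hm.one_lt_mul hab) (mul_pos hβ hc) (mul_pos hβ ha) (mul_pos hβ hc')
      (mul_pos hβ ha') (hm'.mul_lt_one' hβ.le) (hm'.mul_lt_one hab') (by linarith) ?_ ?_ ?_ ?_
      hess hmom
    · rw [lg _ hc, lg _ hc']; linarith [hm.log_eq_field, hm'.log_eq_field]
    · rw [lg _ ha, lg _ ha']; ring
    · rw [lg _ hb, lg _ hb']; linarith [hm.log_eq, hm'.log_eq]
    · linear_combination β * hm.sum_eq - β * hm'.sum_eq

end IsMinTriple

lemma convexOn_pottsTerm {β : ℝ} (hβ : 0 < β) : ConvexOn ℝ (Ioc 0 (1 / β)) (pottsTerm β) := by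
  have hint : interior (Ioc 0 (1 / β)) = Ioo 0 (1 / β) := interior_Ioc
  refine convexOn_of_hasDerivWithinAt2_nonneg (f' := fun x ↦ log x + 1 - β * x)
    (f'' := fun x ↦ 1 / x - β) (convex_Ioc _ _) (fun x hx ↦ ?_) (fun x hx ↦ ?_) (fun x hx ↦ ?_)
    (fun x hx ↦ ?_)
  · exact (hasDerivAt_pottsTerm hx.1.ne').continuousAt.continuousWithinAt
  · rw [hint] at hx
    exact (hasDerivAt_pottsTerm hx.1.ne').hasDerivWithinAt
  · rw [hint] at hx
    have := ((hasDerivAt_log hx.1.ne').add_const 1).sub ((hasDerivAt_id x).const_mul β)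
    exact (this.congr_deriv (by simp)).hasDerivWithinAt
  · rw [hint] at hx
    have := hx.2
    rw [lt_div_iff₀ hβ] at this
    rw [sub_nonneg, le_div_iff₀ hx.1]
    linarith

namespace IsMinTriple

variable {n β h c a b β' h' c' a' b' : ℝ}

/-- Quantitative comparison of the critical couplings at two fields. -/
lemma coupling_sub_pow_le (hn : 2 ≤ n) {M : ℝ} (hy : IsMinTriple n β h c a b) (hab : a < b)
    (hx : IsMinTriple n β' h' c' a' a') (hβ : β ≤ β') (hM : β' ≤ M) (hh : h ≤ h') :
    (β' - β) * (zeroFieldCoupling n * (β' - β) / M ^ 2) ^ 2 ≤ 2 * (h' - h) := by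
  have h1 := hy.zeroFieldCoupling_le hn hab
  have h2 := hx.le_zeroFieldCoupling hn
  have h0 := zeroFieldCoupling_pos (m := n) (by linarith)
  have hβ0 : 0 < β := h0.trans (hy.zeroFieldCoupling_lt' hn hab)
  have hβ0' : 0 < β' := by linarith
  set z := zeroFieldCoupling n with hz
  have h3 : z / β ≤ 1 - c := by rw [div_le_iff₀ hβ0]; linarith
  have h4 : 1 - c' ≤ z / β' := by rw [le_div_iff₀ hβ0']; linarith
  have h5 : z / β - z / β' = z * (β' - β) / (β * β') := by field_simp
  have hu := sub_nonneg.2 hβ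
  have h6 : z * (β' - β) / M ^ 2 ≤ z * (β' - β) / (β * β') := by
    gcongr
    nlinarith
  have h7 : z * (β' - β) / M ^ 2 ≤ c' - c := by linarith
  have h8 : 0 ≤ z * (β' - β) / M ^ 2 := by positivity
  have h9 := sq_sub_le_sq_sum_sub hn hy hx (by linarith)
  have h10 := exchange hy hx
  have h11 : (z * (β' - β) / M ^ 2) ^ 2 ≤ (c' - c) ^ 2 := by gcongr
  have h12 : c' - c ≤ 1 := by
    have := hx.mul_lt_one_zero hn
    have := hx.pos
    have := hy.pos
    nlinarith
  have h13 := mul_le_mul_of_nonneg_left (h11.trans h9) hu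
  have h14 := mul_le_mul_of_nonneg_left h12 (sub_nonneg.2 hh)
  linarith

/-- Symmetric minimizers do not occur far above the zero-field coupling if the field is small. -/
lemma coupling_sub_le (hn : 2 ≤ n) (hh : h < 0) (hx : IsMinTriple n β h c a a) :
    (β - zeroFieldCoupling (n + 1)) / 10 ≤ -h := by
  rcases le_or_gt β (zeroFieldCoupling (n + 1)) with hle | hlt
  · linarith
  have hc := hx.pos
  have ha : 0 < a := hc.trans hx.lt
  have hsum : c + (n + 1) * a = 1 := by linarith [hx.sum_eq]
  have h1 := zeroField_entropy_ge (m := n + 1) (by linarith) ha hc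
  have h2 := zeroField_entropy_eq (m := n + 1) (by linarith) one_pos
  rw [hsum] at h1
  have hp : 0 < 1 / ((n + 1) * (n + 1 + 1)) := by positivity
  have hP : 0 < 1 * (n + 1) / (n + 1 + 1) := by positivity
  have hPp : 1 / ((n + 1) * (n + 1 + 1)) + n * (1 / ((n + 1) * (n + 1 + 1)))
      + 1 * (n + 1) / (n + 1 + 1) = 1 := by field_simp; ring
  have hP2 : 3 / 4 ≤ 1 * (n + 1) / (n + 1 + 1) := by
    rw [le_div_iff₀ (by linarith)]; linarith
  set p := 1 / ((n + 1) * (n + 1 + 1))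
  set P := 1 * (n + 1) / (n + 1 + 1)
  have h3 := hx.min_le p p P hp.le hp.le hP.le hPp
  unfold tripleEnergy pottsTerm at h3
  simp only [mul_one, one_mul] at h1 h2
  have hV : 11 / 48 ≤ (P ^ 2 + (n + 1) * p ^ 2) - (c ^ 2 + (n + 1) * a ^ 2) := by
    have e1 : c ^ 2 + (n + 1) * a ^ 2 ≤ a := by nlinarith [hx.lt]
    have e2 : a ≤ 1 / 3 := by nlinarith
    have e3 : 0 ≤ (n + 1) * p ^ 2 := by positivity
    nlinarith
  have hp1 : p ≤ 1 := by nlinarith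
  have h4 : (β - zeroFieldCoupling (n + 1)) / 2
      * ((P ^ 2 + (n + 1) * p ^ 2) - (c ^ 2 + (n + 1) * a ^ 2)) ≤ h * (c - p) := by
    linarith
  have h5 : h * (c - p) ≤ -h := by nlinarith
  nlinarith

/-- Asymmetric minimizers do not occur far below the zero-field coupling if the field is small. -/
lemma le_coupling_sub (hn : 2 ≤ n) (hh : h < 0) (hy : IsMinTriple n β h c a b) (hab : a < b)
    (hβ : β < zeroFieldCoupling (n + 1)) :
    (zeroFieldCoupling (n + 1) - β) / 2 * (1 / zeroFieldCoupling (n + 1) - 1 / (n + 2)) ^ 2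
      ≤ -h := by
  have hβ0 : 0 < β := (zeroFieldCoupling_pos (by linarith)).trans (hy.zeroFieldCoupling_lt' hn hab)
  have hc := hy.pos
  have ha : 0 < a := hc.trans hy.lt
  have hb : 0 < b := ha.trans hab
  set z := zeroFieldCoupling (n + 1) with hz
  have hz0 : 0 < z := hβ0.trans hβ
  have hzq : z < n + 2 := by
    have := zeroFieldCoupling_lt (m := n + 1) (by linarith)
    linarith
  have hmem : ∀ t, 0 < t → β * t ≤ 1 → t ∈ Ioc 0 (1 / β) := fun t h0 h1 ↦
    ⟨h0, by rw [le_div_iff₀ hβ0]; linarith⟩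
  have hconv := (convexOn_pottsTerm hβ0).2 (hmem c hc (hy.mul_lt_one' hβ0.le).le)
    (hmem a ha hy.mul_le_one) (by positivity : 0 ≤ 1 / (n + 1)) (by positivity : 0 ≤ n / (n + 1))
    (by field_simp; ring)
  simp only [smul_eq_mul] at hconv
  set m := 1 / (n + 1) * c + n / (n + 1) * a with hm
  have hm0 : 0 < m := by positivity
  have hmsum : b + (n + 1) * m = 1 := by
    have e : (n + 1) * m = c + n * a := by rw [hm]; field_simp
    linarith [hy.sum_eq]
  have hconv2 : (n + 1) * pottsTerm β m ≤ pottsTerm β c + n * pottsTerm β a := by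
    calc (n + 1) * pottsTerm β m
        ≤ (n + 1) * (1 / (n + 1) * pottsTerm β c + n / (n + 1) * pottsTerm β a) := by gcongr
      _ = _ := by field_simp
  have h1 := zeroField_entropy_ge (m := n + 1) (by linarith) hm0 hb
  rw [hmsum] at h1
  simp only [mul_one, one_mul, one_pow, ← hz] at h1
  have hu : 0 < 1 / (n + 1 + 1) := by positivity
  have hu1 : (n + 2) * (1 / (n + 1 + 1)) = 1 := by field_simp; ring
  have hu2 : 1 / (n + 2) = 1 / (n + 1 + 1) := by ring
  rw [hu2]
  set u := 1 / (n + 1 + 1) with hudef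
  have h2 := hy.min_le u u u hu.le hu.le hu.le (by linarith)
  have h3 : (z - β) / 2 * (b ^ 2 + (n + 1) * m ^ 2 - u) ≤ h * (c - u) := by
    unfold tripleEnergy at h2
    have e : pottsTerm β u + n * pottsTerm β u + pottsTerm β u = -(β / 2) * u + log u := by
      unfold pottsTerm
      linear_combination (-(β / 2) * u + log u) * hu1
    unfold pottsTerm at e hconv2 h2
    linarith
  have hV : (b - u) ^ 2 ≤ b ^ 2 + (n + 1) * m ^ 2 - u := by
    have e : b ^ 2 + (n + 1) * m ^ 2 - u - (b - u) ^ 2 = (n + 1) * (m - u) ^ 2 := by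
      linear_combination 2 * u * hmsum - u * hu1
    have : 0 ≤ (n + 1) * (m - u) ^ 2 := by positivity
    linarith
  have hbz : 1 / z ≤ b := by
    rw [div_le_iff₀ hz0]
    nlinarith [hy.one_lt_mul hab]
  have huz : u ≤ 1 / z := by
    rw [← hu2]
    exact one_div_le_one_div_of_le hz0 hzq.le
  have h4 : (1 / z - u) ^ 2 ≤ (b - u) ^ 2 := by
    have := sub_nonneg.2 huz
    gcongr
  have h5 : (z - β) / 2 * (1 / z - u) ^ 2 ≤ (z - β) / 2 * (b ^ 2 + (n + 1) * m ^ 2 - u) := by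
    have := sub_pos.2 hβ
    gcongr
    exact h4.trans hV
  have hu3 : u ≤ 1 := by nlinarith
  have h6 : 0 ≤ -h * (1 + c - u) := mul_nonneg (by linarith) (by linarith)
  calc (z - β) / 2 * (1 / z - u) ^ 2 ≤ h * (c - u) := h5.trans h3
    _ ≤ -h := by linarith

end IsMinTriple

/-- Symmetric and asymmetric minimizers at the same coupling cannot have the asymmetric one at
larger field. -/
lemma IsMinTriple.field_not_lt {q : ℕ} [NeZero q] (hq : 4 ≤ q) {β h c a b h' c' a' : ℝ}
    (hβ : 0 < β) (hh : h' < h) (hh0 : h < 0) (hy : IsMinTriple ((q : ℝ) - 2) β h c a b)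
    (hab : a < b) (hx : IsMinTriple ((q : ℝ) - 2) β h' c' a' a') : False := by
  have hn : (2 : ℝ) ≤ (q : ℝ) - 2 := by
    have : (4 : ℝ) ≤ q := by exact_mod_cast hq
    linarith
  have h1 := hy.zeroFieldCoupling_le hn hab
  have h2 := hx.le_zeroFieldCoupling hn
  have h3 : c ≤ c' := by
    have := le_of_mul_le_mul_left (h2.trans h1) hβ
    linarith
  have h4 : c = c' := by
    have := exchange hy hx
    nlinarith
  subst h4
  have px := hx.isPottsMinimizer hq hβ.le (hh.trans hh0)
  have py := hy.isPottsMinimizer hq hβ.le hh0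
  have px' : IsPottsMinimizer q β h (vec3 q c a' a') := by
    refine ⟨px.1, fun z hz ↦ le_trans ?_ (py.2 z hz)⟩
    have := px.2 _ py.1
    rw [pottsPhi_vec3 hq, pottsPhi_vec3 hq] at this ⊢
    unfold tripleEnergy at this ⊢
    linarith
  have := (px'.isMinTriple hq hβ.le hh0 le_rfl hx.mul_le_one fun h ↦
    absurd h (lt_irrefl _)).log_eq_field
  linarith [hx.log_eq_field]

lemma abs_pottsPhi_sub_le {q : ℕ} [NeZero q] {x : Fin q → ℝ} (hx : x ∈ pottsSimplex q)
    (β β' h : ℝ) : |pottsPhi q β h x - pottsPhi q β' h x| ≤ |β - β'| := by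
  have e : pottsPhi q β h x - pottsPhi q β' h x = -((β - β') / 2) * ∑ k, x k ^ 2 := by
    unfold pottsPhi
    rw [Finset.mul_sum, sub_sub_sub_cancel_right, ← Finset.sum_sub_distrib]
    refine Finset.sum_congr rfl fun k _ ↦ by ring
  have h0 : 0 ≤ ∑ k, x k ^ 2 := Finset.sum_nonneg fun k _ ↦ sq_nonneg _
  have h1 : ∑ k, x k ^ 2 ≤ 1 := by
    rw [← hx.2]
    refine Finset.sum_le_sum fun k _ ↦ ?_
    have : x k ≤ 1 := by
      rw [← hx.2]
      exact Finset.single_le_sum (fun k _ ↦ hx.1 k) (Finset.mem_univ k)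
    nlinarith [hx.1 k]
  rw [e, abs_mul, abs_neg, abs_div, abs_of_nonneg h0, abs_two]
  nlinarith [abs_nonneg (β - β')]

/-- The set of couplings with a global minimizer in a given closed set is closed. -/
lemma exists_isPottsMinimizer_of_closed {q : ℕ} [NeZero q] {K : Set (Fin q → ℝ)}
    (hK : IsClosed K) {β h : ℝ}
    (H : ∀ ε > 0, ∃ β', |β' - β| < ε ∧ ∃ x ∈ K, IsPottsMinimizer q β' h x) :
    ∃ x ∈ K, IsPottsMinimizer q β h x := by
  have hcomp : IsCompact (pottsSimplex q ∩ K) := (isCompact_pottsSimplex q).inter_right hK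
  obtain ⟨_, -, x₀, hx₀, hx₀'⟩ := H 1 one_pos
  obtain ⟨x, hx, hmin⟩ := hcomp.exists_isMinOn ⟨x₀, hx₀'.1, hx₀⟩
    (continuous_pottsPhi q β h).continuousOn
  refine ⟨x, hx.2, hx.1, fun y hy ↦ le_of_forall_pos_le_add fun ε hε ↦ ?_⟩
  obtain ⟨β', hβ', x', hx', hm'⟩ := H (ε / 2) (by linarith)
  have h1 : pottsPhi q β h x ≤ pottsPhi q β h x' := hmin ⟨hm'.1, hx'⟩
  have h2 := (abs_le.1 (abs_pottsPhi_sub_le hm'.1 β' β h)).1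
  have h3 := (abs_le.1 (abs_pottsPhi_sub_le hy β' β h)).2
  have h4 := hm'.2 y hy
  linarith

lemma two_le_sub_two {q : ℕ} (hq : 4 ≤ q) : (2 : ℝ) ≤ (q : ℝ) - 2 := by
  have : (4 : ℝ) ≤ q := by exact_mod_cast hq
  linarith

/-- The couplings at which there is a symmetric global minimizer. -/
def symmetricCouplings (q : ℕ) (h : ℝ) : Set ℝ :=
  {β | 0 ≤ β ∧ ∃ c a, IsMinTriple ((q : ℝ) - 2) β h c a a}

/-- The transition coupling in the field `h`: the largest coupling with a symmetric global
minimizer. -/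
def criticalCoupling (q : ℕ) (h : ℝ) : ℝ := sSup (symmetricCouplings q h)

lemma one_sub_exp_pos {h : ℝ} (hh : h < 0) : 0 < 1 - exp h := by
  have := exp_lt_one_iff.2 hh
  linarith

lemma le_of_mem_symmetricCouplings {q : ℕ} {β h : ℝ} (hq : 4 ≤ q) (hh : h < 0) (hβ : β ∈ symmetricCouplings q h) :
    β ≤ zeroFieldCoupling ((q : ℝ) - 2) / (1 - exp h) := by
  obtain ⟨h0, c, a, hm⟩ := hβ
  rw [le_div_iff₀ (one_sub_exp_pos hh)]
  exact hm.mul_one_sub_exp_le h0 (two_le_sub_two hq)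

lemma bddAbove_symmetricCouplings {q : ℕ} {h : ℝ} (hq : 4 ≤ q) (hh : h < 0) : BddAbove (symmetricCouplings q h) :=
  ⟨_, fun _ hβ ↦ le_of_mem_symmetricCouplings hq hh hβ⟩

lemma IsMinTriple.le_criticalCoupling {q : ℕ} {β h : ℝ} (hq : 4 ≤ q) (hh : h < 0) (hβ : 0 ≤ β) {c a : ℝ}
    (hm : IsMinTriple ((q : ℝ) - 2) β h c a a) : β ≤ criticalCoupling q h :=
  le_csSup (bddAbove_symmetricCouplings hq hh) ⟨hβ, c, a, hm⟩

lemma betaMF_sub_one {q : ℕ} (hq : 4 ≤ q) : betaMF (q - 1) = zeroFieldCoupling ((q : ℝ) - 2) := by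
  unfold betaMF zeroFieldCoupling
  rw [Nat.cast_sub (by omega)]
  push_cast
  ring_nf

lemma betaMF_eq (q : ℕ) : betaMF q = zeroFieldCoupling ((q : ℝ) - 2 + 1) := by
  unfold betaMF zeroFieldCoupling
  ring_nf

section criticalCoupling

variable {q : ℕ} [NeZero q] {β h : ℝ}

lemma zero_mem_symmetricCouplings (hq : 4 ≤ q) (hh : h < 0) : 0 ∈ symmetricCouplings q h := by
  obtain ⟨c, a, b, hm⟩ := exists_isMinTriple hq le_rfl hh
  rcases hm.le.eq_or_lt with rfl | hab
  · exact ⟨le_rfl, c, a, hm⟩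
  · have := hm.one_lt_mul hab
    linarith

lemma criticalCoupling_le (hq : 4 ≤ q) (hh : h < 0) :
    criticalCoupling q h ≤ zeroFieldCoupling ((q : ℝ) - 2) / (1 - exp h) :=
  csSup_le ⟨0, zero_mem_symmetricCouplings hq hh⟩ fun _ hβ ↦ le_of_mem_symmetricCouplings hq hh hβ

lemma IsMinTriple.criticalCoupling_le (hq : 4 ≤ q) (hh : h < 0) {c a b : ℝ}
    (hm : IsMinTriple ((q : ℝ) - 2) β h c a b) (hab : a < b) : criticalCoupling q h ≤ β :=
  csSup_le ⟨0, zero_mem_symmetricCouplings hq hh⟩ fun _ ⟨_, _, _, hx⟩ ↦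
    hm.coupling_le (two_le_sub_two hq) hab hx

lemma exists_asymm_of_criticalCoupling_lt (hq : 4 ≤ q) (hh : h < 0) (hβ : 0 ≤ β)
    (hlt : criticalCoupling q h < β) :
    ∃ c a b, a < b ∧ IsMinTriple ((q : ℝ) - 2) β h c a b := by
  obtain ⟨c, a, b, hm⟩ := exists_isMinTriple hq hβ hh
  rcases hm.le.eq_or_lt with rfl | hab
  · exact absurd (hm.le_criticalCoupling hq hh hβ) (not_le.2 hlt)
  · exact ⟨c, a, b, hab, hm⟩

lemma le_criticalCoupling (hq : 4 ≤ q) (hh : h < 0) :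
    zeroFieldCoupling ((q : ℝ) - 2) ≤ criticalCoupling q h := by
  have hn := two_le_sub_two hq
  have h0 := zeroFieldCoupling_pos (m := (q : ℝ) - 2) (by linarith)
  obtain ⟨c, a, b, hm⟩ := exists_isMinTriple hq h0.le hh
  rcases hm.le.eq_or_lt with rfl | hab
  · exact hm.le_criticalCoupling hq hh h0.le
  · exact absurd (hm.zeroFieldCoupling_lt' hn hab) (lt_irrefl _)

lemma criticalCoupling_pos (hq : 4 ≤ q) (hh : h < 0) : 0 < criticalCoupling q h :=
  (zeroFieldCoupling_pos (by linarith [two_le_sub_two hq])).trans_le (le_criticalCoupling hq hh)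

/-- A triple describing a vector that is symmetric after a permutation is symmetric. -/
lemma eq_of_symForm_vec3 (hq : 4 ≤ q) {c a b : ℝ} {σ : Equiv.Perm (Fin q)} (hσ : σ 0 = 0)
    (hs : SymForm q (vec3 q c a b ∘ σ)) : a = b := by
  obtain ⟨k, hk0, hkl⟩ := exists_ne_zero_ne hq (lastIdx q)
  have hne : ∀ i, i ≠ 0 → σ.symm i ≠ 0 := fun i hi h ↦ hi (by
    rw [← hσ, ← h, Equiv.apply_symm_apply])
  have := hs _ _ (hne k hk0) (hne _ (zero_ne_lastIdx hq).symm)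
  simpa [vec3_last, vec3_of_isMid c a b ⟨hk0, hkl⟩] using this

lemma symForm_vec3 (c a : ℝ) : SymForm q (vec3 q c a a) := by
  have : ∀ k : Fin q, k ≠ 0 → vec3 q c a a k = a := fun k hk ↦ by
    by_cases hl : k = lastIdx q
    · rw [hl, vec3_last]
    · exact vec3_of_isMid c a a ⟨hk, hl⟩
  intro j k hj hk
  rw [this j hj, this k hk]

lemma exists_symm_criticalCoupling (hq : 4 ≤ q) (hh : h < 0) :
    ∃ c a, IsMinTriple ((q : ℝ) - 2) (criticalCoupling q h) h c a a := by
  have hK : IsClosed {x : Fin q → ℝ | SymForm q x} := by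
    simp only [SymForm, ofPred_forall]
    exact isClosed_iInter fun j ↦ isClosed_iInter fun k ↦ isClosed_iInter fun _ ↦
      isClosed_iInter fun _ ↦ isClosed_eq (continuous_apply j) (continuous_apply k)
  obtain ⟨x, hx, hm⟩ := exists_isPottsMinimizer_of_closed (β := criticalCoupling q h) (h := h) hK (by
    intro ε hε
    obtain ⟨s, hs, hlt⟩ := exists_lt_of_lt_csSup ⟨0, zero_mem_symmetricCouplings hq hh⟩
      (sub_lt_self (criticalCoupling q h) hε)
    obtain ⟨hs0, c, a, hm⟩ := hs
    refine ⟨s, ?_, _, symForm_vec3 c a, hm.isPottsMinimizer hq hs0 hh⟩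
    have := hm.le_criticalCoupling hq hh hs0
    rw [abs_lt]
    constructor <;> linarith)
  obtain ⟨c, a, b, σ, hσ, rfl, -, hm'⟩ := hm.exists_normal_form hq (criticalCoupling_pos hq hh).le hh
  obtain rfl := eq_of_symForm_vec3 hq hσ hx
  exact ⟨c, a, hm'⟩

lemma exists_asymm_criticalCoupling (hq : 4 ≤ q) (hh : h < 0) :
    ∃ c a b, a < b ∧ IsMinTriple ((q : ℝ) - 2) (criticalCoupling q h) h c a b := by
  have hn := two_le_sub_two hq
  have hβ0 := criticalCoupling_pos hq hh
  set β := criticalCoupling q h with hβ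
  have hz0 := zeroFieldCoupling_pos (m := (q : ℝ) - 2) (by linarith)
  have hz1 := zeroFieldCoupling_lt (m := (q : ℝ) - 2) (by linarith)
  set z := zeroFieldCoupling ((q : ℝ) - 2) with hz
  set n := (q : ℝ) - 2 with hn'
  set β₁ := β * ((n + 1 + z) / (2 * z)) with hβ₁
  have hlt : β < β₁ := by
    have : 1 < (n + 1 + z) / (2 * z) := by rw [lt_div_iff₀ (by positivity)]; linarith
    exact lt_mul_of_one_lt_right hβ0 this
  have hβ₁0 : 0 < β₁ := hβ0.trans hlt
  have hK : IsClosed {x : Fin q → ℝ | 1 / β₁ ≤ x (lastIdx q)} :=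
    isClosed_le continuous_const (continuous_apply _)
  obtain ⟨x, hx, hm⟩ := exists_isPottsMinimizer_of_closed (β := β) (h := h) hK (by
    intro ε hε
    set δ := min (ε / 2) (β₁ - β)
    have hδ : 0 < δ := lt_min (by linarith) (by linarith)
    have hδ1 : δ ≤ ε / 2 := min_le_left _ _
    have hδ2 : δ ≤ β₁ - β := min_le_right _ _
    obtain ⟨c, a, b, hab, hm⟩ := exists_asymm_of_criticalCoupling_lt (β := β + δ) hq hh
      (by linarith) (by linarith)
    refine ⟨β + δ, ?_, _, ?_, hm.isPottsMinimizer hq (by linarith) hh⟩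
    · rw [abs_lt]
      constructor <;> linarith
    · have h1 := hm.one_lt_mul hab
      have hb : 0 < b := (hm.pos.trans hm.lt).trans hab
      rw [mem_ofPred_eq, vec3_last, div_le_iff₀ hβ₁0]
      nlinarith)
  obtain ⟨c, a, b, σ, hσ, rfl, -, hm'⟩ := hm.exists_normal_form hq hβ0.le hh
  rcases hm'.le.eq_or_lt with rfl | hab
  · exfalso
    have hl : σ (lastIdx q) ≠ 0 := by
      rw [← hσ]; exact fun h ↦ zero_ne_lastIdx hq (σ.injective h).symm
    have e : vec3 q c a a (σ (lastIdx q)) = a := by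
      rw [symForm_vec3 c a _ _ hl (zero_ne_lastIdx hq).symm, vec3_last]
    have h1 : 1 / β₁ ≤ a := by simpa [e] using hx
    have h2 := hm'.le_zeroFieldCoupling hn
    have h3 : 1 - c = (n + 1) * a := by linarith [hm'.sum_eq]
    have h4 : β / β₁ * (n + 1) ≤ z := by
      calc β / β₁ * (n + 1) = β * ((n + 1) * (1 / β₁)) := by ring
        _ ≤ β * ((n + 1) * a) := by gcongr
        _ ≤ z := by rw [← h3]; exact h2
    have h5 : β / β₁ = 2 * z / (n + 1 + z) := by rw [hβ₁]; field_simp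
    rw [h5, div_mul_eq_mul_div, div_le_iff₀ (by positivity)] at h4
    nlinarith
  · exact ⟨c, a, b, hab, hm'⟩

lemma criticalCoupling_strictMonoOn (hq : 4 ≤ q) : StrictMonoOn (criticalCoupling q) (Iio 0) := by
  intro h hh h' hh' hlt
  by_contra! hcon
  obtain ⟨c, a, b, hab, hy⟩ := exists_asymm_criticalCoupling hq hh'
  have hβ0 := criticalCoupling_pos hq hh'
  obtain ⟨c', a', b', hx⟩ := exists_isMinTriple hq hβ0.le hh
  rcases hx.le.eq_or_lt with rfl | hab'
  · exact hy.field_not_lt hq hβ0 hlt hh' hab hx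
  · have e := le_antisymm hcon (hx.criticalCoupling_le hq hh hab')
    obtain ⟨c'', a'', hs⟩ := exists_symm_criticalCoupling hq hh
    rw [← e] at hs
    exact hy.field_not_lt hq hβ0 hlt hh' hab hs

lemma criticalCoupling_sub_pow_le (hq : 4 ≤ q) {h' M : ℝ} (hh : h < h') (hh' : h' < 0)
    (hM : criticalCoupling q h' ≤ M) :
    (criticalCoupling q h' - criticalCoupling q h) *
      (zeroFieldCoupling ((q : ℝ) - 2) * (criticalCoupling q h' - criticalCoupling q h) / M ^ 2) ^ 2
      ≤ 2 * (h' - h) := by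
  obtain ⟨c, a, b, hab, hy⟩ := exists_asymm_criticalCoupling hq (hh.trans hh')
  obtain ⟨c', a', hx⟩ := exists_symm_criticalCoupling hq hh'
  exact hy.coupling_sub_pow_le (two_le_sub_two hq) hab hx
    (criticalCoupling_strictMonoOn hq (hh.trans hh') hh' hh).le hM hh.le

lemma criticalCoupling_continuousOn (hq : 4 ≤ q) : ContinuousOn (criticalCoupling q) (Iio 0) := by
  intro h₀ hh₀
  rw [mem_Iio] at hh₀
  refine ContinuousAt.continuousWithinAt ?_
  rw [Metric.continuousAt_iff]
  intro ε hε
  have hz0 := zeroFieldCoupling_pos (m := (q : ℝ) - 2) (by linarith [two_le_sub_two hq])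
  set z := zeroFieldCoupling ((q : ℝ) - 2) with hz
  set M := criticalCoupling q (h₀ / 2) with hMdef
  have hM0 : 0 < M := criticalCoupling_pos hq (by linarith)
  set δ₀ := ε * (z * ε / M ^ 2) ^ 2 / 2 with hδ₀
  have hδ₀0 : 0 < δ₀ := by positivity
  have key : ∀ h h', h < h' → h' ≤ h₀ / 2 → h' - h < δ₀ →
      criticalCoupling q h' - criticalCoupling q h < ε := by
    intro h h' hlt hle hd
    have hh' : h' < 0 := by linarith
    have hM : criticalCoupling q h' ≤ M :=
      (criticalCoupling_strictMonoOn hq).monotoneOn hh' (mem_Iio.2 (by linarith)) hle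
    have h1 := criticalCoupling_sub_pow_le hq hlt hh' hM
    by_contra! hcon
    have h2 : ε * (z * ε / M ^ 2) ^ 2 ≤ (criticalCoupling q h' - criticalCoupling q h) *
      (z * (criticalCoupling q h' - criticalCoupling q h) / M ^ 2) ^ 2 := by
      have := hε.le.trans hcon
      gcongr
    linarith
  refine ⟨min δ₀ (-h₀ / 2), lt_min hδ₀0 (by linarith), fun {x} hx ↦ ?_⟩
  rw [dist_eq] at hx ⊢
  have h1 := abs_lt.1 (hx.trans_le (min_le_left _ _))
  have h2 := abs_lt.1 (hx.trans_le (min_le_right _ _))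
  have mono := (criticalCoupling_strictMonoOn hq).monotoneOn
  rcases lt_trichotomy x h₀ with hlt | rfl | hlt
  · have := key x h₀ hlt (by linarith) (by linarith)
    rw [abs_sub_comm, abs_of_nonneg]
    · exact this
    · exact sub_nonneg.2 (mono (mem_Iio.2 (by linarith)) hh₀ hlt.le)
  · simpa
  · have := key h₀ x hlt (by linarith) (by linarith)
    rw [abs_of_nonneg]
    · exact this
    · exact sub_nonneg.2 (mono hh₀ (mem_Iio.2 (by linarith)) hlt.le)

lemma tendsto_criticalCoupling_atBot (hq : 4 ≤ q) :
    Tendsto (criticalCoupling q) atBot (𝓝 (betaMF (q - 1))) := by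
  rw [betaMF_sub_one hq]
  have hup : Tendsto (fun h : ℝ ↦ zeroFieldCoupling ((q : ℝ) - 2) / (1 - exp h)) atBot
      (𝓝 (zeroFieldCoupling ((q : ℝ) - 2))) := by
    have := (tendsto_const_nhds (x := zeroFieldCoupling ((q : ℝ) - 2))).div
      ((tendsto_const_nhds (x := (1 : ℝ))).sub tendsto_exp_atBot) (by norm_num)
    rwa [sub_zero, div_one] at this
  refine tendsto_of_tendsto_of_tendsto_of_le_of_le' tendsto_const_nhds hup ?_ ?_
  · filter_upwards [Iio_mem_atBot (0 : ℝ)] with h hh using le_criticalCoupling hq hh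
  · filter_upwards [Iio_mem_atBot (0 : ℝ)] with h hh using criticalCoupling_le hq hh

lemma tendsto_criticalCoupling_zero (hq : 4 ≤ q) :
    Tendsto (criticalCoupling q) (𝓝[<] 0) (𝓝 (betaMF q)) := by
  rw [betaMF_eq]
  have hn := two_le_sub_two hq
  set n := (q : ℝ) - 2 with hn'
  have hz0 := zeroFieldCoupling_pos (m := n + 1) (by linarith)
  have hz1 := zeroFieldCoupling_lt (m := n + 1) (by linarith)
  set z := zeroFieldCoupling (n + 1) with hz
  set D := (1 / z - 1 / (n + 2)) ^ 2 / 2 with hD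
  have hD0 : 0 < D := by
    have : 0 < 1 / z - 1 / (n + 2) :=
      sub_pos.2 (one_div_lt_one_div_of_lt hz0 (by linarith))
    positivity
  have hneg : ∀ᶠ h in 𝓝[<] (0 : ℝ), h < 0 := self_mem_nhdsWithin
  have hid : Tendsto (fun h : ℝ ↦ h) (𝓝[<] 0) (𝓝 0) := tendsto_id.mono_left nhdsWithin_le_nhds
  have hlo : Tendsto (fun h : ℝ ↦ z + h / D) (𝓝[<] 0) (𝓝 z) := by
    simpa using (hid.div_const D).const_add z
  have hup : Tendsto (fun h : ℝ ↦ z - 10 * h) (𝓝[<] 0) (𝓝 z) := by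
    simpa using (hid.const_mul 10).const_sub z
  refine tendsto_of_tendsto_of_tendsto_of_le_of_le' hlo hup ?_ ?_
  · filter_upwards [hneg] with h hh
    obtain ⟨c, a, b, hab, hy⟩ := exists_asymm_criticalCoupling hq hh
    rcases lt_or_ge (criticalCoupling q h) z with hlt | hge
    · have h1 := hy.le_coupling_sub hn hh hab hlt
      have h2 : (z - criticalCoupling q h) * D ≤ -h := by rw [hD]; linarith
      rw [← le_div_iff₀ hD0, neg_div] at h2
      linarith
    · have : h / D ≤ 0 := div_nonpos_of_nonpos_of_nonneg hh.le hD0.le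
      linarith
  · filter_upwards [hneg] with h hh
    obtain ⟨c, a, hx⟩ := exists_symm_criticalCoupling hq hh
    have := hx.coupling_sub_le hn hh
    linarith

end criticalCoupling

lemma vec3_comp_perm_of_eq {q : ℕ} [NeZero q] (c a : ℝ) {σ : Equiv.Perm (Fin q)}
    (hσ : σ 0 = 0) : vec3 q c a a ∘ σ = vec3 q c a a := by
  funext i
  by_cases hi : i = 0
  · simp [hi, hσ]
  · exact symForm_vec3 c a _ _ (fun h ↦ hi (σ.injective (h.trans hσ.symm))) hi

lemma vec3_comp_perm {q : ℕ} [NeZero q] (hq : 4 ≤ q) (c a b : ℝ) {σ : Equiv.Perm (Fin q)}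
    (hσ : σ 0 = 0) :
    vec3 q c a b ∘ σ = vec3 q c a b ∘ Equiv.swap (σ.symm (lastIdx q)) (lastIdx q) := by
  have h0l := zero_ne_lastIdx hq
  have hk0 : σ.symm (lastIdx q) ≠ 0 := by
    intro h
    rw [Equiv.symm_apply_eq, hσ] at h
    exact h0l h.symm
  funext i
  simp only [Function.comp_apply]
  by_cases hi : i = 0
  · rw [hi, hσ, Equiv.swap_apply_of_ne_of_ne hk0.symm h0l]
  by_cases hik : i = σ.symm (lastIdx q)
  · rw [hik, Equiv.swap_apply_left, Equiv.apply_symm_apply]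
  have h1 : IsMid q (σ i) := ⟨fun h ↦ hi (σ.injective (h.trans hσ.symm)), fun h ↦ hik (by
    rw [← h, Equiv.symm_apply_apply])⟩
  rw [vec3_of_isMid c a b h1]
  by_cases hil : i = lastIdx q
  · rw [hil, Equiv.swap_apply_right]
    exact (vec3_of_isMid c a b ⟨hk0, fun h ↦ hik (hil.trans h.symm)⟩).symm
  · rw [Equiv.swap_apply_of_ne_of_ne hik hil]
    exact (vec3_of_isMid c a b ⟨hi, hil⟩).symm

/-- An asymmetric triple yields exactly `q - 1` vectors under permutations fixing the first
coordinate. -/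
lemma ncard_vec3_comp_perm {q : ℕ} [NeZero q] (hq : 4 ≤ q) (c : ℝ) {a b : ℝ} (hab : a < b) :
    {x | ∃ σ : Equiv.Perm (Fin q), σ 0 = 0 ∧ x = vec3 q c a b ∘ σ}.ncard = q - 1 := by
  have h0l := zero_ne_lastIdx hq
  have himg : {x | ∃ σ : Equiv.Perm (Fin q), σ 0 = 0 ∧ x = vec3 q c a b ∘ σ}
      = (fun k ↦ vec3 q c a b ∘ Equiv.swap k (lastIdx q)) '' ({0}ᶜ : Set (Fin q)) := by
    ext x
    constructor
    · rintro ⟨σ, hσ, rfl⟩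
      refine ⟨σ.symm (lastIdx q), ?_, (vec3_comp_perm hq c a b hσ).symm⟩
      intro h
      rw [mem_singleton_iff, Equiv.symm_apply_eq, hσ] at h
      exact h0l h.symm
    · rintro ⟨k, hk, rfl⟩
      exact ⟨_, Equiv.swap_apply_of_ne_of_ne (Ne.symm hk) h0l, rfl⟩
  rw [himg, InjOn.ncard_image, ncard_compl, ncard_singleton, Nat.card_eq_fintype_card,
    Fintype.card_fin]
  intro j hj k hk hjk
  by_contra hne
  have h1 := congrFun hjk j
  simp only [Function.comp_apply, Equiv.swap_apply_left, vec3_last] at h1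
  by_cases hjl : j = lastIdx q
  · rw [hjl, Equiv.swap_apply_right, vec3_of_isMid c a b ⟨hk, fun h ↦ hne (hjl.trans h.symm)⟩] at h1
    exact hab.ne' h1
  · rw [Equiv.swap_apply_of_ne_of_ne hne hjl, vec3_of_isMid c a b ⟨hj, hjl⟩] at h1
    exact hab.ne' h1

lemma gEq_iff {q : ℕ} (hq : 4 ≤ q) {β h θ : ℝ} :
    GEq q β h θ ↔ exp (β * θ - h) * (1 - ((q : ℝ) - 1) * θ) = 1 + θ := by
  have hn := two_le_sub_two hq
  have : 0 < ((q : ℝ) - 1) * exp (β * θ - h) + 1 := by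
    have : 0 < (q : ℝ) - 1 := by linarith
    positivity
  unfold GEq
  rw [eq_div_iff this.ne']
  constructor <;> intro h <;> linarith

lemma gEq_iff_log {q : ℕ} (hq : 4 ≤ q) {β h θ : ℝ} (h0 : 0 ≤ θ) (h1 : ((q : ℝ) - 1) * θ < 1) :
    GEq q β h θ ↔ log (1 + θ) - log (1 - ((q : ℝ) - 1) * θ) = β * θ - h := by
  have h2 : 0 < 1 - ((q : ℝ) - 1) * θ := by linarith
  have h3 : 0 < 1 + θ := by linarith
  rw [gEq_iff hq, ← log_div h3.ne' h2.ne', ← eq_div_iff h2.ne']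
  exact ⟨fun e ↦ by rw [← e, log_exp], fun e ↦ by rw [← e, exp_log (by positivity)]⟩

lemma mul_lt_one_of_gEq {q : ℕ} (hq : 4 ≤ q) {β h θ : ℝ} (h0 : 0 ≤ θ) (hG : GEq q β h θ) :
    ((q : ℝ) - 1) * θ < 1 := by
  rw [gEq_iff hq] at hG
  have := (mul_pos_iff_of_pos_left (exp_pos (β * θ - h))).1 (hG ▸ (by linarith : 0 < 1 + θ))
  linarith

lemma IsMinTriple.gEq {q : ℕ} (hq : 4 ≤ q) {β h c a : ℝ}
    (hm : IsMinTriple ((q : ℝ) - 2) β h c a a) : GEq q β h (a - c) := by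
  have e : (q : ℝ) - 1 = (q : ℝ) - 2 + 1 := by ring
  have hc := hm.pos
  rw [gEq_iff_log hq (sub_nonneg.2 hm.lt.le), e]
  · exact hm.field_equation
  · nlinarith [hm.sum_eq, two_le_sub_two hq]

lemma IsMinTriple.existsUnique_gEq {q : ℕ} (hq : 4 ≤ q) {β h c a : ℝ} (hh : h < 0)
    (hm : IsMinTriple ((q : ℝ) - 2) β h c a a) :
    ∃! θ, θ ∈ Icc (0 : ℝ) (1 / ((q : ℝ) - 1)) ∧ GEq q β h θ := by
  have hn := two_le_sub_two hq
  have hG := hm.gEq hq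
  have h0 := sub_nonneg.2 hm.lt.le
  have h1 := mul_lt_one_of_gEq hq h0 hG
  refine ⟨a - c, ⟨⟨h0, ?_⟩, hG⟩, ?_⟩
  · rw [le_div_iff₀ (by linarith)]
    linarith
  · rintro θ ⟨⟨hθ0, -⟩, hθ⟩
    have h2 := mul_lt_one_of_gEq hq hθ0 hθ
    exact symmetric_equation_unique (by linarith) hh hθ0 h0 h2 h1
      ((gEq_iff_log hq hθ0 h2).1 hθ) ((gEq_iff_log hq h0 h1).1 hG)

lemma IsMinTriple.asymForm {q : ℕ} [NeZero q] (hq : 4 ≤ q) {β h c a b : ℝ}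
    (hm : IsMinTriple ((q : ℝ) - 2) β h c a b) (hab : a < b) : AsymForm q (vec3 q c a b) := by
  refine ⟨fun j k hj hk ↦ ?_, fun j hj ↦ ?_, fun j hj ↦ ?_⟩
  · rw [vec3_of_isMid c a b hj, vec3_of_isMid c a b hk]
  · rw [vec3_of_isMid c a b hj, vec3_zero hq]; exact hm.lt
  · rw [vec3_of_isMid c a b hj, vec3_last]; exact hab

lemma IsMinTriple.negOrderedForm {q : ℕ} [NeZero q] (hq : 4 ≤ q) {β h c a b : ℝ}
    (hm : IsMinTriple ((q : ℝ) - 2) β h c a b) : NegOrderedForm q (vec3 q c a b) := by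
  refine ⟨fun j k hj hk ↦ ?_, fun j hj ↦ ?_, fun j hj ↦ ?_⟩
  · rw [vec3_of_isMid c a b hj, vec3_of_isMid c a b hk]
  · rw [vec3_of_isMid c a b hj, vec3_zero hq]; exact hm.lt
  · rw [vec3_of_isMid c a b hj, vec3_last]; exact hm.le

/-- Every global minimizer is the symmetric one or a permutation of the asymmetric one. -/
lemma IsPottsMinimizer.symm_or_asymm {q : ℕ} [NeZero q] (hq : 4 ≤ q) {β h : ℝ} (hβ : 0 ≤ β)
    (hh : h < 0) {x : Fin q → ℝ} (hx : IsPottsMinimizer q β h x) :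
    (∃ c a, IsMinTriple ((q : ℝ) - 2) β h c a a ∧ x = vec3 q c a a) ∨
      ∃ c a b, a < b ∧ IsMinTriple ((q : ℝ) - 2) β h c a b ∧
        ∃ σ : Equiv.Perm (Fin q), σ 0 = 0 ∧ x = vec3 q c a b ∘ σ := by
  obtain ⟨c, a, b, σ, hσ, e, -, hm⟩ := hx.exists_normal_form hq hβ hh
  rcases hm.le.eq_or_lt with rfl | hab
  · exact Or.inl ⟨c, a, hm, by rw [e, vec3_comp_perm_of_eq c a hσ]⟩
  · exact Or.inr ⟨c, a, b, hab, hm, σ, hσ, e⟩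

/-- Mean-field Potts model in a negative external field (Theorem 2.4 = "TH2"). -/
theorem potts_negative_field (q : ℕ) [NeZero q] (hq : 4 ≤ q) :
    -- (1) every global minimizer is a permutation (in the last q-1 coordinates)
    --     of a vector with `x₁ < x₂ = … = x_{q-1} ≤ x_q`
    (∀ β h : ℝ, 0 ≤ β → h < 0 → ∀ x, IsPottsMinimizer q β h x →
      ∃ (y : Fin q → ℝ) (σ : Equiv.Perm (Fin q)),
        σ 0 = 0 ∧ x = y ∘ σ ∧ NegOrderedForm q y) ∧
    ∃ βm : ℝ → ℝ,
      (∀ h : ℝ, h < 0 → 0 < βm h) ∧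
      -- (2) the symmetric minimum for `β < β₋(h)`
      (∀ β h : ℝ, 0 ≤ β → h < 0 → β < βm h →
        (∃! x, IsPottsMinimizer q β h x) ∧
        (∀ x, IsPottsMinimizer q β h x →
          SymForm q x ∧
          GEq q β h ((q : ℝ) / ((q : ℝ) - 1) * (1 / (q : ℝ) - x 0))) ∧
        (∃! θ, θ ∈ Icc (0 : ℝ) (1 / ((q : ℝ) - 1)) ∧ GEq q β h θ)) ∧
      -- (3) exactly `q-1` asymmetric global minima for `β > β₋(h)`, all
      --     permutations in the last `q-1` coordinates of a single vector
      (∀ β h : ℝ, h < 0 → βm h < β →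
        ∃ y, AsymForm q y ∧ IsPottsMinimizer q β h y ∧
          {x | IsPottsMinimizer q β h x} =
            {x | ∃ σ : Equiv.Perm (Fin q), σ 0 = 0 ∧ x = y ∘ σ} ∧
          {x | IsPottsMinimizer q β h x}.ncard = q - 1) ∧
      -- (4) exactly `q` global minima at `β = β₋(h)`: one symmetric, `q-1` asymmetric
      (∀ h : ℝ, h < 0 →
        ∃ ys ya : Fin q → ℝ,
          IsPottsMinimizer q (βm h) h ys ∧ SymForm q ys ∧
          IsPottsMinimizer q (βm h) h ya ∧ AsymForm q ya ∧
          {x | IsPottsMinimizer q (βm h) h x} =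
            insert ys {x | ∃ σ : Equiv.Perm (Fin q), σ 0 = 0 ∧ x = ya ∘ σ} ∧
          {x | IsPottsMinimizer q (βm h) h x}.ncard = q) ∧
      -- (5) monotonicity, continuity and boundary values of `β₋`
      StrictMonoOn βm (Iio (0 : ℝ)) ∧ ContinuousOn βm (Iio (0 : ℝ)) ∧
      Tendsto βm atBot (𝓝 (betaMF (q - 1))) ∧
      Tendsto βm (𝓝[<] (0 : ℝ)) (𝓝 (betaMF q)) := by
  have hn := two_le_sub_two hq
  refine ⟨fun β h hβ hh x hx ↦ ?_, criticalCoupling q, fun h hh ↦ criticalCoupling_pos hq hh,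
    fun β h hβ hh hlt ↦ ?_, fun β h hh hlt ↦ ?_, fun h hh ↦ ?_, criticalCoupling_strictMonoOn hq,
    criticalCoupling_continuousOn hq, tendsto_criticalCoupling_atBot hq,
    tendsto_criticalCoupling_zero hq⟩
  · obtain ⟨c, a, b, σ, hσ, e, -, hm⟩ := hx.exists_normal_form hq hβ hh
    exact ⟨_, σ, hσ, e, hm.negOrderedForm hq⟩
  · obtain ⟨c, a, b, hm⟩ := exists_isMinTriple hq hβ hh
    rcases hm.le.eq_or_lt with rfl | hab
    · have huniq : ∀ x, IsPottsMinimizer q β h x → x = vec3 q c a a := fun x hx ↦ by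
        rcases hx.symm_or_asymm hq hβ hh with ⟨c', a', hm', rfl⟩ | ⟨c', a', b', hab, hm', -⟩
        · obtain ⟨rfl, rfl⟩ := hm.symm_unique hn hh hm'
          rfl
        · exact absurd (hm'.criticalCoupling_le hq hh hab) (not_le.2 hlt)
      refine ⟨⟨_, hm.isPottsMinimizer hq hβ hh, huniq⟩, fun x hx ↦ ?_,
        hm.existsUnique_gEq hq hh⟩
      rw [huniq x hx, vec3_zero hq]
      refine ⟨symForm_vec3 c a, ?_⟩
      have e : (q : ℝ) / ((q : ℝ) - 1) * (1 / (q : ℝ) - c) = a - c := by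
        have h1 : (q : ℝ) - 1 ≠ 0 := by linarith
        have h2 : (q : ℝ) ≠ 0 := by linarith
        field_simp
        linarith [hm.sum_eq]
      rw [e]
      exact hm.gEq hq
    · exact absurd (hm.criticalCoupling_le hq hh hab) (not_le.2 hlt)
  · have hβ : 0 < β := (criticalCoupling_pos hq hh).trans hlt
    obtain ⟨c, a, b, hab, hm⟩ := exists_asymm_of_criticalCoupling_lt hq hh hβ.le hlt
    have hy := hm.isPottsMinimizer hq hβ.le hh
    have hset : {x | IsPottsMinimizer q β h x} =
        {x | ∃ σ : Equiv.Perm (Fin q), σ 0 = 0 ∧ x = vec3 q c a b ∘ σ} := by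
      ext x
      refine ⟨fun hx ↦ ?_, ?_⟩
      · rcases IsPottsMinimizer.symm_or_asymm hq hβ.le hh hx with
          ⟨c', a', hm', -⟩ | ⟨c', a', b', hab', hm', σ, hσ, e⟩
        · exact absurd (hm'.le_criticalCoupling hq hh hβ.le) (not_le.2 hlt)
        · obtain ⟨rfl, rfl, rfl⟩ := hm.asymm_unique hn hβ hab hm' hab'
          exact ⟨σ, hσ, e⟩
      · rintro ⟨σ, hσ, rfl⟩
        exact hy.comp_perm hσ
    exact ⟨_, hm.asymForm hq hab, hy, hset, by rw [hset, ncard_vec3_comp_perm hq c hab]⟩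
  · have hβ := criticalCoupling_pos hq hh
    obtain ⟨c, a, b, hab, hm⟩ := exists_asymm_criticalCoupling hq hh
    obtain ⟨c₀, a₀, hm₀⟩ := exists_symm_criticalCoupling hq hh
    have hy := hm.isPottsMinimizer hq hβ.le hh
    have hs := hm₀.isPottsMinimizer hq hβ.le hh
    have hset : {x | IsPottsMinimizer q (criticalCoupling q h) h x} = insert (vec3 q c₀ a₀ a₀)
        {x | ∃ σ : Equiv.Perm (Fin q), σ 0 = 0 ∧ x = vec3 q c a b ∘ σ} := by
      ext x
      refine ⟨fun hx ↦ ?_, ?_⟩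
      · rcases IsPottsMinimizer.symm_or_asymm hq hβ.le hh hx with
          ⟨c', a', hm', e⟩ | ⟨c', a', b', hab', hm', σ, hσ, e⟩
        · obtain ⟨rfl, rfl⟩ := hm₀.symm_unique hn hh hm'
          exact Or.inl e
        · obtain ⟨rfl, rfl, rfl⟩ := hm.asymm_unique hn hβ hab hm' hab'
          exact Or.inr ⟨σ, hσ, e⟩
      · rintro (rfl | ⟨σ, hσ, rfl⟩)
        · exact hs
        · exact hy.comp_perm hσ
    have hcard := ncard_vec3_comp_perm hq c hab
    refine ⟨_, _, hs, symForm_vec3 c₀ a₀, hy, hm.asymForm hq hab, hset, ?_⟩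
    rw [hset, ncard_insert_of_notMem ?_ (finite_of_ncard_ne_zero (by omega)), hcard]
    · omega
    · rintro ⟨σ, hσ, e⟩
      exact hab.ne (eq_of_symForm_vec3 hq hσ (e ▸ symForm_vec3 c₀ a₀))
end
end

section
/- For all β ≥ 0 and all λ ∈ ℝ, every local minimum (x₁, x₀, x₋₁) of the Blume-Capel mean-field free-energy function Φ_{β,λ} on the simplex Δ has all three coordinates strictly positive and satisfies the stationarity equations x₁ e^{4β x₋₁} = x₋₁ e^{4β x₁} = x₀ e^{β(1−2x₀)+λ}. Moreover, there exist β₀ < ∞ and C < ∞ such that for all β ≥ β₀ and all λ ∈ ℝ, every local minimum (x₁, x₀, x₋₁) satisfies: (1) if x₀ is the largest of the three coordinates, then x₁ = x₋₁ = (1−x₀)/2 and 1 − x₀ ≤ C e^{−β+λ}; (2) if x₁ is the largest coordinate, then x₋₁ ≤ C e^{−4β} and x₀ ≤ C e^{−β−λ}; and symmetrically, if x₋₁ is the largest coordinate, then x₁ ≤ C e^{−4β} and x₀ ≤ C e^{−β−λ}. -/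
open Real Set

noncomputable section

/-- The simplex `Δ` of mole fractions `(x₁, x₀, x₋₁)` of the Blume-Capel model. -/
def bcSimplex : Set (ℝ × ℝ × ℝ) :=
  {p | 0 ≤ p.1 ∧ 0 ≤ p.2.1 ∧ 0 ≤ p.2.2 ∧ p.1 + p.2.1 + p.2.2 = 1}

/-- The Blume-Capel mean-field free-energy function `Φ_{β,λ}(x₁, x₀, x₋₁)`.
(Note that `Real.log 0 = 0`, so `x * Real.log x` implements the convention `0 log 0 = 0`.) -/
noncomputable def bcPhi (β lam : ℝ) (p : ℝ × ℝ × ℝ) : ℝ :=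
  4 * β * p.1 * p.2.2 + β * p.2.1 * (1 - p.2.1) + lam * p.2.1
    + p.1 * Real.log p.1 + p.2.1 * Real.log p.2.1 + p.2.2 * Real.log p.2.2

/-- The derivative of `Φ_{β,λ}` at `(a, b, c) + t (u, v, w)` in the direction `(u, v, w)`. -/
def bcSlope (β lam a b c u v w t : ℝ) : ℝ :=
  4 * β * (u * (c + t * w) + (a + t * u) * w) + β * v * (1 - 2 * (b + t * v)) + lam * v
    + u * (log (a + t * u) + 1) + v * (log (b + t * v) + 1) + w * (log (c + t * w) + 1)

lemma hasDerivAt_bcPhi_line (β lam a b c u v w t : ℝ) (ha : a + t * u ≠ 0) (hb : b + t * v ≠ 0)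
    (hc : c + t * w ≠ 0) :
    HasDerivAt (fun t => bcPhi β lam (a + t * u, b + t * v, c + t * w))
      (bcSlope β lam a b c u v w t) t := by
  have hline (x y : ℝ) : HasDerivAt (fun t : ℝ => x + t * y) y t := by
    simpa using ((hasDerivAt_id t).mul_const y).const_add x
  have hA := hline a u
  have hB := hline b v
  have hC := hline c w
  have hent {x y : ℝ} (h : x + t * y ≠ 0) :
      HasDerivAt (fun t : ℝ => (x + t * y) * log (x + t * y))
        ((log (x + t * y) + 1) * y) t :=
    HasDerivAt.comp (h₂ := fun z : ℝ => z * log z) t (Real.hasDerivAt_mul_log h) (hline x y)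
  have key := ((((((hA.const_mul (4 * β)).mul hC).add
    ((hB.const_mul β).mul (hB.const_sub 1))).add (hB.const_mul lam)).add (hent ha)).add
    (hent hb)).add (hent hc)
  refine key.congr_deriv ?_
  unfold bcSlope
  ring

lemma hasDerivAt_bcSlope_zero (β lam a b c u v w : ℝ) (ha : 0 < a) (hb : 0 < b) (hc : 0 < c) :
    HasDerivAt (bcSlope β lam a b c u v w)
      (8 * β * u * w - 2 * β * v ^ 2 + u ^ 2 / a + v ^ 2 / b + w ^ 2 / c) 0 := by
  have hline (x y : ℝ) : HasDerivAt (fun t : ℝ => x + t * y) y 0 := by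
    simpa using ((hasDerivAt_id (0 : ℝ)).mul_const y).const_add x
  have hA := hline a u
  have hB := hline b v
  have hC := hline c w
  have hlog {x : ℝ} (y : ℝ) (h : 0 < x) :
      HasDerivAt (fun t : ℝ => y * (log (x + t * y) + 1)) (y * (y / x)) 0 := by
    have := (((hline x y).log (by simpa using h.ne')).add_const 1).const_mul y
    simpa using this
  have key := ((((((hC.const_mul u).add (hA.mul_const w)).const_mul (4 * β)).add
    (((hB.const_mul 2).const_sub 1).const_mul (β * v))).add_const (lam * v)).add
    (hlog u ha)).add (hlog v hb) |>.add (hlog w hc)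
  refine key.congr_deriv ?_
  ring

open Topology Filter in
/-- If a differentiable function has a local minimum, its second derivative there is
nonnegative. -/
lemma nonneg_of_isLocalMin_of_hasDerivAt {f g : ℝ → ℝ} {x d : ℝ} (h : IsLocalMin f x)
    (hf : ∀ᶠ t in 𝓝 x, HasDerivAt f (g t) t) (hg : HasDerivAt g d x) : 0 ≤ d := by
  by_contra! hd
  have hderiv : deriv f =ᶠ[𝓝 x] g := hf.mono fun t ht => ht.deriv
  have hdd : deriv (deriv f) x = d := by rw [hderiv.deriv_eq, hg.deriv]
  have hmax : IsLocalMax f x :=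
    isLocalMax_of_deriv_deriv_neg (by rwa [hdd]) h.deriv_eq_zero
      hf.self_of_nhds.continuousAt
  have hconst : f =ᶠ[𝓝 x] fun _ => f x := by
    filter_upwards [h, hmax] with t h1 h2 using le_antisymm h2 h1
  have hzero : deriv (deriv f) x = 0 := by
    rw [hconst.deriv.deriv_eq]
    simp
  linarith

open Topology Filter in
lemma isLocalMin_bcPhi_line {β lam a b c : ℝ} (u v w : ℝ) (ha : 0 < a) (hb : 0 < b) (hc : 0 < c)
    (hsum : a + b + c = 1) (huvw : u + v + w = 0)
    (h : IsLocalMinOn (bcPhi β lam) bcSimplex (a, b, c)) :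
    IsLocalMin (fun t => bcPhi β lam (a + t * u, b + t * v, c + t * w)) 0 ∧
      ∀ᶠ t in 𝓝 (0 : ℝ), HasDerivAt (fun t => bcPhi β lam (a + t * u, b + t * v, c + t * w))
        (bcSlope β lam a b c u v w t) t := by
  have hpos {x : ℝ} (y : ℝ) (hx : 0 < x) : ∀ᶠ t in 𝓝 (0 : ℝ), 0 < x + t * y := by
    have : ContinuousAt (fun t : ℝ => x + t * y) 0 := by fun_prop
    exact this.eventually (lt_mem_nhds (by simpa using hx))
  have hev := (hpos u ha).and ((hpos v hb).and (hpos w hc))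
  refine ⟨?_, hev.mono fun t ht =>
    hasDerivAt_bcPhi_line β lam a b c u v w t ht.1.ne' ht.2.1.ne' ht.2.2.ne'⟩
  have htend : Tendsto (fun t : ℝ => (a + t * u, b + t * v, c + t * w)) (𝓝 0)
      (𝓝[bcSimplex] (a, b, c)) := by
    refine tendsto_nhdsWithin_iff.2 ⟨?_, hev.mono fun t ht =>
      ⟨ht.1.le, ht.2.1.le, ht.2.2.le, by linear_combination hsum + t * huvw⟩⟩
    have : Continuous (fun t : ℝ => (a + t * u, b + t * v, c + t * w)) := by fun_prop
    simpa using this.tendsto 0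
  have h' := htend.eventually h
  simpa [IsLocalMin, IsMinFilter] using h'

lemma bcSlope_zero_eq_zero {β lam a b c : ℝ} (u v w : ℝ) (ha : 0 < a) (hb : 0 < b) (hc : 0 < c)
    (hsum : a + b + c = 1) (huvw : u + v + w = 0)
    (h : IsLocalMinOn (bcPhi β lam) bcSimplex (a, b, c)) : bcSlope β lam a b c u v w 0 = 0 :=
  have H := isLocalMin_bcPhi_line u v w ha hb hc hsum huvw h
  H.1.hasDerivAt_eq_zero H.2.self_of_nhds

/-- The Hessian of `Φ_{β,λ}` is nonnegative along the simplex at an interior local minimum. -/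
lemma bcPhi_hessian_nonneg {β lam a b c : ℝ} (u v w : ℝ) (ha : 0 < a) (hb : 0 < b) (hc : 0 < c)
    (hsum : a + b + c = 1) (huvw : u + v + w = 0)
    (h : IsLocalMinOn (bcPhi β lam) bcSimplex (a, b, c)) :
    0 ≤ 8 * β * u * w - 2 * β * v ^ 2 + u ^ 2 / a + v ^ 2 / b + w ^ 2 / c :=
  have H := isLocalMin_bcPhi_line u v w ha hb hc hsum huvw h
  nonneg_of_isLocalMin_of_hasDerivAt H.1 H.2 (hasDerivAt_bcSlope_zero β lam a b c u v w ha hb hc)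

/-- The logarithmic equations of stationarity. -/
lemma bcPhi_stationary_log {β lam a b c : ℝ} (ha : 0 < a) (hb : 0 < b) (hc : 0 < c)
    (hsum : a + b + c = 1) (h : IsLocalMinOn (bcPhi β lam) bcSimplex (a, b, c)) :
    log a + 4 * β * c = log c + 4 * β * a ∧
      log c + 4 * β * a = log b + (β * (1 - 2 * b) + lam) := by
  have h1 := bcSlope_zero_eq_zero 1 0 (-1) ha hb hc hsum (by norm_num) h
  have h2 := bcSlope_zero_eq_zero 0 (-1) 1 ha hb hc hsum (by norm_num) h
  simp only [bcSlope, zero_mul, add_zero] at h1 h2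
  constructor <;> linarith

lemma mul_log_toward_third_le {p t : ℝ} (hp : 0 ≤ p) (hp1 : p ≤ 1) (ht : 0 < t) (ht1 : t ≤ 1) :
    (1 / 3 - p) * log (p + t * (1 / 3 - p)) ≤ 2 := by
  rcases le_total p (1 / 3) with h | h
  · have h1 : log (p + t * (1 / 3 - p)) ≤ 0 :=
      log_nonpos (by nlinarith) (by nlinarith)
    nlinarith
  · have hx : 1 / 3 ≤ p + t * (1 / 3 - p) := by nlinarith
    have h1 := Real.one_sub_inv_le_log_of_pos (x := p + t * (1 / 3 - p)) (by linarith)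
    have h2 : (p + t * (1 / 3 - p))⁻¹ ≤ 3 := by
      rw [inv_le_comm₀ (by linarith) (by norm_num)]
      linarith
    nlinarith

open Topology Filter in
/-- Local minima do not lie on the boundary: moving towards the barycentre decreases `Φ`. -/
lemma pos_of_isLocalMinOn_bcPhi {β lam a b c : ℝ} (hβ : 0 ≤ β) (hmem : (a, b, c) ∈ bcSimplex)
    (h : IsLocalMinOn (bcPhi β lam) bcSimplex (a, b, c)) : 0 < a ∧ 0 < b ∧ 0 < c := by
  obtain ⟨ha, hb, hc, hsum⟩ := hmem
  simp only at ha hb hc hsum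
  by_contra hcon
  have hz : a = 0 ∨ b = 0 ∨ c = 0 := by
    by_contra! hne
    exact hcon ⟨ha.lt_of_ne' hne.1, hb.lt_of_ne' hne.2.1, hc.lt_of_ne' hne.2.2⟩
  have hlog : ∀ᶠ t in 𝓝[>] (0 : ℝ), log t < -3 * (8 * β + β + |lam| + 8) :=
    Real.tendsto_log_nhdsGT_zero.eventually_lt_atBot _
  have hlog' : ∀ᶠ t in 𝓝[>] (0 : ℝ), t < 1 := by
    filter_upwards [Ioo_mem_nhdsGT (zero_lt_one' ℝ)] with t ht using ht.2
  have hpt {x t : ℝ} (hx : 0 ≤ x) (ht : 0 < t) (ht1 : t < 1) :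
      0 < x + t * (1 / 3 - x) := by nlinarith
  have hslope {t : ℝ} (ht : 0 < t) (ht1 : t < 1)
      (hl : log t < -3 * (8 * β + β + |lam| + 8)) :
      bcSlope β lam a b c (1 / 3 - a) (1 / 3 - b) (1 / 3 - c) t < 0 := by
    have hA := mul_log_toward_third_le ha (by linarith) ht ht1.le
    have hB := mul_log_toward_third_le hb (by linarith) ht ht1.le
    have hC := mul_log_toward_third_le hc (by linarith) ht ht1.le
    have hzero {x : ℝ} (hx : x = 0) :
        (1 / 3 - x) * log (x + t * (1 / 3 - x)) < -(8 * β + β + |lam| + 8) := by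
      have h1 : log (t * (1 / 3)) ≤ log t := log_le_log (by linarith) (by linarith)
      simp only [hx, sub_zero, zero_add]
      linarith
    have hlogs : (1 / 3 - a) * log (a + t * (1 / 3 - a))
        + (1 / 3 - b) * log (b + t * (1 / 3 - b))
        + (1 / 3 - c) * log (c + t * (1 / 3 - c)) < -(8 * β + β + |lam| + 8) + 4 := by
      rcases hz with hz | hz | hz <;> linarith [hzero hz]
    have hbd {x : ℝ} (hx : 0 ≤ x) (hx1 : x ≤ 1) :
        0 < x + t * (1 / 3 - x) ∧ x + t * (1 / 3 - x) ≤ 1 :=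
      ⟨hpt hx ht ht1, by nlinarith⟩
    obtain ⟨hA0, hA1⟩ := hbd ha (by linarith)
    obtain ⟨hB0, hB1⟩ := hbd hb (by linarith)
    obtain ⟨hC0, hC1⟩ := hbd hc (by linarith)
    have hlin : lam * (1 / 3 - b) ≤ |lam| := by
      calc lam * (1 / 3 - b) ≤ |lam * (1 / 3 - b)| := le_abs_self _
        _ = |lam| * |1 / 3 - b| := abs_mul _ _
        _ ≤ |lam| * 1 := by
          gcongr
          exact abs_le.2 ⟨by linarith, by linarith⟩
        _ = |lam| := mul_one _
    have hq1 : (1 / 3 - a) * (c + t * (1 / 3 - c)) + (a + t * (1 / 3 - a)) * (1 / 3 - c) ≤ 2 := by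
      nlinarith
    have hq2 : (1 / 3 - b) * (1 - 2 * (b + t * (1 / 3 - b))) ≤ 1 := by nlinarith
    have hq1' := mul_le_mul_of_nonneg_left hq1 hβ
    have hq2' := mul_le_mul_of_nonneg_left hq2 hβ
    unfold bcSlope
    linarith
  have hcont : Continuous (fun t : ℝ =>
      (a + t * (1 / 3 - a), b + t * (1 / 3 - b), c + t * (1 / 3 - c))) := by fun_prop
  have hmin : ∀ᶠ t in 𝓝[>] (0 : ℝ), bcPhi β lam (a, b, c) ≤
      bcPhi β lam (a + t * (1 / 3 - a), b + t * (1 / 3 - b), c + t * (1 / 3 - c)) := by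
    have htend : Tendsto (fun t : ℝ =>
        (a + t * (1 / 3 - a), b + t * (1 / 3 - b), c + t * (1 / 3 - c))) (𝓝[>] 0)
        (𝓝[bcSimplex] (a, b, c)) := by
      refine tendsto_nhdsWithin_iff.2 ⟨?_, ?_⟩
      · have := hcont.tendsto 0
        simp only [zero_mul, add_zero] at this
        exact this.mono_left nhdsWithin_le_nhds
      · filter_upwards [hlog', self_mem_nhdsWithin] with t ht1 ht0
        exact ⟨(hpt ha ht0 ht1).le, (hpt hb ht0 ht1).le, (hpt hc ht0 ht1).le,
          by linear_combination (1 - t) * hsum⟩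
    exact htend.eventually h
  obtain ⟨δ, hδ, hIoc⟩ := mem_nhdsGT_iff_exists_Ioc_subset.1 ((hlog.and hlog').and hmin)
  have hphi : Continuous (bcPhi β lam) := by
    have hml := Real.continuous_mul_log
    unfold bcPhi
    have h1 := hml.comp (continuous_fst (X := ℝ) (Y := ℝ × ℝ))
    have h2 := hml.comp (continuous_fst.comp (continuous_snd (X := ℝ) (Y := ℝ × ℝ)))
    have h3 := hml.comp (continuous_snd.comp (continuous_snd (X := ℝ) (Y := ℝ × ℝ)))
    have h0 : Continuous fun p : ℝ × ℝ × ℝ => 4 * β * p.1 * p.2.2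
        + β * p.2.1 * (1 - p.2.1) + lam * p.2.1 := by fun_prop
    exact ((h0.add h1).add h2).add h3
  have hanti := strictAntiOn_of_deriv_neg (convex_Icc 0 δ) (hphi.comp hcont).continuousOn
    (by
      intro t ht
      rw [interior_Icc] at ht
      have ht' := (hIoc ⟨ht.1, ht.2.le⟩).1
      have hd := hasDerivAt_bcPhi_line β lam a b c (1 / 3 - a) (1 / 3 - b) (1 / 3 - c) t
        (hpt ha ht.1 ht'.2).ne' (hpt hb ht.1 ht'.2).ne' (hpt hc ht.1 ht'.2).ne'
      have := hslope ht.1 ht'.2 ht'.1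
      rw [← hd.deriv] at this
      exact this)
  have hδ0 : (0 : ℝ) < δ := hδ
  have hlt := hanti (left_mem_Icc.2 hδ0.le) (right_mem_Icc.2 hδ0.le) hδ0
  have hle := (hIoc (right_mem_Ioc.2 hδ)).2
  simp only [Function.comp, zero_mul, add_zero] at hlt
  exact absurd hlt (not_lt.2 hle)

/-- The logarithmic mean is smaller than the arithmetic mean. -/
lemma two_mul_sub_div_add_lt_log_sub {x y : ℝ} (hx : 0 < x) (hxy : x < y) :
    2 * (y - x) / (y + x) < log y - log x := by
  have hy := hx.trans hxy
  have hq0 : 0 < (y - x) / (y + x) := div_pos (by linarith) (by linarith)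
  have hq1 : (y - x) / (y + x) < 1 := by
    rw [div_lt_one (by linarith)]
    linarith
  have h := Real.sum_range_le_log_div hq0.le hq1 2
  have hquot : (1 + (y - x) / (y + x)) / (1 - (y - x) / (y + x)) = y / x := by
    have h1 : 1 + (y - x) / (y + x) = 2 * y / (y + x) := by field_simp; ring
    have h2 : 1 - (y - x) / (y + x) = 2 * x / (y + x) := by field_simp; ring
    rw [h1, h2]
    field_simp
  rw [hquot, log_div hy.ne' hx.ne'] at h
  simp only [Finset.sum_range_succ, Finset.sum_range_zero] at h
  norm_num at h
  have hq3 := pow_pos hq0 3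
  rw [mul_div_assoc]
  linarith

/-- If `u ≠ v` have logarithmic mean `1`, then the sum of their arithmetic and geometric means
exceeds `2`. -/
lemma two_lt_add_of_log_sub_eq {x y : ℝ} (hx : 0 < x) (hxy : x < y)
    (h : log (y ^ 2) - log (x ^ 2) = y ^ 2 - x ^ 2) : 2 < x + y := by
  have h1 := two_mul_sub_div_add_lt_log_sub hx hxy
  rw [log_pow, log_pow] at h
  push_cast at h
  have h2 : 2 * (y - x) / (y + x) < (y ^ 2 - x ^ 2) / 2 := by linarith
  rw [div_lt_div_iff₀ (by linarith) (by norm_num)] at h2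
  have h3 : (y - x) * 4 < (y - x) * (y + x) ^ 2 := by linarith
  have h4 := lt_of_mul_lt_mul_left h3 (by linarith)
  nlinarith

/-- The determinant condition of the Hessian is incompatible with `u ≠ v` having logarithmic
mean `1`. -/
lemma not_lt_of_log_sub_eq {u v s : ℝ} (hu : 0 < u) (hs0 : 0 ≤ s) (hs : s < 2 / 3)
    (h : log v - log u = v - u)
    (hdet : 2 * (u + v) - 4 ≤ s * (u + v - 2 * (u * v))) : ¬ u < v := by
  intro huv
  obtain ⟨x, hx, rfl⟩ : ∃ x, 0 < x ∧ x ^ 2 = u := ⟨√u, sqrt_pos.2 hu, sq_sqrt hu.le⟩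
  have hv := hu.trans huv
  obtain ⟨y, hy, rfl⟩ : ∃ y, 0 < y ∧ y ^ 2 = v := ⟨√v, sqrt_pos.2 hv, sq_sqrt hv.le⟩
  have hxy : x < y := lt_of_pow_lt_pow_left₀ 2 hy.le huv
  have hsum := two_lt_add_of_log_sub_eq hx hxy h
  have hA : 0 < x ^ 2 + y ^ 2 - 2 := by nlinarith [sq_nonneg (x - y)]
  have hG : 4 < x ^ 2 + y ^ 2 + 2 * (x * y) := by nlinarith
  have hB : x ^ 2 + y ^ 2 - 2 * (x ^ 2 * y ^ 2) ≤ 3 * (x ^ 2 + y ^ 2 - 2) := by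
    nlinarith [sq_nonneg (x * y - 1)]
  have := mul_le_mul_of_nonneg_left hB hs0
  nlinarith

/-- At a local minimum the two charged species are equally frequent, unless the neutral one is
rare. -/
lemma eq_of_isLocalMinOn_bcPhi {β lam a b c : ℝ} (hβ : 0 < β) (ha : 0 < a) (hb : 0 < b)
    (hc : 0 < c) (hsum : a + b + c = 1) (hβb : 3 / 2 < β * b)
    (h : IsLocalMinOn (bcPhi β lam) bcSimplex (a, b, c)) : a = c := by
  have hdet : 2 * (4 * β * a + 4 * β * c) - 4 ≤
      1 / (β * b) * (4 * β * a + 4 * β * c - 2 * (4 * β * a * (4 * β * c))) := by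
    have hdisc := discrim_le_zero (a := 1 / a + 1 / b - 2 * β) (b := 2 * (2 * β + 1 / b))
      (c := 1 / c + 1 / b - 2 * β) (by
        intro x
        have := bcPhi_hessian_nonneg x (-(x + 1)) 1 ha hb hc hsum (by ring) h
        refine this.trans_eq ?_
        ring)
    have hmul := mul_le_mul_of_nonneg_left hdisc (show 0 ≤ a * c by positivity)
    have hexp : a * c * discrim (1 / a + 1 / b - 2 * β) (2 * (2 * β + 1 / b))
        (1 / c + 1 / b - 2 * β) = 2 * (4 * β * a + 4 * β * c) - 4 -
      1 / (β * b) * (4 * β * a + 4 * β * c - 2 * (4 * β * a * (4 * β * c))) := by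
      unfold discrim
      field_simp
      ring
    linarith
  have hs0 : 0 ≤ 1 / (β * b) := by positivity
  have hs : 1 / (β * b) < 2 / 3 := by
    rw [div_lt_div_iff₀ (by positivity) (by norm_num)]
    linarith
  have hst := (bcPhi_stationary_log ha hb hc hsum h).1
  have hβ4 : 4 * β ≠ 0 := by positivity
  have hla : log (4 * β * a) = log (4 * β) + log a := log_mul hβ4 ha.ne'
  have hlc : log (4 * β * c) = log (4 * β) + log c := log_mul hβ4 hc.ne'
  have h1 := not_lt_of_log_sub_eq (u := 4 * β * a) (v := 4 * β * c) (by positivity) hs0 hs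
    (by rw [hla, hlc]; linarith) hdet
  have h2 := not_lt_of_log_sub_eq (u := 4 * β * c) (v := 4 * β * a) (by positivity) hs0 hs
    (by rw [hla, hlc]; linarith) (by convert hdet using 2 <;> ring)
  have h3 : 4 * β * a = 4 * β * c := le_antisymm (not_lt.1 h2) (not_lt.1 h1)
  exact mul_left_cancel₀ hβ4 h3

/-- The bounds on the two rare species when a charged species dominates. -/
lemma rare_le_of_stationary {β lam a b c : ℝ} (hβ : 5 ≤ β) (ha : 0 < a) (hb : 0 < b) (hc : 0 < c)
    (hsum : a + b + c = 1) (hba : b ≤ a) (hca : c ≤ a)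
    (hac : log a + 4 * β * c = log c + 4 * β * a)
    (hab : log a + 4 * β * c = log b + (β * (1 - 2 * b) + lam))
    (hHac : 8 * β ≤ 1 / a + 1 / c) (hHab : 2 * β ≤ 1 / a + 1 / b) :
    c ≤ exp 6 * exp (-(4 * β)) ∧ b ≤ exp 6 * exp (-β - lam) := by
  have ha3 : 1 / a ≤ 3 := by
    rw [div_le_iff₀ ha]
    linarith
  have hla : log a ≤ 0 := log_nonpos ha.le (by linarith)
  have hcβ : 4 * β * c ≤ 1 := by
    have h1 : 4 * β ≤ 1 / c := by linarith
    rwa [le_div_iff₀ hc] at h1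
  have hbβ : β * b ≤ 1 := by
    have h1 : β ≤ 1 / b := by linarith
    rwa [le_div_iff₀ hb] at h1
  have hprod : β * a + β * b + β * c = β := by rw [← mul_add, ← mul_add, hsum, mul_one]
  rw [← exp_add, ← exp_add, ← log_le_iff_le_exp hc, ← log_le_iff_le_exp hb]
  constructor <;> linarith

/-- Local minima of the Blume-Capel mean-field free energy (Theorem 3.5 = "BCT1", first part). -/
theorem bc_local_minima :
    -- stationarity equations for every local minimum, at every `β ≥ 0`, `λ`
    (∀ β lam : ℝ, 0 ≤ β → ∀ p ∈ bcSimplex, IsLocalMinOn (bcPhi β lam) bcSimplex p →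
      (0 < p.1 ∧ 0 < p.2.1 ∧ 0 < p.2.2) ∧
      p.1 * Real.exp (4 * β * p.2.2) = p.2.2 * Real.exp (4 * β * p.1) ∧
      p.2.2 * Real.exp (4 * β * p.1) = p.2.1 * Real.exp (β * (1 - 2 * p.2.1) + lam)) ∧
    -- quantitative description of the local minima at low temperature
    ∃ β₀ C : ℝ, ∀ β lam : ℝ, β₀ ≤ β →
      ∀ p ∈ bcSimplex, IsLocalMinOn (bcPhi β lam) bcSimplex p →
        -- (1) `x₀` dominant
        ((p.1 ≤ p.2.1 ∧ p.2.2 ≤ p.2.1 →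
          p.1 = (1 - p.2.1) / 2 ∧ p.2.2 = (1 - p.2.1) / 2 ∧
          1 - p.2.1 ≤ C * Real.exp (-β + lam)) ∧
        -- (2) `x₁` dominant
        (p.2.1 ≤ p.1 ∧ p.2.2 ≤ p.1 →
          p.2.2 ≤ C * Real.exp (-(4 * β)) ∧ p.2.1 ≤ C * Real.exp (-β - lam)) ∧
        -- (2') `x₋₁` dominant
        (p.1 ≤ p.2.2 ∧ p.2.1 ≤ p.2.2 →
          p.1 ≤ C * Real.exp (-(4 * β)) ∧ p.2.1 ≤ C * Real.exp (-β - lam))) := by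
  refine ⟨?_, 5, exp 6, ?_⟩
  · rintro β lam hβ ⟨a, b, c⟩ hp h
    obtain ⟨ha, hb, hc⟩ := pos_of_isLocalMinOn_bcPhi hβ hp h
    obtain ⟨h1, h2⟩ := bcPhi_stationary_log ha hb hc hp.2.2.2 h
    have hmul {x : ℝ} (y : ℝ) (hx : 0 < x) : x * exp y = exp (log x + y) := by
      rw [exp_add, exp_log hx]
    refine ⟨⟨ha, hb, hc⟩, ?_, ?_⟩
    · simp only [hmul _ ha, hmul _ hc, h1]
    · simp only [hmul _ hb, hmul _ hc, h2]
  · rintro β lam hβ ⟨a, b, c⟩ hp h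
    obtain ⟨ha, hb, hc⟩ := pos_of_isLocalMinOn_bcPhi (by linarith) hp h
    have hsum : a + b + c = 1 := hp.2.2.2
    obtain ⟨h1, h2⟩ := bcPhi_stationary_log ha hb hc hsum h
    have hac := bcPhi_hessian_nonneg 1 0 (-1) ha hb hc hsum (by norm_num) h
    have hab := bcPhi_hessian_nonneg 1 (-1) 0 ha hb hc hsum (by norm_num) h
    have hbc := bcPhi_hessian_nonneg 0 (-1) 1 ha hb hc hsum (by norm_num) h
    norm_num only [zero_div, add_zero] at hac hab hbc
    simp only
    refine ⟨?_, ?_, ?_⟩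
    · rintro ⟨hab', hcb'⟩
      have heq : a = c := eq_of_isLocalMinOn_bcPhi (by linarith) ha hb hc hsum (by nlinarith) h
      subst heq
      have hbe : b = 1 - 2 * a := by linarith
      have hlog : log a = log b + (-β + lam) := by
        have : β * (1 - 2 * b) = -β + 4 * β * a := by rw [hbe]; ring
        linarith
      have ha' : a = b * exp (-β + lam) := by
        rw [← exp_log ha, hlog, exp_add, exp_log hb]
      have h6 : (2 : ℝ) ≤ exp 6 := by linarith [add_one_le_exp (6 : ℝ)]
      refine ⟨by linarith, by linarith, ?_⟩
      have hE := exp_pos (-β + lam)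
      nlinarith
    · rintro ⟨hba, hca⟩
      exact rare_le_of_stationary hβ ha hb hc hsum hba hca h1 (h1.trans h2)
        (by linarith) (by linarith)
    · rintro ⟨hac', hbc'⟩
      exact rare_le_of_stationary hβ hc hb ha (by linarith) hbc' hac' h1.symm h2
        (by linarith) (by linarith)
end
end

section
/- Let q ≥ 4 be an integer, β ≥ 0 and h < 0. Then Φ_{β,h}^{(q)} has at most one global minimizer on Δ_q satisfying x₁ < x₂ = x₃ = ... = x_q (a symmetric minimizer), and at most one global minimizer satisfying x₁ < x₂ = ... = x_{q−1} < x_q (an asymmetric minimizer). -/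
open Real Set

noncomputable section

/-- The symmetric form `x₁ < x₂ = x₃ = … = x_q`. -/
def SymMinForm (q : ℕ) [NeZero q] (x : Fin q → ℝ) : Prop :=
  (∀ j k : Fin q, j ≠ 0 → k ≠ 0 → x j = x k) ∧ (∀ k : Fin q, k ≠ 0 → x 0 < x k)

/-- The derivative of the Potts free energy along an affine line. -/
theorem hasDerivAt_pottsPhi_line {q : ℕ} [NeZero q] (β h : ℝ) (x v : Fin q → ℝ) {ε : ℝ}
    (hpos : ∀ k, 0 < x k + ε * v k) :
    HasDerivAt (fun ε => pottsPhi q β h fun k => x k + ε * v k)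
      (∑ k, v k * (log (x k + ε * v k) + 1 - β * (x k + ε * v k)) - h * v 0) ε := by
  have hlin : ∀ k, HasDerivAt (fun ε : ℝ => x k + ε * v k) (v k) ε := fun k => by
    simpa using ((hasDerivAt_id ε).mul_const (v k)).const_add (x k)
  unfold pottsPhi
  refine HasDerivAt.sub (HasDerivAt.fun_sum fun k _ => ?_) ((hlin 0).const_mul h)
  convert! (((hlin k).fun_pow 2).const_mul (-(β / 2))).fun_add
    ((hlin k).fun_mul ((hlin k).log (hpos k).ne')) using 1
  rw [mul_div_cancel₀ _ (hpos k).ne']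
  push_cast
  ring

/-- The second derivative of the Potts free energy along an affine line. -/
theorem hasDerivAt_deriv_pottsPhi_line {q : ℕ} (β h : ℝ) (x v : Fin q → ℝ) [NeZero q]
    (hpos : ∀ k, 0 < x k) :
    HasDerivAt
      (fun ε => ∑ k, v k * (log (x k + ε * v k) + 1 - β * (x k + ε * v k)) - h * v 0)
      (∑ k, v k ^ 2 * (1 / x k - β)) 0 := by
  have hlin : ∀ k, HasDerivAt (fun ε : ℝ => x k + ε * v k) (v k) 0 := fun k => by
    simpa using ((hasDerivAt_id (0 : ℝ)).mul_const (v k)).const_add (x k)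
  refine (HasDerivAt.fun_sum fun k _ => ?_).sub_const _
  have hne : x k + 0 * v k ≠ 0 := by simpa using (hpos k).ne'
  convert! ((((hlin k).log hne).add_const 1).fun_sub ((hlin k).const_mul β)).const_mul (v k) using 1
  simp only [zero_mul, add_zero]
  ring

theorem eventually_pos_line {q : ℕ} {x : Fin q → ℝ} (v : Fin q → ℝ) (hpos : ∀ k, 0 < x k) :
    ∀ᶠ ε in nhds (0 : ℝ), ∀ k, 0 < x k + ε * v k := by
  refine Filter.eventually_all.2 fun k => ?_
  have : ContinuousAt (fun ε : ℝ => x k + ε * v k) 0 := by fun_prop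
  exact this.eventually (lt_mem_nhds (by simpa using hpos k))

namespace IsPottsMinimizer

variable {q : ℕ} [NeZero q] {β h : ℝ} {x : Fin q → ℝ}

theorem isLocalMin_line (hx : IsPottsMinimizer q β h x) (hpos : ∀ k, 0 < x k) {v : Fin q → ℝ}
    (hv : ∑ k, v k = 0) : IsLocalMin (fun ε => pottsPhi q β h fun k => x k + ε * v k) 0 := by
  filter_upwards [eventually_pos_line v hpos] with ε hε
  simpa using hx.2 _ ⟨fun k => (hε k).le, by
    rw [Finset.sum_add_distrib, ← Finset.mul_sum, hv, hx.1.2]; simp⟩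

theorem sum_first_order_eq_zero (hx : IsPottsMinimizer q β h x) (hpos : ∀ k, 0 < x k)
    {v : Fin q → ℝ} (hv : ∑ k, v k = 0) :
    ∑ k, v k * (log (x k) + 1 - β * x k) - h * v 0 = 0 := by
  simpa using (hx.isLocalMin_line hpos hv).hasDerivAt_eq_zero
    (hasDerivAt_pottsPhi_line β h x v (ε := 0) (by simpa using hpos))

theorem sum_second_order_nonneg (hx : IsPottsMinimizer q β h x) (hpos : ∀ k, 0 < x k)
    {v : Fin q → ℝ} (hv : ∑ k, v k = 0) : 0 ≤ ∑ k, v k ^ 2 * (1 / x k - β) := by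
  set F : ℝ → ℝ := fun ε => pottsPhi q β h fun k => x k + ε * v k
  have hmin : IsLocalMin F 0 := hx.isLocalMin_line hpos hv
  have hd : deriv F =ᶠ[nhds 0]
      fun ε => ∑ k, v k * (log (x k + ε * v k) + 1 - β * (x k + ε * v k)) - h * v 0 := by
    filter_upwards [eventually_pos_line v hpos] with ε hε
    exact (hasDerivAt_pottsPhi_line β h x v hε).deriv
  have hdd : deriv (deriv F) 0 = ∑ k, v k ^ 2 * (1 / x k - β) := by
    rw [hd.deriv_eq, (hasDerivAt_deriv_pottsPhi_line β h x v hpos).deriv]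
  by_contra! hneg
  have hmax : IsLocalMax F 0 := isLocalMax_of_deriv_deriv_neg (hdd ▸ hneg) hmin.deriv_eq_zero
    (hasDerivAt_pottsPhi_line β h x v (by simpa using hpos)).continuousAt
  have hconst : F =ᶠ[nhds 0] fun _ => F 0 := by
    filter_upwards [hmin, hmax] with ε h₁ h₂ using le_antisymm h₂ h₁
  have : deriv (deriv F) 0 = 0 := by
    rw [hconst.deriv.deriv_eq]
    simp
  linarith

/-- Stationarity between two coordinates other than the first. -/
theorem log_sub_mul_eq (hx : IsPottsMinimizer q β h x) (hpos : ∀ k, 0 < x k) (i j : Fin q)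
    (hi : i ≠ 0) (hj : j ≠ 0) : log (x i) - β * x i = log (x j) - β * x j := by
  have := hx.sum_first_order_eq_zero hpos (v := Pi.single i 1 - Pi.single j 1) (by simp)
  simp [sub_mul, Pi.single_apply, hi.symm, hj.symm] at this
  linarith

/-- Stationarity between the first coordinate and another one. -/
theorem log_sub_mul_zero_eq (hx : IsPottsMinimizer q β h x) (hpos : ∀ k, 0 < x k) (j : Fin q)
    (hj : j ≠ 0) : log (x 0) - β * x 0 = log (x j) - β * x j + h := by
  have := hx.sum_first_order_eq_zero hpos (v := Pi.single 0 1 - Pi.single j 1) (by simp)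
  simp [sub_mul, Pi.single_apply, hj.symm] at this
  linarith

theorem two_mul_le_inv_add_inv (hx : IsPottsMinimizer q β h x) (hpos : ∀ k, 0 < x k)
    {i j : Fin q} (hij : i ≠ j) : 2 * β ≤ 1 / x i + 1 / x j := by
  have := hx.sum_second_order_nonneg hpos (v := Pi.single i 1 - Pi.single j 1) (by simp)
  have hv : ∀ k, (Pi.single i 1 - Pi.single j 1 : Fin q → ℝ) k ^ 2 =
      (Pi.single i 1 + Pi.single j 1 : Fin q → ℝ) k := fun k => by
    by_cases h₁ : k = i <;> by_cases h₂ : k = j <;> simp_all [Pi.single_apply]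
  simp only [hv] at this
  simp [add_mul, Finset.sum_add_distrib, Pi.single_apply] at this
  simp
  linarith

/-- If exactly one coordinate lies beyond the inflection point, the inverse curvatures have
nonpositive sum. -/
theorem sum_inv_curvature_nonpos (hx : IsPottsMinimizer q β h x) (hpos : ∀ k, 0 < x k)
    {l : Fin q} (hl : 1 / x l - β < 0) (hne : ∀ k, k ≠ l → 1 / x k - β ≠ 0) :
    ∑ k, (1 / x k - β)⁻¹ ≤ 0 := by
  set c : Fin q → ℝ := fun k => 1 / x k - β
  set D := ∑ k, (c k)⁻¹ with hD
  by_contra! hDpos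
  have key := hx.sum_second_order_nonneg hpos
    (v := fun k => (c k)⁻¹ - Pi.single (M := fun _ => ℝ) l D k)
    (by simp [Finset.sum_sub_distrib, ← hD])
  have hterm : ∀ k, ((c k)⁻¹ - Pi.single (M := fun _ => ℝ) l D k) ^ 2 * (1 / x k - β) =
      (c k)⁻¹ + Pi.single (M := fun _ => ℝ) l (-2 * D + c l * D ^ 2) k := fun k => by
    change _ ^ 2 * c k = _
    by_cases hk : k = l
    · subst hk
      have : c k ≠ 0 := hl.ne
      simp
      field_simp
      ring
    · have : c k ≠ 0 := hne k hk
      simp [hk]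
      field_simp
  simp only [hterm, Finset.sum_add_distrib, Finset.sum_pi_single', ← hD] at key
  simp at key
  have hcl : c l < 0 := hl
  nlinarith [mul_pos hDpos hDpos]

/-- A minimizer whose first coordinate is the strictly smallest one is interior. -/
theorem zero_coord_pos (hx : IsPottsMinimizer q β h x) {j : Fin q} (hj : j ≠ 0)
    (hxj : x 0 < x j) : 0 < x 0 := by
  refine (hx.1.1 0).lt_of_ne fun h0 => ?_
  rw [← h0] at hxj
  set φ : ℝ → ℝ := fun y => -(β / 2) * y ^ 2 + y * log y with hφ
  have hder : HasDerivAt (fun ε => φ (x j - ε)) (-(log (x j) + 1 - β * x j)) 0 := by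
    have hlin : HasDerivAt (fun ε : ℝ => x j - ε) (-1) 0 := by
      simpa using (hasDerivAt_id (0 : ℝ)).const_sub (x j)
    have hne : x j - 0 ≠ 0 := by simpa using hxj.ne'
    convert! ((hlin.fun_pow 2).const_mul (-(β / 2))).fun_add (hlin.fun_mul (hlin.log hne)) using 1
    rw [mul_div_cancel₀ _ hne]
    simp only [sub_zero]
    push_cast
    ring
  have hlim : Filter.Tendsto (fun ε : ℝ => log ε + (-(β / 2) * ε - h + ε⁻¹ * (φ (x j - ε) - φ (x j))))
      (nhdsWithin 0 (Ioi 0)) Filter.atBot := by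
    refine tendsto_log_nhdsGT_zero.atBot_add
      (C := (-(β / 2) * 0 - h + -(log (x j) + 1 - β * x j))) (Filter.Tendsto.add ?_ ?_)
    · exact ((by fun_prop : ContinuousAt (fun ε : ℝ => -(β / 2) * ε - h) 0).tendsto).mono_left
        nhdsWithin_le_nhds
    · simpa using hder.tendsto_slope_zero_right
  have hpos : ∀ᶠ ε : ℝ in nhdsWithin 0 (Ioi 0), 0 < ε ∧ ε < x j :=
    Ioo_mem_nhdsGT hxj
  obtain ⟨ε, hε, hεpos, hεj⟩ := ((hlim.eventually_lt_atBot 0).and hpos).exists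
  set v : Fin q → ℝ := Pi.single 0 ε - Pi.single j ε with hv
  have hv0 : v 0 = ε := by simp [hv, hj.symm]
  have hvj : v j = -ε := by simp [hv, hj]
  have hvk : ∀ k, k ≠ 0 → k ≠ j → v k = 0 := fun k h₁ h₂ => by simp [hv, h₁, h₂]
  have hmem : x + v ∈ pottsSimplex q := by
    refine ⟨fun k => ?_, by simp [Finset.sum_add_distrib, hx.1.2, hv]⟩
    by_cases h₁ : k = 0
    · subst h₁; simp [hv0, ← h0, hεpos.le]
    by_cases h₂ : k = j
    · subst h₂; simp [hvj, hεj.le]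
    simpa [hvk k h₁ h₂] using hx.1.1 k
  have hle := hx.2 _ hmem
  have hsum : ∑ k, (φ ((x + v) k) - φ (x k)) = φ ε + (φ (x j - ε) - φ (x j)) := by
    rw [Finset.sum_eq_add 0 j hj.symm]
    · simp [hv0, hvj, ← h0, hφ, sub_eq_add_neg]
    · rintro k - ⟨h₁, h₂⟩
      simp [hvk k h₁ h₂]
    · simp
    · simp
  rw [Finset.sum_sub_distrib] at hsum
  have hmain : 0 ≤ φ ε + (φ (x j - ε) - φ (x j)) - h * ε := by
    simp only [pottsPhi, Pi.add_apply, hv0, ← h0] at hle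
    simp only [hφ, Pi.add_apply] at hsum ⊢
    linarith
  have : φ ε + (φ (x j - ε) - φ (x j)) - h * ε =
      ε * (log ε + (-(β / 2) * ε - h + ε⁻¹ * (φ (x j - ε) - φ (x j)))) := by
    have : φ ε = -(β / 2) * ε ^ 2 + ε * log ε := rfl
    rw [this]
    field_simp
    ring
  nlinarith [mul_neg_of_pos_of_neg hεpos hε]

end IsPottsMinimizer

/-- On the two preimages `t < 1 < u` of a value of `y ↦ log y - y`, the inverse distances to the
critical point differ by at least `1 / 2`. -/
theorem inv_sub_one_add_half_le {t u : ℝ} (ht : 0 < t) (ht1 : t < 1) (hu : 1 < u)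
    (hut : log u - u = log t - t) : 1 / (u - 1) + 1 / 2 ≤ 1 / (1 - t) := by
  set ψ : ℝ → ℝ := fun t => log (3 - t) - log (1 + t) - log t - (4 / (1 + t) - 1) + t with hψ
  have hder : ∀ y ∈ Icc t 1, HasDerivAt ψ
      (-1 / (3 - y) - 1 / (1 + y) - 1 / y + 4 / (1 + y) ^ 2 + 1) y := fun y hy => by
    have hy0 : 0 < y := ht.trans_le hy.1
    have hy1 : y ≤ 1 := hy.2
    have h₁ : HasDerivAt (fun y : ℝ => 3 - y) (-1) y := by
      simpa using (hasDerivAt_id y).const_sub 3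
    have h₂ : HasDerivAt (fun y : ℝ => 1 + y) 1 y := by
      simpa using (hasDerivAt_id y).const_add 1
    convert! ((((h₁.log (by linarith)).fun_sub (h₂.log (by linarith))).fun_sub
      (hasDerivAt_log hy0.ne')).fun_sub (((h₂.fun_inv (by linarith)).const_mul 4).sub_const 1)).fun_add
      (hasDerivAt_id y) using 1
    ring
  have hanti : AntitoneOn ψ (Icc t 1) := by
    refine antitoneOn_of_hasDerivWithinAt_nonpos (convex_Icc t 1)
      (fun y hy => (hder y hy).continuousAt.continuousWithinAt)
      (fun y hy => (hder y (interior_subset hy)).hasDerivWithinAt) fun y hy => ?_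
    rw [interior_Icc] at hy
    have hy0 : 0 < y := ht.trans hy.1
    have hy1 : 0 < 1 - y := sub_pos.2 hy.2
    have h3 : 0 < 3 - y := by linarith
    have : -1 / (3 - y) - 1 / (1 + y) - 1 / y + 4 / (1 + y) ^ 2 + 1 =
        -((1 - y) ^ 2 * (3 + y ^ 2) / ((1 + y) ^ 2 * (3 - y) * y)) := by
      field_simp
      ring
    rw [this]
    exact neg_nonpos.2 (by positivity)
  have hψt : 0 ≤ ψ t := by
    have : ψ 1 ≤ ψ t := hanti ⟨le_rfl, ht1.le⟩ ⟨ht1.le, le_rfl⟩ ht1.le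
    have h1 : ψ 1 = 0 := by simp only [hψ]; norm_num
    linarith
  set w := (3 - t) / (1 + t) with hw
  have hw1 : 1 < w := by rw [hw, lt_div_iff₀ (by linarith)]; linarith
  have hwt : log t - t ≤ log w - w := by
    have h₁ : log w = log (3 - t) - log (1 + t) := log_div (by linarith) (by linarith)
    have h₂ : w = 4 / (1 + t) - 1 := by rw [hw]; field_simp; ring
    have : ψ t = log (3 - t) - log (1 + t) - log t - (4 / (1 + t) - 1) + t := rfl
    linarith
  have hwu : w ≤ u := by
    by_contra! hlt
    have h₁ : log (w / u) < w / u - 1 :=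
      log_lt_sub_one_of_pos (by positivity) (by rw [Ne, div_eq_one_iff_eq (by linarith)]; exact hlt.ne')
    rw [log_div (by linarith) (by linarith)] at h₁
    have : w / u - 1 ≤ w - u := by
      rw [div_sub_one (by linarith), div_le_iff₀ (by linarith)]
      nlinarith
    linarith
  have : 1 / (u - 1) ≤ 1 / (w - 1) := one_div_le_one_div_of_le (by linarith) (by linarith)
  have hw' : 1 / (w - 1) + 1 / 2 = 1 / (1 - t) := by
    have h₁ : w - 1 = 2 * (1 - t) / (1 + t) := by rw [hw]; field_simp; ring
    have h₂ : 1 - t ≠ 0 := by linarith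
    rw [h₁]
    field_simp
    ring
  linarith

/-- The cubic inequality behind the single sign change of the inverse-curvature sum. -/
theorem cubic_pos_of_sum_eq {a b k z : ℝ} (ha : 0 < a) (hb : 0 ≤ b) (hk : 2 ≤ k) (hz : 0 < z)
    (haz : z + 1 / 2 ≤ 1 + a) (hsum : b + k * a = 1 + z) :
    0 < b * (1 + b) ^ 2 + k * (a * (1 + a) ^ 2) - (1 + z) * z ^ 2 := by
  have hA : 0 < (1 + a) ^ 2 - z ^ 2 := by nlinarith
  have h₁ : 2 * a * ((1 + a) ^ 2 - z ^ 2) ≤ k * a * ((1 + a) ^ 2 - z ^ 2) := by gcongr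
  have h₀ : 0 < a * ((1 + a) ^ 2 - z ^ 2) := mul_pos ha hA
  rw [← hsum]
  rcases le_or_gt z 1 with hz1 | hz1
  · have : 0 ≤ b * ((1 + b) ^ 2 - z ^ 2) := mul_nonneg hb (by nlinarith)
    nlinarith
  · have hb2 : b ≤ 2 - z := by nlinarith
    have h₂ : -((2 - z) * (z ^ 2 - 1)) ≤ b * ((1 + b) ^ 2 - z ^ 2) := by
      have e₁ : b * (1 - z ^ 2) ≤ b * ((1 + b) ^ 2 - z ^ 2) := by gcongr; nlinarith
      nlinarith [mul_nonneg (sub_nonneg.2 hb2) (by nlinarith : (0 : ℝ) ≤ z ^ 2 - 1)]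
    have h₃ : 2 * (z - 1 / 2) * ((z + 1 / 2) ^ 2 - z ^ 2) ≤ 2 * a * ((1 + a) ^ 2 - z ^ 2) := by
      have : (z + 1 / 2) ^ 2 - z ^ 2 ≤ (1 + a) ^ 2 - z ^ 2 := by gcongr
      have h' : 0 ≤ (z + 1 / 2) ^ 2 - z ^ 2 := by nlinarith
      apply mul_le_mul _ this h' (by positivity)
      linarith
    nlinarith [mul_nonneg (by linarith : (0 : ℝ) ≤ 2 - z) (sq_nonneg (z - 1)), sq_nonneg (z - 1)]

theorem hasDerivAt_log_sub_id {y : ℝ} (hy : 0 < y) :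
    HasDerivAt (fun y => log y - y) ((1 - y) / y) y := by
  convert! (hasDerivAt_log hy.ne').fun_sub (hasDerivAt_id y) using 1
  field_simp

theorem strictMonoOn_log_sub_id : StrictMonoOn (fun y : ℝ => log y - y) (Ioc 0 1) := by
  refine strictMonoOn_of_deriv_pos (convex_Ioc 0 1)
    (fun y hy => (hasDerivAt_log_sub_id hy.1).continuousAt.continuousWithinAt) fun y hy => ?_
  rw [interior_Ioc] at hy
  rw [(hasDerivAt_log_sub_id hy.1).deriv]
  exact div_pos (sub_pos.2 hy.2) hy.1

theorem strictAntiOn_log_sub_id : StrictAntiOn (fun y : ℝ => log y - y) (Ici 1) := by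
  have hpos : ∀ y ∈ Ici (1 : ℝ), 0 < y := fun y hy => one_pos.trans_le hy
  refine strictAntiOn_of_deriv_neg (convex_Ici 1)
    (fun y hy => (hasDerivAt_log_sub_id (hpos y hy)).continuousAt.continuousWithinAt)
    fun y hy => ?_
  rw [(hasDerivAt_log_sub_id (hpos y (interior_subset hy))).deriv]
  rw [interior_Ici] at hy
  exact div_neg_of_neg_of_pos (sub_neg.2 hy) (one_pos.trans hy)

theorem log_sub_id_lt_neg_one {y : ℝ} (hy : 0 < y) (hy1 : y ≠ 1) : log y - y < -1 := by
  linarith [log_lt_sub_one_of_pos hy hy1]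

/-- The lower branch of the inverse of `y ↦ log y - y`. -/
theorem exists_lower_branch : ∃ T : ℝ → ℝ, ∀ l < -1, T l ∈ Ioo (0 : ℝ) 1 ∧
    log (T l) - T l = l ∧ HasDerivAt T (T l / (1 - T l)) l := by
  have hex : ∀ l : ℝ, ∃ t : ℝ, l < -1 → t ∈ Ioo (0 : ℝ) 1 ∧ log t - t = l := fun l => by
    by_cases hl : l < -1
    · have hexp : exp l < 1 := exp_lt_one_iff.2 (by linarith)
      obtain ⟨t, ht, htl⟩ := intermediate_value_Ioo (f := fun y => log y - y) hexp.le
        (fun y hy => (hasDerivAt_log_sub_id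
          ((exp_pos l).trans_le hy.1)).continuousAt.continuousWithinAt)
        (show l ∈ Ioo (log (exp l) - exp l) (log 1 - 1) by
          simp only [log_exp, log_one, mem_Ioo]; constructor <;> linarith [exp_pos l])
      exact ⟨t, fun _ => ⟨⟨(exp_pos l).trans ht.1, ht.2⟩, htl⟩⟩
    · exact ⟨0, fun h => absurd h hl⟩
  choose T hT using hex
  refine ⟨T, fun l hl => ⟨(hT l hl).1, (hT l hl).2, ?_⟩⟩
  have hmono : StrictMonoOn T (Iio (-1)) := fun a ha b hb hab => by
    by_contra! hle
    have := strictMonoOn_log_sub_id.monotoneOn (Ioo_subset_Ioc_self (hT b hb).1)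
      (Ioo_subset_Ioc_self (hT a ha).1) hle
    simp only [(hT b hb).2, (hT a ha).2] at this
    linarith
  have himage : Ioo (0 : ℝ) 1 ⊆ T '' Iio (-1) := fun t ht => by
    have hl : log t - t < -1 := log_sub_id_lt_neg_one ht.1 ht.2.ne
    exact ⟨log t - t, hl, strictMonoOn_log_sub_id.injOn (Ioo_subset_Ioc_self (hT _ hl).1)
      (Ioo_subset_Ioc_self ht) (hT _ hl).2⟩
  have hcont : ContinuousAt T l := hmono.continuousAt_of_image_mem_nhds (Iio_mem_nhds hl)
    (Filter.mem_of_superset (isOpen_Ioo.mem_nhds (hT l hl).1) himage)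
  have hne : 1 - T l ≠ 0 := by linarith [(hT l hl).1.2]
  rw [← inv_div]
  exact HasDerivAt.of_local_left_inverse hcont (hasDerivAt_log_sub_id (hT l hl).1.1)
    (div_ne_zero hne (hT l hl).1.1.ne')
    (Filter.mem_of_superset (Iio_mem_nhds hl) fun m hm => (hT m hm).2)

/-- The upper branch of the inverse of `y ↦ log y - y`. -/
theorem exists_upper_branch : ∃ U : ℝ → ℝ, ∀ l < -1, 1 < U l ∧
    log (U l) - U l = l ∧ HasDerivAt U (U l / (1 - U l)) l := by
  have hex : ∀ l : ℝ, ∃ u : ℝ, l < -1 → 1 < u ∧ log u - u = l := fun l => by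
    by_cases hl : l < -1
    · have hb : 1 < (2 * l) ^ 2 := by nlinarith
      have hlog : log ((2 * l) ^ 2) - (2 * l) ^ 2 < l := by
        have : log (-(2 * l)) ≤ -(2 * l) - 1 := log_le_sub_one_of_pos (by linarith)
        rw [log_pow, ← log_neg_eq_log]
        push_cast
        nlinarith
      obtain ⟨u, hu, hul⟩ := intermediate_value_Ioo' (f := fun y => log y - y) hb.le
        (fun y hy => (hasDerivAt_log_sub_id
          (one_pos.trans_le hy.1)).continuousAt.continuousWithinAt)
        (show l ∈ Ioo (log ((2 * l) ^ 2) - (2 * l) ^ 2) (log 1 - 1) from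
          ⟨hlog, by simpa using hl⟩)
      exact ⟨u, fun _ => ⟨hu.1, hul⟩⟩
    · exact ⟨0, fun h => absurd h hl⟩
  choose U hU using hex
  refine ⟨U, fun l hl => ⟨(hU l hl).1, (hU l hl).2, ?_⟩⟩
  have hanti : StrictAntiOn U (Iio (-1)) := fun a ha b hb hab => by
    by_contra! hle
    have := strictAntiOn_log_sub_id.antitoneOn (hU a ha).1.le (hU b hb).1.le hle
    simp only [(hU b hb).2, (hU a ha).2] at this
    linarith
  have himage : Iio (-1 : ℝ) ⊆ (-U) '' Iio (-1) := fun t ht => by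
    have ht1 : 1 < -t := lt_neg_of_lt_neg ht
    have hl : log (-t) - -t < -1 := log_sub_id_lt_neg_one (by linarith) ht1.ne'
    refine ⟨_, hl, ?_⟩
    have : U (log (-t) - -t) = -t :=
      strictAntiOn_log_sub_id.injOn (hU _ hl).1.le ht1.le (hU _ hl).2
    simp only [Pi.neg_apply, this, neg_neg]
  have hcont : ContinuousAt U l := by
    have hneg : ContinuousAt (-U) l := hanti.neg.continuousAt_of_image_mem_nhds (Iio_mem_nhds hl)
      (Filter.mem_of_superset (Iio_mem_nhds (by simpa using (hU l hl).1)) himage)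
    simpa using hneg.neg
  have hne : 1 - U l ≠ 0 := by linarith [(hU l hl).1]
  have hpos : 0 < U l := by linarith [(hU l hl).1]
  rw [← inv_div]
  exact HasDerivAt.of_local_left_inverse hcont (hasDerivAt_log_sub_id hpos)
    (div_ne_zero hne hpos.ne')
    (Filter.mem_of_superset (Iio_mem_nhds hl) fun m hm => (hU m hm).2)

/-- A function whose derivative `D` increases strictly through each of its zeros cannot take the
same value at two points where `D ≤ 0`. -/
theorem ne_of_deriv_pos_at_zeros {S D D' : ℝ → ℝ} {a b : ℝ} (hab : a < b)
    (hS : ∀ l ∈ Icc a b, HasDerivAt S (D l) l) (hD : ∀ l ∈ Icc a b, HasDerivAt D (D' l) l)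
    (hpos : ∀ l ∈ Icc a b, D l = 0 → 0 < D' l) (hb : D b ≤ 0) : S a ≠ S b := by
  intro hSab
  obtain ⟨m, hm, hDm⟩ := exists_hasDerivAt_eq_zero hab
    (fun l hl => (hS l hl).continuousAt.continuousWithinAt) hSab
    (fun l hl => hS l (Ioo_subset_Icc_self hl))
  have hsub : Icc m b ⊆ Icc a b := Icc_subset_Icc_left hm.1.le
  have hnonneg : ∀ l ∈ Icc m b, 0 ≤ D l := fun l hl => by
    have := image_le_of_deriv_right_lt_deriv_boundary (f := fun l => -D l) (f' := fun l => -D' l)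
      (B := fun _ => 0) (B' := fun _ => 0) (a := m) (b := b)
      (fun l hl => (hD l (hsub hl)).neg.continuousAt.continuousWithinAt)
      (fun l hl => (hD l (hsub (Ico_subset_Icc_self hl))).fun_neg.hasDerivWithinAt) (by simp [hDm])
      (fun l => hasDerivAt_const l _)
      (fun l hl h0 => neg_lt_zero.2
        (hpos l (hsub (Ico_subset_Icc_self hl)) (by simpa using h0))) hl
    simpa using this
  have hbm : b ∈ Icc m b := ⟨hm.2.le, le_rfl⟩
  have hDb : D b = 0 := le_antisymm hb (hnonneg b hbm)
  have hanti : D' b ≤ 0 := by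
    refine le_of_tendsto (hasDerivAt_iff_tendsto_slope_left_right.1 (hD b (hsub hbm))).1 ?_
    filter_upwards [Ioo_mem_nhdsLT hm.2] with l hl
    rw [slope_def_field, hDb]
    exact div_nonpos_of_nonneg_of_nonpos (by simpa using hnonneg l (Ioo_subset_Icc_self hl))
      (by linarith [hl.2])
  exact absurd (hpos b (hsub hbm) hDb) (not_lt.2 hanti)

/-- Along solutions of the rescaled asymmetric stationarity equations, the total mass distinguishes
the stable ones. -/
theorem asymmetric_mass_ne {k h s₁ t₁ u₁ s₂ t₂ u₂ : ℝ} (hk : 2 ≤ k) (hh : h < 0)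
    (hs₁ : s₁ ∈ Ioo (0 : ℝ) 1) (ht₁ : t₁ ∈ Ioo (0 : ℝ) 1) (hu₁ : 1 < u₁)
    (hs₂ : s₂ ∈ Ioo (0 : ℝ) 1) (ht₂ : t₂ ∈ Ioo (0 : ℝ) 1) (hu₂ : 1 < u₂)
    (hst₁ : log s₁ - s₁ = log t₁ - t₁ + h) (hut₁ : log u₁ - u₁ = log t₁ - t₁)
    (hst₂ : log s₂ - s₂ = log t₂ - t₂ + h) (hut₂ : log u₂ - u₂ = log t₂ - t₂)
    (hD₂ : s₂ / (1 - s₂) + k * (t₂ / (1 - t₂)) + u₂ / (1 - u₂) ≤ 0)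
    (hlt : log t₁ - t₁ < log t₂ - t₂) : s₁ + k * t₁ + u₁ ≠ s₂ + k * t₂ + u₂ := by
  obtain ⟨T, hT⟩ := exists_lower_branch
  obtain ⟨U, hU⟩ := exists_upper_branch
  have hTeq : ∀ {t l : ℝ}, t ∈ Ioo (0 : ℝ) 1 → log t - t = l → T l = t := fun {t l} ht hl => by
    have hl1 : l < -1 := hl ▸ log_sub_id_lt_neg_one ht.1 ht.2.ne
    exact strictMonoOn_log_sub_id.injOn (Ioo_subset_Ioc_self (hT l hl1).1)
      (Ioo_subset_Ioc_self ht) ((hT l hl1).2.1.trans hl.symm)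
  have hUeq : ∀ {u l : ℝ}, 1 < u → log u - u = l → U l = u := fun {u l} hu hl => by
    have hl1 : l < -1 := hl ▸ log_sub_id_lt_neg_one (by linarith) hu.ne'
    exact strictAntiOn_log_sub_id.injOn (hU l hl1).1.le hu.le ((hU l hl1).2.1.trans hl.symm)
  have hl₂ : log t₂ - t₂ < -1 := log_sub_id_lt_neg_one ht₂.1 ht₂.2.ne
  have hTshift : ∀ l < -1, HasDerivAt (fun l => T (l + h)) (T (l + h) / (1 - T (l + h))) l :=
    fun l hl => (hT (l + h) (by linarith)).2.2.comp_add_const l h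
  have hratio : ∀ {f : ℝ → ℝ} {l : ℝ}, f l ≠ 1 → HasDerivAt f (f l / (1 - f l)) l →
      HasDerivAt (fun l => f l / (1 - f l)) (f l / (1 - f l) * (1 / (1 - f l)) ^ 2) l :=
    fun {f l} hne hf => by
      have hne' : 1 - f l ≠ 0 := sub_ne_zero.2 hne.symm
      convert! hf.fun_div (hf.const_sub 1) hne' using 1
      field_simp
      ring
  have hmass := ne_of_deriv_pos_at_zeros (S := fun l => T (l + h) + k * T l + U l)
    (D := fun l => T (l + h) / (1 - T (l + h)) + k * (T l / (1 - T l)) + U l / (1 - U l))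
    (D' := fun l => T (l + h) / (1 - T (l + h)) * (1 / (1 - T (l + h))) ^ 2 +
      k * (T l / (1 - T l) * (1 / (1 - T l)) ^ 2) + U l / (1 - U l) * (1 / (1 - U l)) ^ 2)
    hlt
    (fun l hl => by
      have hl1 : l < -1 := hl.2.trans_lt hl₂
      exact ((hTshift l hl1).fun_add ((hT l hl1).2.2.const_mul k)).fun_add (hU l hl1).2.2)
    (fun l hl => by
      have hl1 : l < -1 := hl.2.trans_lt hl₂
      exact ((hratio (f := fun l => T (l + h)) (hT (l + h) (by linarith)).1.2.ne
        (hTshift l hl1)).fun_add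
        ((hratio (hT l hl1).1.2.ne (hT l hl1).2.2).const_mul k)).fun_add
        (hratio (hU l hl1).1.ne' (hU l hl1).2.2))
    (fun l hl hzero => by
      have hl1 : l < -1 := hl.2.trans_lt hl₂
      obtain ⟨⟨ht0, ht1⟩, hTl, -⟩ := hT l hl1
      obtain ⟨⟨hs0, hs1⟩, -, -⟩ := hT (l + h) (by linarith)
      obtain ⟨hu1, hUl, -⟩ := hU l hl1
      have hgap := inv_sub_one_add_half_le ht0 ht1 hu1 (hUl.trans hTl.symm)
      generalize T l = t at *
      generalize T (l + h) = s at *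
      generalize U l = u at *
      have et : 1 / (1 - t) = 1 + t / (1 - t) := by
        have : 1 - t ≠ 0 := by linarith
        field_simp; ring
      have es : 1 / (1 - s) = 1 + s / (1 - s) := by
        have : 1 - s ≠ 0 := by linarith
        field_simp; ring
      have eu : u / (1 - u) = -(1 + 1 / (u - 1)) := by
        have : 1 - u ≠ 0 := by linarith
        have : u - 1 ≠ 0 := by linarith
        field_simp; ring
      have eu' : 1 / (1 - u) = -(1 / (u - 1)) := by
        rw [← neg_sub u 1, one_div_neg_eq_neg_one_div]
      rw [et] at hgap ⊢
      rw [es, eu, eu']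
      rw [eu] at hzero
      have := cubic_pos_of_sum_eq (div_pos ht0 (sub_pos.2 ht1)) (div_pos hs0 (sub_pos.2 hs1)).le hk
        (div_pos one_pos (sub_pos.2 hu1)) hgap (by linarith)
      rw [neg_sq]
      linarith)
    (by
      rwa [hTeq hs₂ hst₂, hTeq ht₂ rfl, hUeq hu₂ hut₂])
  rwa [hTeq hs₂ hst₂, hTeq ht₂ rfl, hUeq hu₂ hut₂, hTeq hs₁ hst₁, hTeq ht₁ rfl,
    hUeq hu₁ hut₁] at hmass

/-- The rescaled asymmetric stationarity equations with fixed mass have at most one stable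
solution. -/
theorem asymmetric_unique {k h s₁ t₁ u₁ s₂ t₂ u₂ : ℝ} (hk : 2 ≤ k) (hh : h < 0)
    (hs₁ : s₁ ∈ Ioo (0 : ℝ) 1) (ht₁ : t₁ ∈ Ioo (0 : ℝ) 1) (hu₁ : 1 < u₁)
    (hs₂ : s₂ ∈ Ioo (0 : ℝ) 1) (ht₂ : t₂ ∈ Ioo (0 : ℝ) 1) (hu₂ : 1 < u₂)
    (hst₁ : log s₁ - s₁ = log t₁ - t₁ + h) (hut₁ : log u₁ - u₁ = log t₁ - t₁)
    (hst₂ : log s₂ - s₂ = log t₂ - t₂ + h) (hut₂ : log u₂ - u₂ = log t₂ - t₂)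
    (hD₁ : s₁ / (1 - s₁) + k * (t₁ / (1 - t₁)) + u₁ / (1 - u₁) ≤ 0)
    (hD₂ : s₂ / (1 - s₂) + k * (t₂ / (1 - t₂)) + u₂ / (1 - u₂) ≤ 0)
    (hmass : s₁ + k * t₁ + u₁ = s₂ + k * t₂ + u₂) : s₁ = s₂ ∧ t₁ = t₂ ∧ u₁ = u₂ := by
  rcases lt_trichotomy (log t₁ - t₁) (log t₂ - t₂) with hlt | heq | hgt
  · exact absurd hmass (asymmetric_mass_ne hk hh hs₁ ht₁ hu₁ hs₂ ht₂ hu₂ hst₁ hut₁ hst₂ hut₂ hD₂ hlt)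
  · exact ⟨strictMonoOn_log_sub_id.injOn (Ioo_subset_Ioc_self hs₁) (Ioo_subset_Ioc_self hs₂)
      (by simp only [hst₁, hst₂, heq]),
      strictMonoOn_log_sub_id.injOn (Ioo_subset_Ioc_self ht₁) (Ioo_subset_Ioc_self ht₂) heq,
      strictAntiOn_log_sub_id.injOn hu₁.le hu₂.le (by simp only [hut₁, hut₂, heq])⟩
  · exact absurd hmass.symm
      (asymmetric_mass_ne hk hh hs₂ ht₂ hu₂ hs₁ ht₁ hu₁ hst₂ hut₂ hst₁ hut₁ hD₁ hgt)

theorem strictConvexOn_log_one_add_sub_log {n : ℝ} (hn : 1 ≤ n) :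
    StrictConvexOn ℝ (Ico 0 (1 / n)) fun d => log (1 + d) - log (1 - n * d) := by
  have hn0 : 0 < n := by linarith
  have hlt : ∀ d ∈ Ico 0 (1 / n), 0 < 1 - n * d := fun d hd => by
    have := (lt_div_iff₀ hn0).1 hd.2
    linarith
  have hder : ∀ d ∈ Ico 0 (1 / n), HasDerivAt (fun d => log (1 + d) - log (1 - n * d))
      ((n + 1) / ((1 + d) * (1 - n * d))) d := fun d hd => by
    have h₁ : 0 < 1 + d := by linarith [hd.1]
    have h₂ := hlt d hd
    convert! (((hasDerivAt_id d).const_add 1).log h₁.ne').fun_sub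
      ((((hasDerivAt_id d).const_mul n).const_sub 1).log h₂.ne') using 1
    have := h₂.ne'
    simp only [id]
    field_simp
    ring
  refine StrictMonoOn.strictConvexOn_of_deriv (convex_Ico _ _)
    (fun d hd => (hder d hd).continuousAt.continuousWithinAt) fun a ha b hb hab => ?_
  have ha' := interior_subset ha
  have hb' := interior_subset hb
  rw [(hder a ha').deriv, (hder b hb').deriv]
  rw [interior_Ico] at ha hb
  have h₁ := hlt b hb'
  refine div_lt_div_of_pos_left (by linarith) (mul_pos (by linarith [hb.1]) h₁) ?_
  nlinarith [mul_nonneg (sub_nonneg.2 hn) (sub_nonneg.2 hab.le),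
    mul_pos (mul_pos hn0 (sub_pos.2 hab)) (add_pos ha.1 hb.1)]

/-- The symmetric stationarity equation has at most one solution with `s < t`. -/
theorem symmetric_unique {n β h s₁ t₁ s₂ t₂ : ℝ} (hn : 1 ≤ n) (hh : h < 0)
    (hs₁ : 0 < s₁) (hst₁ : s₁ < t₁) (hsum₁ : s₁ + n * t₁ = 1)
    (heq₁ : log s₁ - β * s₁ = log t₁ - β * t₁ + h)
    (hs₂ : 0 < s₂) (hst₂ : s₂ < t₂) (hsum₂ : s₂ + n * t₂ = 1)
    (heq₂ : log s₂ - β * s₂ = log t₂ - β * t₂ + h) : t₁ = t₂ := by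
  wlog hlt : t₁ < t₂ generalizing s₁ t₁ s₂ t₂
  · rcases lt_or_eq_of_le (not_lt.1 hlt) with h' | h'
    · exact (this hs₂ hst₂ hsum₂ heq₂ hs₁ hst₁ hsum₁ heq₁ h').symm
    · exact h'.symm
  exfalso
  have hn0 : 0 < n := by linarith
  have hmem : ∀ {s t : ℝ}, 0 < s → s < t → s + n * t = 1 → t - s ∈ Ico 0 (1 / n) :=
    fun {s t} hs hst hsum => by
      refine ⟨by linarith, ?_⟩
      rw [lt_div_iff₀ hn0]
      nlinarith
  have hL : ∀ {s t : ℝ}, 0 < s → s < t → s + n * t = 1 →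
      log (1 + (t - s)) - log (1 - n * (t - s)) = log t - log s := fun {s t} hs hst hsum => by
    have h₁ : 1 + (t - s) = (n + 1) * t := by linarith
    have h₂ : 1 - n * (t - s) = (n + 1) * s := by linarith
    rw [h₁, h₂, log_mul (by linarith) (by linarith), log_mul (by linarith) (by linarith)]
    ring
  have hd : t₁ - s₁ < t₂ - s₂ := by nlinarith
  have hd₁ : 0 < t₁ - s₁ := sub_pos.2 hst₁
  have hd₂ : 0 < t₂ - s₂ := sub_pos.2 hst₂
  have key := (strictConvexOn_log_one_add_sub_log hn).secant_strict_mono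
    (a := 0) ⟨le_rfl, by positivity⟩ (hmem hs₁ hst₁ hsum₁) (hmem hs₂ hst₂ hsum₂)
    hd₁.ne' hd₂.ne' hd
  simp only [hL hs₁ hst₁ hsum₁, hL hs₂ hst₂ hsum₂, add_zero, mul_zero, sub_zero, log_one,
    div_lt_div_iff₀ hd₁ hd₂] at key
  have e₁ : log t₁ - log s₁ = β * (t₁ - s₁) - h := by linarith
  have e₂ : log t₂ - log s₂ = β * (t₂ - s₂) - h := by linarith
  rw [e₁, e₂] at key
  nlinarith

theorem sum_eq_of_const_on_ne_zero {q : ℕ} [NeZero q] (f : Fin q → ℝ) (c : ℝ)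
    (hf : ∀ k, k ≠ 0 → f k = c) : ∑ k, f k = f 0 + (q - 1) * c := by
  have : ∀ k, f k = c + Pi.single (M := fun _ => ℝ) 0 (f 0 - c) k := fun k => by
    by_cases hk : k = 0
    · subst hk; simp
    · simp [hk, hf k hk]
  rw [Finset.sum_congr rfl fun k _ => this k]
  simp [Finset.sum_add_distrib]
  ring

theorem sum_eq_of_const_on_mid {q : ℕ} [NeZero q] (hq : 2 ≤ q) (f : Fin q → ℝ) (c : ℝ)
    (hf : ∀ k, IsMid q k → f k = c) : ∑ k, f k = f 0 + (q - 2) * c + f (lastIdx q) := by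
  have hl : lastIdx q ≠ 0 := by
    rw [Ne, Fin.ext_iff]
    simp [lastIdx]
    omega
  have : ∀ k, f k = c + Pi.single (M := fun _ => ℝ) 0 (f 0 - c) k +
      Pi.single (M := fun _ => ℝ) (lastIdx q) (f (lastIdx q) - c) k := fun k => by
    by_cases hk : k = 0
    · subst hk; simp [hl.symm]
    by_cases hk' : k = lastIdx q
    · subst hk'; simp [hl]
    · simp [hk, hk', hf k ⟨hk, hk'⟩]
  rw [Finset.sum_congr rfl fun k _ => this k]
  simp [Finset.sum_add_distrib]
  ring

/-- The rescaled stationarity and stability relations of an asymmetric minimizer. -/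
theorem IsPottsMinimizer.asymmetric_relations {q : ℕ} [NeZero q] (hq : 4 ≤ q) {β h : ℝ}
    (hβ : 0 ≤ β) {x : Fin q → ℝ} (hx : IsPottsMinimizer q β h x) (hform : AsymForm q x)
    {m : Fin q} (hm : IsMid q m) :
    0 < β ∧ β * x 0 ∈ Ioo (0 : ℝ) 1 ∧ β * x m ∈ Ioo (0 : ℝ) 1 ∧ 1 < β * x (lastIdx q) ∧
    log (β * x 0) - β * x 0 = log (β * x m) - β * x m + h ∧
    log (β * x (lastIdx q)) - β * x (lastIdx q) = log (β * x m) - β * x m ∧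
    β * x 0 / (1 - β * x 0) + (q - 2) * (β * x m / (1 - β * x m)) +
      β * x (lastIdx q) / (1 - β * x (lastIdx q)) ≤ 0 ∧
    β * x 0 + (q - 2) * (β * x m) + β * x (lastIdx q) = β := by
  obtain ⟨hconst, hlow, hhigh⟩ := hform
  have hq2 : 2 ≤ q := by omega
  have hl : lastIdx q ≠ 0 := by
    rw [Ne, Fin.ext_iff]
    simp [lastIdx]
    omega
  have h0lt : ∀ k, k ≠ 0 → x 0 < x k := fun k hk => by
    by_cases hk' : k = lastIdx q
    · exact hk' ▸ (hlow m hm).trans (hhigh m hm)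
    · exact hlow k ⟨hk, hk'⟩
  have hpos0 : 0 < x 0 := hx.zero_coord_pos hm.1 (h0lt m hm.1)
  have hpos : ∀ k, 0 < x k := fun k => by
    by_cases hk : k = 0
    · exact hk ▸ hpos0
    · exact hpos0.trans (h0lt k hk)
  have hlm := hx.log_sub_mul_eq hpos _ _ hl hm.1
  have h0m := hx.log_sub_mul_zero_eq hpos _ hm.1
  have hmu := hhigh m hm
  have hβpos : 0 < β := by
    refine hβ.lt_of_ne fun h0 => ?_
    rw [← h0] at hlm
    have := log_lt_log (hpos m) hmu
    linarith
  have hscale : ∀ k, log (β * x k) = log β + log (x k) := fun k =>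
    log_mul hβpos.ne' (hpos k).ne'
  have hbpos : ∀ k, 0 < β * x k := fun k => mul_pos hβpos (hpos k)
  have hut : log (β * x (lastIdx q)) - β * x (lastIdx q) = log (β * x m) - β * x m := by
    rw [hscale, hscale]
    linarith
  have hmu' : β * x m < β * x (lastIdx q) := mul_lt_mul_of_pos_left hmu hβpos
  obtain ⟨m', hm', hne⟩ : ∃ m', IsMid q m' ∧ m ≠ m' := by
    have h₁ : IsMid q ⟨1, by omega⟩ := by
      constructor <;> simp [lastIdx, Fin.ext_iff]
      omega
    have h₂ : IsMid q ⟨2, by omega⟩ := by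
      constructor <;> simp [lastIdx, Fin.ext_iff]
      omega
    by_cases hm1 : m = ⟨1, by omega⟩
    · exact ⟨_, h₂, by rw [hm1]; simp⟩
    · exact ⟨_, h₁, hm1⟩
  have ht_le : β * x m ≤ 1 := by
    have := hx.two_mul_le_inv_add_inv hpos hne
    rw [hconst m' m hm' hm] at this
    exact (le_div_iff₀ (hpos m)).1 (by linarith)
  have hu : 1 < β * x (lastIdx q) := by
    by_contra! hle
    exact hmu'.ne' (strictMonoOn_log_sub_id.injOn ⟨hbpos _, hle⟩ ⟨hbpos m, ht_le⟩ hut)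
  have ht : β * x m < 1 := by
    refine ht_le.lt_of_ne fun h1 => ?_
    exact hmu'.ne' (strictAntiOn_log_sub_id.injOn hu.le h1.ge hut)
  have hs : β * x 0 < 1 := (mul_lt_mul_of_pos_left (hlow m hm) hβpos).trans ht
  have hcurv : ∀ k, 1 / x k - β = (1 - β * x k) / x k := fun k => by
    have := (hpos k).ne'
    field_simp
  have hD := hx.sum_inv_curvature_nonpos hpos (l := lastIdx q)
    (by rw [hcurv]; exact div_neg_of_neg_of_pos (by linarith) (hpos _))
    (fun k hk => by
      rw [hcurv]
      refine (div_pos ?_ (hpos k)).ne'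
      by_cases hk0 : k = 0
      · rw [hk0]; linarith
      · rw [hconst k m ⟨hk0, hk⟩ hm]; linarith)
  simp only [hcurv, inv_div] at hD
  rw [sum_eq_of_const_on_mid hq2 _ (x m / (1 - β * x m))
    fun k hk => by rw [hconst k m hk hm]] at hD
  refine ⟨hβpos, ⟨hbpos 0, hs⟩, ⟨hbpos m, ht⟩, hu, ?_, hut, ?_, ?_⟩
  · rw [hscale, hscale]
    linarith
  · have := mul_nonpos_of_nonneg_of_nonpos hβ hD
    simp only [mul_div_assoc]
    linarith
  · have := hx.1.2
    rw [sum_eq_of_const_on_mid hq2 _ (x m) fun k hk => hconst k m hk hm] at this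
    linear_combination β * this

/-- At negative fields there is at most one symmetric and at most one asymmetric
global minimizer (Corollary 5.8). -/
theorem potts_at_most_one_minimizer (q : ℕ) [NeZero q] (hq : 4 ≤ q)
    (β h : ℝ) (hβ : 0 ≤ β) (hh : h < 0) :
    (∀ x y : Fin q → ℝ, IsPottsMinimizer q β h x → SymMinForm q x →
      IsPottsMinimizer q β h y → SymMinForm q y → x = y) ∧
    (∀ x y : Fin q → ℝ, IsPottsMinimizer q β h x → AsymForm q x →
      IsPottsMinimizer q β h y → AsymForm q y → x = y) := by
  have hq' : (4 : ℝ) ≤ q := by exact_mod_cast hq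
  have h1mid : IsMid q ⟨1, by omega⟩ := by
    constructor <;> simp [lastIdx, Fin.ext_iff]
    omega
  set m : Fin q := ⟨1, by omega⟩
  refine ⟨fun x y hx hfx hy hfy => ?_, fun x y hx hfx hy hfy => ?_⟩
  · have hsol : ∀ z : Fin q → ℝ, IsPottsMinimizer q β h z → SymMinForm q z →
        0 < z 0 ∧ z 0 < z m ∧ z 0 + (q - 1) * z m = 1 ∧
        log (z 0) - β * z 0 = log (z m) - β * z m + h := fun z hz hfz => by
      have hpos0 := hz.zero_coord_pos h1mid.1 (hfz.2 m h1mid.1)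
      have hpos : ∀ k, 0 < z k := fun k => by
        by_cases hk : k = 0
        · exact hk ▸ hpos0
        · exact hpos0.trans (hfz.2 k hk)
      exact ⟨hpos0, hfz.2 m h1mid.1,
        (sum_eq_of_const_on_ne_zero z (z m) fun k hk => hfz.1 k m hk h1mid.1) ▸ hz.1.2,
        hz.log_sub_mul_zero_eq hpos m h1mid.1⟩
    obtain ⟨hs₁, hst₁, hsum₁, heq₁⟩ := hsol x hx hfx
    obtain ⟨hs₂, hst₂, hsum₂, heq₂⟩ := hsol y hy hfy
    have ht : x m = y m :=
      symmetric_unique (by linarith) hh hs₁ hst₁ hsum₁ heq₁ hs₂ hst₂ hsum₂ heq₂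
    ext k
    by_cases hk : k = 0
    · subst hk
      rw [ht] at hsum₁
      linarith
    · rw [hfx.1 k m hk h1mid.1, hfy.1 k m hk h1mid.1, ht]
  · obtain ⟨hβpos, hs₁, ht₁, hu₁, hst₁, hut₁, hD₁, hm₁⟩ :=
      hx.asymmetric_relations hq hβ hfx h1mid
    obtain ⟨-, hs₂, ht₂, hu₂, hst₂, hut₂, hD₂, hm₂⟩ := hy.asymmetric_relations hq hβ hfy h1mid
    obtain ⟨hs, ht, hu⟩ := asymmetric_unique (by linarith) hh hs₁ ht₁ hu₁ hs₂ ht₂ hu₂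
      hst₁ hut₁ hst₂ hut₂ hD₁ hD₂ (hm₁.trans hm₂.symm)
    ext k
    refine mul_left_cancel₀ hβpos.ne' ?_
    by_cases hk : k = 0
    · rw [hk, hs]
    by_cases hk' : k = lastIdx q
    · rw [hk', hu]
    · rw [hfx.1 k m ⟨hk, hk'⟩ h1mid, hfy.1 k m ⟨hk, hk'⟩ h1mid, ht]
end
end
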